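/- arXiv:2206.04290 — 4 statements merged into one kernel-verified Lean document; each statement's English description precedes it below -/
import Mathlib

section
/- Let d be an integer with d ≡ 4 (mod 12), let c be a nonzero integer, and let f(z) = z^d + 1/c ∈ ℚ[z]. If f is irreducible over ℚ, then f is stable over ℚ, i.e., every iterate fⁿ (n ≥ 1) is irreducible over ℚ. -/
open Polynomial
open IntermediateField

universe u

lemma norm_sub_gen {F E : Type*} [Field F] [Field E] [Algebra F E] (x : E) (hx : IsIntegral F x) (r : F) :
    Algebra.norm F (algebraMap F F⟮x⟯ r - AdjoinSimple.gen F x) = (minpoly F x).eval r := by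
  have hfd : FiniteDimensional F F⟮x⟯ := adjoin.finiteDimensional hx
  have h1 : (LinearMap.charpoly (Algebra.lmul F F⟮x⟯ (AdjoinSimple.gen F x))) = minpoly F x := by
    have := charpoly_leftMulMatrix (adjoin.powerBasis hx)
    rw [adjoin.powerBasis_gen] at this
    rw [← minpoly_gen F x, ← this, ← LinearMap.charpoly_toMatrix _ (adjoin.powerBasis hx).basis]
    rfl
  rw [← h1, LinearMap.eval_charpoly, Algebra.norm_apply]
  congr 1
  ext y
  simp [Algebra.smul_def, sub_mul]

lemma capelli (d : ℕ) : ∀ {F : Type u} [Field F] (a : F), 0 < d →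
    (∀ p : ℕ, p.Prime → p ∣ d → ∀ b : F, b ^ p ≠ a) → (∀ b : F, b ^ 2 ≠ -a) →
    Irreducible (X ^ d - C a) := by
  induction d using Nat.strong_induction_on with
  | _ d ih =>
  intro F _ a hd h1 h2
  by_cases hd1 : d = 1
  · subst hd1; rw [pow_one]; exact irreducible_X_sub_C a
  obtain ⟨p, hp, m, rfl⟩ := Nat.exists_prime_and_dvd hd1
  have hm : 0 < m := Nat.pos_of_mul_pos_left hd
  have hmlt : m < p * m := by nlinarith [hp.two_le]
  have hirr : Irreducible (X ^ m - C a) :=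
    ih m hmlt a hm (fun q hq hqd => h1 q hq (Dvd.dvd.mul_left hqd p)) h2
  have := irreducible_comp (monic_X_pow_sub_C a hm.ne') (monic_X_pow (R := F) p) hirr ?_
  · simpa [pow_mul] using this
  intro E _ _ x hx
  rw [Polynomial.map_pow, map_X]
  have hinteg : IsIntegral F x := by
    by_contra hcon
    rw [minpoly.eq_zero hcon] at hx
    exact X_pow_sub_C_ne_zero hm a hx.symm
  have hfd : FiniteDimensional F F⟮x⟯ := adjoin.finiteDimensional hinteg
  have hN := norm_sub_gen x hinteg 0
  rw [hx, map_zero, zero_sub] at hN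
  simp only [eval_sub, eval_pow, eval_X, eval_C, zero_pow hm.ne', zero_sub] at hN
  have hfr : Module.finrank F F⟮x⟯ = m := by
    rw [adjoin.finrank hinteg, hx, natDegree_X_pow_sub_C]
  apply X_pow_sub_C_irreducible_of_prime hp
  intro b hb
  have hNn : Algebra.norm F (-1 : F⟮x⟯) = (-1) ^ m := by
    have := Algebra.norm_algebraMap (S := F⟮x⟯) (-1 : F)
    rw [hfr] at this
    simpa using this
  have hN2 : (-1) ^ m * (Algebra.norm F b) ^ p = -a := by
    rw [← hN, ← hNn, ← map_pow, ← map_mul, hb]; simp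
  rcases hp.eq_two_or_odd' with rfl | hodd
  · rcases Nat.even_or_odd m with he | ho
    · rw [he.neg_one_pow, one_mul] at hN2
      exact h2 _ hN2
    · rw [ho.neg_one_pow] at hN2
      exact h1 2 hp (Dvd.intro _ rfl) (Algebra.norm F b) (by linear_combination -hN2)
  · rcases Nat.even_or_odd m with he | ho
    · rw [he.neg_one_pow, one_mul] at hN2
      exact h1 p hp (Dvd.intro _ rfl) (-Algebra.norm F b) (by rw [hodd.neg_pow, hN2, neg_neg])
    · rw [ho.neg_one_pow] at hN2
      exact h1 p hp (Dvd.intro _ rfl) (Algebra.norm F b) (by linear_combination -hN2)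

lemma iter_comm {k : Type} [Field k] (f : k[X]) (n : ℕ) :
    (f.comp ·)^[n+1] X = ((f.comp ·)^[n] X).comp f := by
  induction n with
  | zero => simp
  | succ n ih =>
    rw [Function.iterate_succ_apply', ih, ← comp_assoc, ← Function.iterate_succ_apply' (f.comp ·), ih]

lemma iter_monic {k : Type} [Field k] (d : ℕ) (hd : 0 < d) (r : k) (n : ℕ) :
    (((X ^ d + C r : k[X]).comp ·)^[n] X).Monic := by
  induction n with
  | zero => simp [monic_X]
  | succ n ih =>
    rw [iter_comm]
    apply ih.comp (monic_X_pow_add_C r hd.ne')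
    rw [natDegree_X_pow_add_C]; exact hd.ne'

lemma iter_eval {k : Type} [Field k] (d : ℕ) (r : k) (n : ℕ) :
    (((X ^ d + C r : k[X]).comp ·)^[n] X).eval r = (fun z : k => z ^ d + r)^[n+1] 0 ∨ d = 0 := by
  rcases Nat.eq_zero_or_pos d with h | hd
  · right; exact h
  left
  induction n with
  | zero => simp [hd.ne']
  | succ n ih =>
    rw [Function.iterate_succ_apply', Function.iterate_succ_apply', ← ih]
    simp

lemma base_irr {k : Type} [Field k] (d : ℕ) (hd : 0 < d) (hd2 : 2 ∣ d) (r : k) (hirr : Irreducible (X ^ d + C r : k[X]))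
    (K : Type) [Field K] [Algebra k K] (g : K) (hg : g ^ 2 = - algebraMap k K r)
    (hK : Module.finrank k K = 2) : Irreducible (X ^ (d / 2) - C g) := by
  obtain ⟨e, rfl⟩ := hd2
  rw [Nat.mul_div_cancel_left _ (by norm_num)]
  have he : 0 < e := by omega
  have hfK : FiniteDimensional k K := Module.finite_of_finrank_pos (by omega)
  obtain ⟨α, hα⟩ := IsAlgClosed.exists_aeval_eq_zero (AlgebraicClosure K) (X ^ e - C g)
    (by rw [degree_X_pow_sub_C he]; exact_mod_cast he.ne')
  have hα' : α ^ e = algebraMap K _ g := by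
    simpa [sub_eq_zero] using hα
  have hinteg : IsIntegral K α := ⟨X ^ e - C g, monic_X_pow_sub_C g he.ne', by simpa using hα⟩
  have hfd : FiniteDimensional K K⟮α⟯ := adjoin.finiteDimensional hinteg
  have hfq : FiniteDimensional k K⟮α⟯ := FiniteDimensional.trans k K K⟮α⟯
  have h1 : minpoly k (AdjoinSimple.gen K α) = X ^ (2 * e) + C r := by
    symm
    apply minpoly.eq_of_irreducible_of_monic hirr _ (monic_X_pow_add_C r hd.ne')
    have : (AdjoinSimple.gen K α) ^ e = algebraMap K _ g := by
      apply (algebraMap K⟮α⟯ (AlgebraicClosure K)).injective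
      rw [map_pow, AdjoinSimple.algebraMap_gen, hα']
      rfl
    simp only [map_add, map_pow, aeval_X, aeval_C]
    rw [mul_comm, pow_mul, this, ← map_pow, hg, map_neg, ← IsScalarTower.algebraMap_apply]
    simp
  have h2 : 2 * e ≤ Module.finrank k K⟮α⟯ := by
    have := minpoly.natDegree_le (A := k) (AdjoinSimple.gen K α)
    rwa [h1, natDegree_X_pow_add_C] at this
  rw [← Module.finrank_mul_finrank k K K⟮α⟯, hK, adjoin.finrank hinteg] at h2
  have h3 : minpoly K α = X ^ e - C g := by
    symm
    apply eq_of_monic_of_dvd_of_natDegree_le (minpoly.monic hinteg) (monic_X_pow_sub_C g he.ne')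
    · apply minpoly.dvd; exact hα
    · rw [natDegree_X_pow_sub_C]; omega
  rw [← h3]
  exact minpoly.irreducible hinteg

lemma G_irr {k : Type} [Field k] (d : ℕ) (hd : 0 < d) (hd4 : 4 ∣ d) (r : k) (hirr : Irreducible (X ^ d + C r : k[X]))
    (K : Type) [Field K] [Algebra k K] (g : K) (hg : g ^ 2 = - algebraMap k K r)
    (hK : Module.finrank k K = 2)
    (H : ∀ n : ℕ, 1 ≤ n → ∀ p : ℕ, p.Prime → p ∣ d → ∀ b : K,
      b ^ p ≠ algebraMap k K (((fun z : k => z ^ d + r)^[n] 0) ^ (d / 2)) - g) (m : ℕ) :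
    Irreducible (((((X ^ d + C r : k[X]).comp ·)^[m] X) ^ (d / 2)).map (algebraMap k K) - C g) := by
  induction m with
  | zero => simpa using base_irr d hd (dvd_trans (by norm_num) hd4) r hirr K g hg hK
  | succ m ih =>
    have hd2 : 0 < d / 2 := by omega
    set F : k[X] := ((X ^ d + C r : k[X]).comp ·)^[m] X with hF
    have hFm : F.Monic := iter_monic d hd r m
    have hFd : 0 < F.natDegree := by
      rw [hF]; clear ih hFm hF F
      induction m with
      | zero => simp
      | succ m ih =>
        rw [iter_comm, natDegree_comp, natDegree_X_pow_add_C]; positivity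
    set G : K[X] := (F ^ (d/2)).map (algebraMap k K) - C g with hG
    have hFpm : ((F ^ (d/2)).map (algebraMap k K)).Monic := (hFm.pow _).map _
    have hFpd : ((F ^ (d/2)).map (algebraMap k K)).natDegree = d / 2 * F.natDegree := by
      rw [natDegree_map, natDegree_pow]
    have hGm : G.Monic := by
      apply hFpm.sub_of_left
      apply lt_of_le_of_lt degree_C_le
      rw [← natDegree_pos_iff_degree_pos, hFpd]; positivity
    have hGd : G.natDegree = d / 2 * F.natDegree := by
      rw [hG, natDegree_sub_C, hFpd]
    have hGe : Even G.natDegree := by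
      rw [hGd]; apply Even.mul_right; rw [even_iff_two_dvd]; omega
    have key : Irreducible (G.comp (X ^ d + C (algebraMap k K r))) := by
      apply irreducible_comp hGm (monic_X_pow_add_C _ hd.ne') ih
      intro E _ _ x hx
      have hinteg : IsIntegral K x := by
        by_contra hcon
        rw [minpoly.eq_zero hcon] at hx
        exact hGm.ne_zero hx.symm
      have hfd : FiniteDimensional K K⟮x⟯ := adjoin.finiteDimensional hinteg
      have hfr : Module.finrank K K⟮x⟯ = G.natDegree := by
        rw [adjoin.finrank hinteg, hx]
      set a : K⟮x⟯ := AdjoinSimple.gen K x - algebraMap K K⟮x⟯ (algebraMap k K r) with ha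
      have hNa : Algebra.norm K (-a) = algebraMap k K (((fun z : k => z ^ d + r)^[m+1] 0) ^ (d / 2)) - g := by
        rw [ha, neg_sub, norm_sub_gen x hinteg, hx, hG]
        rw [eval_sub, eval_C, eval_map_algebraMap, aeval_algebraMap_apply_eq_algebraMap_eval,
          eval_pow, hF, (iter_eval d r m).resolve_right hd.ne']
      have hNa' : Algebra.norm K a = Algebra.norm K (-a) := by
        have : Algebra.norm K (-1 : K⟮x⟯) = 1 := by
          have := Algebra.norm_algebraMap (S := K⟮x⟯) (-1 : K)
          rw [hfr, hGe.neg_one_pow] at this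
          simpa using this
        rw [neg_eq_neg_one_mul, map_mul, this, one_mul]
      have e1 : (X ^ d + C (algebraMap k K r)).map (algebraMap K K⟮x⟯) - C (AdjoinSimple.gen K x)
          = X ^ d - C a := by
        simp [ha]
        ring
      rw [e1]
      apply capelli d a hd
      · intro p hp hpd b hb
        apply H (m+1) (by omega) p hp hpd (Algebra.norm K b)
        rw [← hNa, ← hNa', ← hb, map_pow]
      · intro b hb
        apply H (m+1) (by omega) 2 Nat.prime_two (dvd_trans (by norm_num) hd4) (Algebra.norm K b)
        rw [← hNa, ← hb, map_pow]
    convert key using 1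
    rw [iter_comm, ← hF, hG]
    simp [Polynomial.map_comp]

lemma tower {k : Type} [Field k] (d : ℕ) (hd : 0 < d) (hd4 : 4 ∣ d) (r : k) (hirr : Irreducible (X ^ d + C r : k[X]))
    (H : ∀ (K : Type) [Field K] [Algebra k K] (g : K), g ^ 2 = - algebraMap k K r →
      Module.finrank k K = 2 → ∀ n : ℕ, 1 ≤ n → ∀ p : ℕ, p.Prime → p ∣ d → ∀ b : K,
      b ^ p ≠ algebraMap k K (((fun z : k => z ^ d + r)^[n] 0) ^ (d / 2)) - g) (n : ℕ) (hn : 1 ≤ n) :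
    Irreducible (((X ^ d + C r : k[X]).comp ·)^[n] X) := by
  obtain ⟨m, rfl⟩ : ∃ m, n = m + 1 := ⟨n - 1, by omega⟩
  have hd2 : d / 2 * 2 = d := by omega
  have hsq : Irreducible (X ^ 2 + C r : k[X]) := by
    have := X_pow_sub_C_irreducible_of_prime (K := k) Nat.prime_two (a := -r) ?_
    · simpa using this
    · have h : Irreducible (X ^ d - C (-r) : k[X]) := by simpa using hirr
      exact pow_ne_of_irreducible_X_pow_sub_C h (by omega) (by norm_num)
  set F : k[X] := ((X ^ d + C r : k[X]).comp ·)^[m] X with hF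
  have key : Irreducible ((X ^ 2 + C r : k[X]).comp (F ^ (d / 2))) := by
    apply irreducible_comp (monic_X_pow_add_C r (by norm_num)) ((iter_monic d hd r m).pow _) hsq
    intro E _ _ x hx
    have hinteg : IsIntegral k x := by
      by_contra hcon
      rw [minpoly.eq_zero hcon] at hx
      exact (monic_X_pow_add_C r (by norm_num : 2 ≠ 0)).ne_zero hx.symm
    have hfd : FiniteDimensional k k⟮x⟯ := adjoin.finiteDimensional hinteg
    have hfr : Module.finrank k k⟮x⟯ = 2 := by
      rw [adjoin.finrank hinteg, hx, natDegree_X_pow_add_C]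
    have hg : (AdjoinSimple.gen k x) ^ 2 = - algebraMap k k⟮x⟯ r := by
      have := minpoly.aeval k (AdjoinSimple.gen k x)
      rw [minpoly_gen, hx] at this
      simp only [map_add, map_pow, aeval_X, aeval_C] at this
      exact eq_neg_of_add_eq_zero_left this
    exact G_irr d hd hd4 r hirr k⟮x⟯ _ hg hfr (H k⟮x⟯ (AdjoinSimple.gen k x) hg hfr) m
  convert key using 1
  rw [Function.iterate_succ_apply', ← hF]
  simp [← pow_mul, hd2]

lemma tower_rat (d : ℕ) (hd : 0 < d) (hd4 : 4 ∣ d) (r : ℚ) (hirr : Irreducible (X ^ d + C r : ℚ[X]))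
    (H : ∀ (K : Type) [Field K] [NumberField K] (g : K), g ^ 2 = - algebraMap ℚ K r →
      Module.finrank ℚ K = 2 → ∀ n : ℕ, 1 ≤ n → ∀ p : ℕ, p.Prime → p ∣ d → ∀ b : K,
      b ^ p ≠ algebraMap ℚ K (((fun z : ℚ => z ^ d + r)^[n] 0) ^ (d / 2)) - g) (n : ℕ) (hn : 1 ≤ n) :
    Irreducible (((X ^ d + C r : ℚ[X]).comp ·)^[n] X) := by
  apply tower d hd hd4 r hirr _ n hn
  intro K _ inst g hg hK
  have hcz : CharZero K := charZero_of_injective_algebraMap (algebraMap ℚ K).injective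
  obtain rfl : inst = DivisionRing.toRatAlgebra := Subsingleton.elim _ _
  have hfd : FiniteDimensional ℚ K := Module.finite_of_finrank_pos (by omega)
  have hnf : NumberField K := { to_charZero := hcz, to_finiteDimensional := hfd }
  exact H K g hg hK

lemma zs_norm (α : ℤ√(-3)) : α.norm = α.re ^ 2 + 3 * α.im ^ 2 := by
  rw [Zsqrtd.norm_def]; ring

lemma zs_dvd_norm (δ : ℤ√(-3)) : δ ∣ ((δ.norm : ℤ) : ℤ√(-3)) := by
  rw [Zsqrtd.norm_eq_mul_conj]; exact Dvd.intro _ rfl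

lemma zs_prim_right {α δ ε : ℤ√(-3)} (h : α = δ * ε) (hc : IsCoprime α.re α.im) :
    IsCoprime ε.re ε.im := by
  obtain ⟨u, v, huv⟩ := hc
  rw [h] at huv
  simp only [Zsqrtd.re_mul, Zsqrtd.im_mul] at huv
  exact ⟨u * δ.re + v * δ.im, -3 * u * δ.im + v * δ.re, by linear_combination huv⟩

lemma exists_small_rep (a z : ℤ) (hz : 0 < z) (ho : Odd z) : ∃ k : ℤ, 2 * |a - z * k| < z := by
  obtain ⟨j, rfl⟩ := ho
  refine ⟨(a + j) / (2 * j + 1), ?_⟩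
  have h1 := Int.emod_add_mul_ediv (a + j) (2 * j + 1)
  have h2 := Int.emod_nonneg (a + j) hz.ne'
  have h3 := Int.emod_lt_of_pos (a + j) hz
  have h4 : a - (2 * j + 1) * ((a + j) / (2 * j + 1)) = (a + j) % (2 * j + 1) - j := by
    linear_combination -h1
  rw [h4]
  have : |(a + j) % (2 * j + 1) - j| ≤ j := by rw [abs_le]; constructor <;> linarith
  linarith

lemma zs_descent (N : ℕ) : ∀ (z : ℤ), z.natAbs = N → 0 < z → Odd z → ∀ α : ℤ√(-3),
    IsCoprime α.re α.im → z ∣ α.norm → ∃ δ : ℤ√(-3), δ ∣ α ∧ δ.norm = z := by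
  induction N using Nat.strong_induction_on with
  | _ N ih =>
  intro z hzN hz hodd α hc hdvd
  by_cases hz1 : z = 1
  · exact ⟨1, one_dvd _, by rw [hz1]; simp⟩
  obtain ⟨k, hk⟩ := exists_small_rep α.re z hz hodd
  obtain ⟨l, hl⟩ := exists_small_rep α.im z hz hodd
  set α' : ℤ√(-3) := α - (z : ℤ√(-3)) * ⟨k, l⟩ with hα'
  have hre : α'.re = α.re - z * k := by simp [hα']
  have him : α'.im = α.im - z * l := by simp [hα']
  rw [← hre] at hk
  rw [← him] at hl
  -- it suffices to find a divisor
  suffices h : ∃ δ : ℤ√(-3), δ ∣ α' ∧ δ.norm = z by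
    obtain ⟨δ, h1, h2⟩ := h
    refine ⟨δ, ?_, h2⟩
    have h3 : δ ∣ (z : ℤ√(-3)) := by rw [← h2]; exact zs_dvd_norm δ
    have : α = α' + (z : ℤ√(-3)) * ⟨k, l⟩ := by rw [hα']; ring
    rw [this]
    exact dvd_add h1 (h3.mul_right _)
  have hcz : IsCoprime (Int.gcd α'.re α'.im : ℤ) z := by
    obtain ⟨u, v, huv⟩ := hc
    have h1 : (Int.gcd α'.re α'.im : ℤ) ∣ α'.re := Int.gcd_dvd_left ..
    have h2 : (Int.gcd α'.re α'.im : ℤ) ∣ α'.im := Int.gcd_dvd_right ..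
    obtain ⟨s, hs⟩ := h1
    obtain ⟨t, ht⟩ := h2
    refine ⟨u * s + v * t, u * k + v * l, ?_⟩
    linear_combination huv - u * hs - v * ht + u * hre + v * him
  have hg0 : Int.gcd α'.re α'.im ≠ 0 := by
    intro h
    rw [h] at hcz
    have := isCoprime_zero_left.mp (by simpa using hcz)
    rcases Int.isUnit_iff.mp this with h | h <;> omega
  have hgpos : 0 < Int.gcd α'.re α'.im := Nat.pos_of_ne_zero hg0
  obtain ⟨β, hβ1, hβ2⟩ : ∃ β : ℤ√(-3), α' = ((Int.gcd α'.re α'.im : ℤ) : ℤ√(-3)) * β ∧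
      IsCoprime β.re β.im := by
    obtain ⟨s, t, hs, h1, h2⟩ := Int.exists_gcd_one hgpos
    refine ⟨⟨s, t⟩, ?_, Int.isCoprime_iff_gcd_eq_one.mpr hs⟩
    ext
    · simpa [mul_comm] using h1
    · simpa [mul_comm] using h2
  set g : ℤ := (Int.gcd α'.re α'.im : ℤ) with hg
  have hgp : 1 ≤ g := by omega
  suffices h : ∃ δ : ℤ√(-3), δ ∣ β ∧ δ.norm = z by
    obtain ⟨δ, h1, h2⟩ := h
    exact ⟨δ, by rw [hβ1]; exact h1.mul_left _, h2⟩
  have hn1 : α'.norm = g ^ 2 * β.norm := by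
    rw [hβ1, Zsqrtd.norm_mul, Zsqrtd.norm_intCast]; ring
  have hzβ : z ∣ β.norm := by
    have h1 : z ∣ α'.norm := by
      rw [zs_norm] at hdvd ⊢
      rw [hre, him]
      obtain ⟨w, hw⟩ := hdvd
      exact ⟨w - 2 * α.re * k + z * k ^ 2 - 6 * α.im * l + 3 * z * l ^ 2, by linear_combination hw⟩
    rw [hn1] at h1
    exact (hcz.symm.pow_right).dvd_of_dvd_mul_left h1
  obtain ⟨w, hw⟩ := hzβ
  have hβpos : 0 < β.norm := by
    rw [zs_norm]
    have : β.re ≠ 0 ∨ β.im ≠ 0 := by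
      by_contra hcon
      push Not at hcon
      rw [hcon.1, hcon.2] at hβ2
      have := isCoprime_zero_left.mp hβ2
      simp at this
    rcases this with h | h <;> positivity
  have hwpos : 0 < w := by
    rw [hw] at hβpos; exact pos_of_mul_pos_right hβpos hz.le
  have hwz : w < z := by
    have h1 : 4 * α'.re ^ 2 < z ^ 2 := by
      have : (2 * |α'.re|) ^ 2 < z ^ 2 := by gcongr
      rw [mul_pow, sq_abs] at this; linarith
    have h2 : 4 * α'.im ^ 2 < z ^ 2 := by
      have : (2 * |α'.im|) ^ 2 < z ^ 2 := by gcongr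
      rw [mul_pow, sq_abs] at this; linarith
    have h3 : α'.norm < z ^ 2 := by rw [zs_norm]; linarith
    have h4 : β.norm ≤ α'.norm := by rw [hn1]; exact le_mul_of_one_le_left hβpos.le (one_le_pow₀ hgp)
    have : z * w < z * z := by rw [← hw]; nlinarith
    exact lt_of_mul_lt_mul_left this hz.le
  rcases Int.even_or_odd w with hwe | hwo
  · -- even case
    have hpar : Odd β.re ∧ Odd β.im := by
      have h1 : Even (β.re ^ 2 + 3 * β.im ^ 2) := by
        rw [← zs_norm, hw]; exact hwe.mul_left z
      obtain ⟨u, v, huv⟩ := hβ2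
      rcases Int.even_or_odd β.re with h | h <;> rcases Int.even_or_odd β.im with h' | h'
      · exfalso
        have : Even (1 : ℤ) := by rw [← huv]; exact (h.mul_left _).add (h'.mul_left _)
        exact absurd this (by decide)
      · exfalso
        rw [Int.even_add] at h1
        have := (h1.mp (h.pow_of_ne_zero (by norm_num)))
        exact absurd this (Int.not_even_iff_odd.mpr (Odd.mul (by decide) h'.pow))
      · exfalso
        rw [Int.even_add] at h1
        have := h1.mpr ((h'.pow_of_ne_zero (by norm_num)).mul_left 3)
        exact absurd this (Int.not_even_iff_odd.mpr h.pow)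
      · exact ⟨h, h'⟩
    obtain ⟨⟨a, ha⟩, ⟨b, hb⟩⟩ := hpar
    obtain ⟨s, hs, q, hq⟩ : ∃ s : ℤ, s ^ 2 = 1 ∧ ∃ q, β.re + s * β.im = 4 * q := by
      rcases Int.even_or_odd (a + b) with ⟨q, hq⟩ | ⟨q, hq⟩
      · exact ⟨-1, by norm_num, q - b, by rw [ha, hb]; linear_combination 2 * hq⟩
      · exact ⟨1, by norm_num, q + 1, by rw [ha, hb]; linear_combination 2 * hq⟩
    set γ : ℤ√(-3) := ⟨q - s * β.im, s * q⟩ with hγ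
    have hβγ : β = ⟨1, -s⟩ * γ := by
      ext
      · simp only [hγ, Zsqrtd.re_mul]
        linear_combination hq - 3 * q * hs
      · simp only [hγ, Zsqrtd.im_mul]
        linear_combination -β.im * hs
    have hγc := zs_prim_right hβγ hβ2
    have hnorm : β.norm = 4 * γ.norm := by
      rw [hβγ, Zsqrtd.norm_mul, zs_norm ⟨1, -s⟩]; linear_combination 3 * γ.norm * hs
    have hγodd : Odd γ.norm := by
      have h8 : β.norm = 8 * ((a^2+a+3*b^2+3*b) / 2) + 4 := by
        have : 2 ∣ a^2+a+3*b^2+3*b := by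
          have h1 := Int.even_mul_succ_self a
          have h2 := Int.even_mul_succ_self b
          have : a^2+a+3*b^2+3*b = a * (a+1) + 3 * (b * (b+1)) := by ring
          rw [this]
          exact (h1.add (h2.mul_left 3)).two_dvd
        rw [zs_norm, ha, hb]
        have := Int.mul_ediv_cancel' this
        linear_combination -4 * this
      exact ⟨(a^2+a+3*b^2+3*b) / 2, by linarith⟩
    obtain ⟨w3, hw3⟩ : 4 ∣ w := by
      have : (4 : ℤ) ∣ z * w := by rw [← hw, hnorm]; exact Dvd.intro _ rfl
      have hco : IsCoprime (4 : ℤ) z := by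
        obtain ⟨j, hj⟩ := hodd
        have h2 : IsCoprime (2 : ℤ) z := ⟨-j, 1, by rw [hj]; ring⟩
        have := h2.pow_left (m := 2)
        norm_num at this; exact this
      exact hco.dvd_of_dvd_mul_left this
    have hγn : γ.norm = z * w3 := by
      have : 4 * γ.norm = 4 * (z * w3) := by rw [← hnorm, hw, hw3]; ring
      linarith
    have hw3pos : 0 < w3 := by omega
    have hw3odd : Odd w3 := by
      rw [hγn, Int.odd_mul] at hγodd; exact hγodd.2
    obtain ⟨δ, ⟨ε, hε⟩, h2⟩ := ih w3.natAbs (by omega) w3 rfl hw3pos hw3odd γ hγc ⟨z, by rw [hγn]; ring⟩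
    refine ⟨ε, ?_, ?_⟩
    · rw [hβγ, hε]; exact (Dvd.intro_left _ rfl).mul_left _
    · have h3 : γ.norm = w3 * ε.norm := by rw [hε, Zsqrtd.norm_mul, h2]
      have : w3 * ε.norm = w3 * z := by rw [← h3, hγn]; ring
      exact mul_left_cancel₀ hw3pos.ne' this
  · obtain ⟨δ, ⟨ε, hε⟩, h2⟩ := ih w.natAbs (by omega) w rfl hwpos hwo β hβ2 ⟨z, by rw [hw]; ring⟩
    refine ⟨ε, ?_, ?_⟩
    · rw [hε]; exact Dvd.intro_left _ rfl
    · have h3 : β.norm = w * ε.norm := by rw [hε, Zsqrtd.norm_mul, h2]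
      have : w * ε.norm = w * z := by rw [← h3, hw]; ring
      exact mul_left_cancel₀ hwpos.ne' this

lemma zs_unique {α δ ε : ℤ√(-3)} {z : ℤ} (hz : 0 < z) (hc : IsCoprime α.re α.im)
    (h1 : δ ∣ α) (h2 : ε ∣ α) (hδ : δ.norm = z) (hε : ε.norm = z) : ε = δ ∨ ε = -δ := by
  obtain ⟨x, hx⟩ := h1
  obtain ⟨y, hy⟩ := h2
  have hxr : α.re = _ := congrArg Zsqrtd.re hx
  have hxi : α.im = _ := congrArg Zsqrtd.im hx
  have hyr : α.re = _ := congrArg Zsqrtd.re hy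
  have hyi : α.im = _ := congrArg Zsqrtd.im hy
  simp only [Zsqrtd.re_mul, Zsqrtd.im_mul] at hxr hxi hyr hyi
  rw [zs_norm] at hδ hε
  set m := δ.re
  set n := δ.im
  set m2 := ε.re
  set n2 := ε.im
  set a := α.re
  set b := α.im
  have e1 : b * m - a * n = z * x.im := by
    rw [hxr, hxi, ← hδ]; ring
  have e2 : b * m2 - a * n2 = z * y.im := by
    rw [hyr, hyi, ← hε]; ring
  obtain ⟨u, v, huv⟩ := hc
  obtain ⟨k, hk⟩ : z ∣ m * n2 - n * m2 :=
    ⟨u * (m2 * x.im - m * y.im) + v * (n2 * x.im - n * y.im), by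
      linear_combination (u * m2 + v * n2) * e1 - (u * m + v * n) * e2 - (m * n2 - n * m2) * huv⟩
  have e3 : (m * m2 + 3 * n * n2) ^ 2 + 3 * (m * n2 - n * m2) ^ 2 = z ^ 2 := by
    rw [sq z]; nth_rw 1 [← hδ]; rw [← hε]; ring
  have hk0 : k = 0 := by
    by_contra hne
    have : 1 ≤ k ^ 2 := by
      have : 0 < k ^ 2 := by positivity
      omega
    rw [hk] at e3
    nlinarith [sq_nonneg (m * m2 + 3 * n * n2), mul_pos hz hz]
  rw [hk0, mul_zero] at hk
  rw [hk] at e3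
  have e4 : (m * m2 + 3 * n * n2) ^ 2 = z ^ 2 := by linarith
  rcases sq_eq_sq_iff_eq_or_eq_neg.mp e4 with h | h
  · left
    ext
    · apply mul_left_cancel₀ hz.ne'
      change z * m2 = z * m
      linear_combination -m2 * hδ + m * h - 3 * n * hk
    · apply mul_left_cancel₀ hz.ne'
      change z * n2 = z * n
      linear_combination -n2 * hδ + n * h + m * hk
  · right
    ext
    · apply mul_left_cancel₀ hz.ne'
      rw [Zsqrtd.re_neg]
      change z * m2 = z * -m
      linear_combination -m2 * hδ + m * h - 3 * n * hk
    · apply mul_left_cancel₀ hz.ne'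
      rw [Zsqrtd.im_neg]
      change z * n2 = z * -n
      linear_combination -n2 * hδ + n * h + m * hk

lemma euler_cubes (a b z : ℤ) (hc : IsCoprime a b) (ho : Odd z) (h : a ^ 2 + 3 * b ^ 2 = z ^ 3) :
    ∃ m n : ℤ, a = m ^ 3 - 9 * m * n ^ 2 ∧ b = 3 * m ^ 2 * n - 3 * n ^ 3 := by
  have hz : 0 < z := by
    have h1 : 0 ≤ z ^ 3 := by rw [← h]; positivity
    have h2 : z ≠ 0 := by rintro rfl; exact absurd ho (by decide)
    have h3 : 0 ≤ z := by
      by_contra hneg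
      push Not at hneg
      have := Odd.pow_neg (by decide : Odd 3) hneg
      omega
    omega
  set α : ℤ√(-3) := ⟨a, b⟩ with hα
  have hN : α.norm = z ^ 3 := by rw [zs_norm, ← h]
  obtain ⟨δ, ⟨α1, h1⟩, hδ⟩ := zs_descent _ z rfl hz ho α hc ⟨z ^ 2, by rw [hN]; ring⟩
  have hc1 := zs_prim_right h1 hc
  have hN1 : α1.norm = z ^ 2 := by
    apply mul_left_cancel₀ hz.ne'
    have : α.norm = δ.norm * α1.norm := by rw [h1, Zsqrtd.norm_mul]
    rw [hδ, hN] at this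
    linear_combination -this
  obtain ⟨ε, ⟨θ, h2⟩, hε⟩ := zs_descent _ z rfl hz ho α1 hc1 ⟨z, by rw [hN1]; ring⟩
  have hθ : θ.norm = z := by
    apply mul_left_cancel₀ hz.ne'
    have : α1.norm = ε.norm * θ.norm := by rw [h2, Zsqrtd.norm_mul]
    rw [hε, hN1] at this
    linear_combination -this
  have hfac : α = δ * ε * θ := by rw [h1, h2]; ring
  have d1 : δ ∣ α := ⟨α1, h1⟩
  have d2 : ε ∣ α := ⟨δ * θ, by rw [hfac]; ring⟩
  have d3 : θ ∣ α := ⟨δ * ε, by rw [hfac]; ring⟩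
  have hcube : ∃ μ : ℤ√(-3), α = μ ^ 3 := by
    rcases zs_unique hz hc d1 d2 hδ hε with r2 | r2 <;>
    rcases zs_unique hz hc d1 d3 hδ hθ with r3 | r3
    · exact ⟨δ, by rw [hfac, r2, r3]; ring⟩
    · exact ⟨-δ, by rw [hfac, r2, r3]; ring⟩
    · exact ⟨-δ, by rw [hfac, r2, r3]; ring⟩
    · exact ⟨δ, by rw [hfac, r2, r3]; ring⟩
  obtain ⟨μ, hμ⟩ := hcube
  refine ⟨μ.re, μ.im, ?_, ?_⟩
  · have : α.re = _ := congrArg Zsqrtd.re hμ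
    rw [pow_succ, pow_two] at this
    simp only [Zsqrtd.re_mul, Zsqrtd.im_mul] at this
    change a = _ at this
    rw [this]; ring
  · have : α.im = _ := congrArg Zsqrtd.im hμ
    rw [pow_succ, pow_two] at this
    simp only [Zsqrtd.re_mul, Zsqrtd.im_mul] at this
    change b = _ at this
    rw [this]; ring

lemma cop_right {a b b' : ℤ} (h : IsCoprime a b) (e : b' = b) : IsCoprime a b' := e ▸ h

lemma cop_left {a a' b : ℤ} (h : IsCoprime a b) (e : a' = a) : IsCoprime a' b := e ▸ h

lemma cubes4_mod9 (x y z : ℤ) (h : x ^ 3 + y ^ 3 = 4 * z ^ 3) : 3 ∣ z ∧ 3 ∣ x + y := by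
  have h9 : (x : ZMod 9) ^ 3 + (y : ZMod 9) ^ 3 = 4 * (z : ZMod 9) ^ 3 := by exact_mod_cast congrArg (Int.cast : ℤ → ZMod 9) h
  have key : ∀ x y z : ZMod 9, x ^ 3 + y ^ 3 = 4 * z ^ 3 → 3 * z = 0 ∧ 3 * (x + y) = 0 := by decide
  obtain ⟨h1, h2⟩ := key _ _ _ h9
  have h1' : ((3 * z : ℤ) : ZMod 9) = 0 := by exact_mod_cast h1
  have h2' : ((3 * (x + y) : ℤ) : ZMod 9) = 0 := by exact_mod_cast h2
  rw [ZMod.intCast_zmod_eq_zero_iff_dvd] at h1' h2'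
  constructor <;> omega

lemma coprime_two_of_odd {a : ℤ} (h : Odd a) : IsCoprime a 2 := by
  obtain ⟨j, hj⟩ := h
  exact ⟨1, -j, by rw [hj]; ring⟩

lemma cubes4 (N : ℕ) : ∀ x y z : ℤ, z.natAbs = N → IsCoprime x y → x ^ 3 + y ^ 3 = 4 * z ^ 3 → z = 0 := by
  induction N using Nat.strong_induction_on with
  | _ N ih =>
  intro x y z hzN hc h
  obtain ⟨⟨Z, hZ⟩, h3⟩ := cubes4_mod9 x y z h
  have hpar : Even (x + y) := by
    have h1 : Even (x ^ 3 + y ^ 3) := by rw [h]; exact ⟨2 * z ^ 3, by ring⟩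
    rw [Int.even_add, Int.even_pow' (by norm_num), Int.even_pow' (by norm_num)] at h1
    rwa [Int.even_add]
  have hxodd : Odd x := by
    rw [← Int.not_even_iff_odd]
    intro hx
    have hy : Even y := by rw [Int.even_add] at hpar; exact hpar.mp hx
    obtain ⟨u, v, huv⟩ := hc
    have : Even (1 : ℤ) := by rw [← huv]; exact (hx.mul_left _).add (hy.mul_left _)
    exact absurd this (by decide)
  obtain ⟨p, hp⟩ := hpar.two_dvd
  obtain ⟨P, hP⟩ : 3 ∣ p := by omega
  set q := x - p with hq
  have hx : x = 3 * P + q := by rw [hq]; linarith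
  have hy : y = 3 * P - q := by linarith
  have e1 : P * (3 * P ^ 2 + q ^ 2) = 6 * Z ^ 3 := by
    rw [hx, hy, hZ] at h; linarith
  have hcPq : IsCoprime (3 * P) q := by
    rw [hx, hy] at hc
    obtain ⟨u, v, huv⟩ := hc
    exact ⟨u + v, u - v, by linear_combination huv⟩
  have hc3q : IsCoprime 3 q := hcPq.of_mul_left_left
  have hcP : IsCoprime P q := hcPq.of_mul_left_right
  have hpe : 2 ∣ P := by
    by_contra hodd
    have hPo : Odd P := by rw [← Int.not_even_iff_odd, even_iff_two_dvd]; exact hodd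
    have hqe : Even q := by
      rw [hx] at hxodd
      by_contra hqo
      rw [Int.not_even_iff_odd] at hqo
      have : Even (3 * P + q) := (Odd.mul (by decide) hPo).add_odd hqo
      exact (Int.not_even_iff_odd.mpr hxodd) this
    have : Odd (P * (3 * P ^ 2 + q ^ 2)) :=
      hPo.mul ((Odd.mul (by decide) hPo.pow).add_even (hqe.pow_of_ne_zero (by norm_num)))
    rw [e1] at this
    exact (Int.not_even_iff_odd.mpr this) ⟨3 * Z ^ 3, by ring⟩
  have hp3 : 3 ∣ P := by
    have h1 : (3 : ℤ) ∣ P * (3 * P ^ 2 + q ^ 2) := by rw [e1]; exact ⟨2 * Z ^ 3, by ring⟩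
    have h2 : IsCoprime 3 (3 * P ^ 2 + q ^ 2) := by
      have := (hc3q.pow_right (n := 2)).add_mul_left_right (P ^ 2)
      rwa [add_comm] at this
    exact h2.dvd_of_dvd_mul_right h1
  obtain ⟨W, hW⟩ : 6 ∣ P := by omega
  have hqo : Odd q := by
    rw [← Int.not_even_iff_odd]
    intro hqe
    rw [hx, hW] at hxodd
    have : Even (3 * (6 * W) + q) := Even.add ⟨9 * W, by ring⟩ hqe
    exact (Int.not_even_iff_odd.mpr hxodd) this
  have e2 : W * (q ^ 2 + 108 * W ^ 2) = Z ^ 3 := by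
    rw [hW] at e1; linarith
  have hcW : IsCoprime W q := by rw [hW] at hcP; exact hcP.of_mul_left_right
  have hcW2 : IsCoprime W (q ^ 2 + 108 * W ^ 2) := by
    have := (hcW.pow_right (n := 2)).add_mul_left_right (108 * W)
    exact cop_right this (by ring)
  obtain ⟨⟨w, hw⟩, ⟨r, hr⟩⟩ := Int.eq_pow_of_mul_eq_pow_odd hcW2 (by decide : Odd 3) e2
  have hro : Odd r := by
    have : Odd (r ^ 3) := by
      rw [← hr]
      exact (hqo.pow).add_even ⟨54 * W ^ 2, by ring⟩
    exact Int.Odd.of_mul_left (n := r ^ 2) (by convert this using 1; ring)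
  obtain ⟨m, n, hm, hn⟩ := euler_cubes q P r hcP.symm hro (by rw [← hr, hW]; ring)
  have hmn : IsCoprime m n := by
    have : IsCoprime (m * (m ^ 2 - 9 * n ^ 2)) (n * (3 * m ^ 2 - 3 * n ^ 2)) := by
      convert hcP.symm using 1
      · rw [hm]; ring
      · rw [hn]; ring
    exact this.of_mul_left_left.of_mul_right_left
  have hqo' : Odd (m * (m ^ 2 - 9 * n ^ 2)) := by
    convert hqo using 1; rw [hm]; ring
  rw [Int.odd_mul] at hqo'
  obtain ⟨hmo, hqo''⟩ := hqo'
  have hne : Even n := by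
    by_contra hno
    rw [Int.not_even_iff_odd] at hno
    have : Even (m ^ 2 - 9 * n ^ 2) := (hmo.pow).sub_odd (Odd.mul (by decide) hno.pow)
    exact (Int.not_even_iff_odd.mpr hqo'') this
  obtain ⟨k, hk⟩ := hne.two_dvd
  have hmk : IsCoprime m k := by rw [hk] at hmn; exact hmn.of_mul_right_right
  have e3 : k * ((m - 2 * k) * (m + 2 * k)) = w ^ 3 := by
    rw [hW, hw, hk] at hn; linarith
  have c1 : IsCoprime (m - 2 * k) k := by
    have := hmk.add_mul_right_left (-2)
    exact cop_left this (by ring)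
  have c2 : IsCoprime (m + 2 * k) k := by
    have := hmk.add_mul_right_left 2
    exact this
  have c3 : IsCoprime (m - 2 * k) (m + 2 * k) := by
    have ho : Odd (m - 2 * k) := hmo.sub_even ⟨k, by ring⟩
    have h2 := coprime_two_of_odd ho
    have := ((h2.mul_right h2).mul_right c1).add_mul_left_right 1
    exact cop_right this (by ring)
  obtain ⟨⟨s, hs⟩, ⟨v, hv⟩⟩ := Int.eq_pow_of_mul_eq_pow_odd (c1.symm.mul_right c2.symm) (by decide : Odd 3) e3
  obtain ⟨⟨t, ht⟩, ⟨u, hu⟩⟩ := Int.eq_pow_of_mul_eq_pow_odd c3 (by decide : Odd 3) hv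
  have hcube : Function.Injective (fun a : ℤ => a ^ 3) := Odd.pow_injective (by decide)
  have hvtu : v = t * u := hcube (by change v ^ 3 = (t * u) ^ 3; rw [← hv, ht, hu]; ring)
  have hws : w = s * v := hcube (by change w ^ 3 = (s * v) ^ 3; rw [← e3, hv, hs]; ring)
  have hZw : Z = w * r := hcube (by change Z ^ 3 = (w * r) ^ 3; rw [← e2, hr, hw]; ring)
  by_contra hz0
  have hs0 : s = 0 := by
    apply ih s.natAbs _ u (-t) s rfl
    · rw [ht, hu] at c3
      have := (IsCoprime.pow_iff (by norm_num) (by norm_num)).mp c3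
      exact this.symm.neg_right
    · rw [neg_pow, ← ht, ← hu, ← hs]; ring
    · rw [← hzN, hZ, hZw, hws]
      have h1 : s * v * r ≠ 0 := by
        intro h0; apply hz0; rw [hZ, hZw, hws, h0]; ring
      rw [mul_ne_zero_iff, mul_ne_zero_iff] at h1
      have a1 := Int.natAbs_pos.mpr h1.1.1
      have a2 := Int.natAbs_pos.mpr h1.1.2
      have a3 := Int.natAbs_pos.mpr h1.2
      rw [Int.natAbs_mul, Int.natAbs_mul, Int.natAbs_mul]
      have : (3 : ℤ).natAbs = 3 := rfl
      rw [this]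
      have : s.natAbs ≤ s.natAbs * v.natAbs * r.natAbs := by
        rw [mul_assoc]; exact Nat.le_mul_of_pos_right _ (Nat.mul_pos a2 a3)
      omega
  apply hz0; rw [hZ, hZw, hws, hs0]; ring

/-- The integer contradiction for `p = 2`. -/
lemma two_case (u B c : ℤ) (M : ℕ) (hB : 0 < B) (hu : 0 < u) (hc : 0 < c) (hcop : IsCoprime B c)
    (hM : 3 ∣ M) (hM0 : M ≠ 0) (h : c ^ M = 4 * u ^ 2 * (u ^ 2 - B ^ 2)) : False := by
  obtain ⟨e, rfl⟩ := hM
  set D := c ^ e with hD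
  have h' : D ^ 3 = 4 * u ^ 2 * ((u - B) * (u + B)) := by
    rw [hD, ← pow_mul, mul_comm e 3, h]; ring
  have hcopD : IsCoprime B (D ^ 3) := (hcop.pow_right).pow_right
  have hDpos : 0 < D := by positivity
  have hBu : B < u := by
    by_contra hle
    push Not at hle
    have h1 : (u - B) * (u + B) ≤ 0 := mul_nonpos_of_nonpos_of_nonneg (by linarith) (by linarith)
    have h2 : 0 < D ^ 3 := by positivity
    nlinarith [mul_nonneg (by positivity : 0 ≤ 4 * u ^ 2) (neg_nonneg.mpr h1)]
  rw [h'] at hcopD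
  have hcopBu : IsCoprime B u := by
    have := hcopD.of_mul_right_left.of_mul_right_right
    exact (IsCoprime.pow_right_iff (by norm_num)).mp this
  have hBodd : Odd B := by
    have h1 : IsCoprime B 4 := hcopD.of_mul_right_left.of_mul_right_left
    rw [← Int.not_even_iff_odd]
    intro he
    obtain ⟨x, hx⟩ := he.two_dvd
    obtain ⟨s, t, hst⟩ := h1
    have : 2 * (s * x + 2 * t) = 1 := by rw [← hst, hx]; ring
    omega
  have cu1 : IsCoprime u (u - B) := by
    have := (hcopBu.symm.neg_right).add_mul_left_right 1
    exact cop_right this (by ring)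
  have cu2 : IsCoprime u (u + B) := by
    have := (hcopBu.symm).add_mul_left_right 1
    exact cop_right this (by ring)
  rcases Int.even_or_odd u with hue | huo
  · have o1 : Odd (u - B) := hue.sub_odd hBodd
    have o2 : Odd (u + B) := hue.add_odd hBodd
    have t1 := coprime_two_of_odd o1
    have t2 := coprime_two_of_odd o2
    have c1 : IsCoprime (u - B) (2 * u) := t1.mul_right cu1.symm
    have c2 : IsCoprime (u + B) (2 * u) := t2.mul_right cu2.symm
    have c3 : IsCoprime (u - B) (u + B) := by
      have := c1.add_mul_left_right (-1)
      exact cop_right this (by ring)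
    have e1 : (2 * u) ^ 2 * ((u - B) * (u + B)) = D ^ 3 := by rw [h']; ring
    obtain ⟨⟨s, hs⟩, ⟨v, hv⟩⟩ := Int.eq_pow_of_mul_eq_pow_odd
      ((c1.symm.pow_left (m := 2)).mul_right (c2.symm.pow_left (m := 2))) (by decide : Odd 3) e1
    obtain ⟨⟨t, ht⟩, ⟨w, hw⟩⟩ := Int.eq_pow_of_mul_eq_pow_odd c3 (by decide : Odd 3) hv
    -- a square equal to a cube
    obtain ⟨x, hx⟩ : ∃ x : ℤ, 2 * u = x ^ 3 := by
      have hdvd : s ∣ 2 * u := by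
        have : s ^ 2 ∣ (2 * u) ^ 2 := ⟨s, by rw [hs]; ring⟩
        exact (Int.pow_dvd_pow_iff (by norm_num)).mp this
      obtain ⟨x, hx⟩ := hdvd
      have hs0 : s ≠ 0 := by rintro rfl; omega
      have h1 : s = x ^ 2 := by
        rw [hx] at hs
        apply mul_left_cancel₀ (pow_ne_zero 2 hs0)
        linear_combination -hs
      exact ⟨x, by rw [hx, h1]; ring⟩
    have h3 := fermatLastTheoremThree
    have h3' : FermatLastTheoremWith ℤ 3 := fermatLastTheoremFor_iff_int.mp h3
    apply h3' t w x
    · rintro rfl; norm_num at ht; omega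
    · rintro rfl; norm_num at hw; omega
    · rintro rfl; norm_num at hx; omega
    · rw [← ht, ← hw, ← hx]; ring
  · obtain ⟨P, hP⟩ := (huo.sub_odd hBodd).two_dvd
    obtain ⟨Q, hQ⟩ := (huo.add_odd hBodd).two_dvd
    have hPQu : P + Q = u := by linarith
    have cPQ : IsCoprime P Q := by
      have a1 : IsCoprime u P := by rw [hP] at cu1; exact cu1.of_mul_right_right
      have := a1.symm.add_mul_left_right (-1)
      exact cop_right this (by linarith)
    have hPpos : 0 < P := by linarith
    have hQpos : 0 < Q := by linarith
    have cu3 : IsCoprime u (16 * (P * Q)) := by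
      have h2 := coprime_two_of_odd huo
      have := ((h2.mul_right cu1).mul_right (h2.mul_right cu2))
      exact cop_right this (by rw [hP, hQ]; ring)
    have e1 : u ^ 2 * (16 * (P * Q)) = D ^ 3 := by rw [h', hP, hQ]; ring
    obtain ⟨⟨s, hs⟩, ⟨v, hv⟩⟩ := Int.eq_pow_of_mul_eq_pow_odd
      (cu3.pow_left (m := 2)) (by decide : Odd 3) e1
    obtain ⟨x, hx⟩ : ∃ x : ℤ, u = x ^ 3 := by
      have hdvd : s ∣ u := by
        have : s ^ 2 ∣ u ^ 2 := ⟨s, by rw [hs]; ring⟩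
        exact (Int.pow_dvd_pow_iff (by norm_num)).mp this
      obtain ⟨x, hx⟩ := hdvd
      have hs0 : s ≠ 0 := by rintro rfl; omega
      have h1 : s = x ^ 2 := by
        rw [hx] at hs
        apply mul_left_cancel₀ (pow_ne_zero 2 hs0)
        linear_combination -hs
      exact ⟨x, by rw [hx, h1]; ring⟩
    -- core case
    have core : ∀ P Q : ℤ, 0 < P → IsCoprime P Q → P + Q = u → 16 * (P * Q) = v ^ 3 → Even P → False := by
      intro P Q hPpos cPQ hPQ hv he
      have hQo : Odd Q := by
        have : Odd (P + Q) := by rw [hPQ]; exact huo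
        rw [Int.odd_add'] at this
        exact this.mpr he
      have h2v : 2 ∣ v := by
        have : Even (v ^ 3) := by rw [← hv]; exact ⟨8 * (P * Q), by ring⟩
        exact ((Int.even_pow' (by norm_num)).mp this).two_dvd
      obtain ⟨v1, hv1⟩ := h2v
      have e2 : 2 * (P * Q) = v1 ^ 3 := by rw [hv1] at hv; linarith
      have : IsCoprime (2 * P) Q := (coprime_two_of_odd hQo).symm.mul_left cPQ
      obtain ⟨⟨t, ht⟩, ⟨w, hw⟩⟩ := Int.eq_pow_of_mul_eq_pow_odd this (by decide : Odd 3)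
        (show 2 * P * Q = v1 ^ 3 by rw [← e2]; ring)
      have h2t : 2 ∣ t := by
        have : Even (t ^ 3) := by rw [← ht]; exact ⟨P, by ring⟩
        exact ((Int.even_pow' (by norm_num)).mp this).two_dvd
      obtain ⟨z, hz⟩ := h2t
      have hP4 : P = 4 * z ^ 3 := by rw [hz] at ht; linarith
      have hcxw : IsCoprime x w := by
        have : IsCoprime u Q := by
          have := cPQ.add_mul_right_left 1
          rwa [one_mul, hPQ] at this
        rw [hx, hw] at this
        exact (IsCoprime.pow_iff (by norm_num) (by norm_num)).mp this
      have := cubes4 _ x (-w) z rfl hcxw.neg_right (by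
        rw [neg_pow, ← hx, ← hw, ← hP4, ← hPQ]; ring)
      rw [this] at hP4; norm_num at hP4; omega
    rcases Int.even_or_odd P with he | ho
    · exact core P Q hPpos cPQ hPQu hv he
    · have he : Even Q := by
        have : Odd (P + Q) := by rw [hPQu]; exact huo
        rw [Int.odd_add] at this
        exact this.mp ho
      exact core Q P hQpos cPQ.symm (by linarith) (by rw [← hv]; ring) he

lemma quad_rep (K : Type) [Field K] [NumberField K] (g : K) (hK : Module.finrank ℚ K = 2)
    (hg : ∀ q : ℚ, algebraMap ℚ K q ≠ g) (b : K) :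
    ∃ u w : ℚ, b = algebraMap ℚ K u + algebraMap ℚ K w * g := by
  have hli : LinearIndependent ℚ ![(1 : K), g] := by
    rw [LinearIndependent.pair_iff]
    intro s t h
    have ht : t = 0 := by
      by_contra ht
      apply hg (-s / t)
      rw [Algebra.smul_def, Algebra.smul_def, mul_one] at h
      have ht' : algebraMap ℚ K t ≠ 0 := by simpa using ht
      rw [map_div₀, map_neg, div_eq_iff ht']
      linear_combination -h
    refine ⟨?_, ht⟩
    rw [ht, zero_smul, add_zero, Algebra.smul_def, mul_one] at h
    simpa using h
  have := hli.span_eq_top_of_card_eq_finrank' (by simp [hK])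
  have hb : b ∈ Submodule.span ℚ (Set.range ![(1 : K), g]) := by rw [this]; trivial
  rw [Matrix.range_cons, Matrix.range_cons, Matrix.range_empty, Set.union_empty, Set.singleton_union, Submodule.mem_span_pair] at hb
  obtain ⟨u, w, h⟩ := hb
  exact ⟨u, w, by rw [← h, Algebra.smul_def, Algebra.smul_def, mul_one]⟩

lemma t_int (d : ℕ) (hd : 2 ≤ d) (c : ℤ) (hc : c ≠ 0) (n : ℕ) :
    ∃ a : ℤ, ((fun z : ℚ => z ^ d + 1 / (c : ℚ))^[n+1] 0) * (c : ℚ) ^ (d ^ n) = a ∧ IsCoprime a c := by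
  have hcq : (c : ℚ) ≠ 0 := by exact_mod_cast hc
  induction n with
  | zero =>
    refine ⟨1, ?_, isCoprime_one_left⟩
    have : d ≠ 0 := by omega
    simp [this, hcq]
  | succ n ih =>
    obtain ⟨a, ha, hac⟩ := ih
    have h1 : 2 ≤ d ^ (n + 1) := le_trans hd (Nat.le_self_pow (by omega) d)
    obtain ⟨m, hm⟩ : ∃ m, d ^ (n + 1) = m + 2 := ⟨d ^ (n+1) - 2, by omega⟩
    refine ⟨a ^ d + c ^ (m + 1), ?_, ?_⟩
    · rw [Function.iterate_succ_apply', hm]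
      generalize (fun z : ℚ => z ^ d + 1 / (c : ℚ))^[n+1] 0 = t at ha ⊢
      push_cast
      rw [← ha, mul_pow, ← pow_mul, ← pow_succ, hm]
      field_simp
      ring
    · have := (hac.pow_left (m := d)).add_mul_right_left (c ^ m)
      rw [pow_succ]; exact this

lemma rat_int_of_sq (q : ℚ) (m : ℤ) (h : q ^ 2 = m) : ∃ k : ℤ, q = k := by
  have h1 : IsIntegral ℤ q := by
    apply IsIntegral.of_pow (n := 2) (by norm_num)
    rw [h]; exact isIntegral_algebraMap (R := ℤ) (A := ℚ) (x := m)
  obtain ⟨k, hk⟩ := IsIntegrallyClosed.isIntegral_iff.mp h1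
  exact ⟨k, by rw [← hk]; rfl⟩

lemma t_neg (d : ℕ) (hd : 2 ≤ d) (hde : Even d) (c : ℤ) (hc : c ≤ -2) (n : ℕ) :
    ((fun z : ℚ => z ^ d + 1 / (c : ℚ))^[n+1] 0) < 0 ∧ 1 / (c : ℚ) ≤ ((fun z : ℚ => z ^ d + 1 / (c : ℚ))^[n+1] 0) := by
  have hcq : (c : ℚ) ≤ -2 := by exact_mod_cast hc
  have hi : 1 / (c : ℚ) < 0 := by apply div_neg_of_pos_of_neg <;> linarith
  have hi2 : -(1/2) ≤ 1 / (c : ℚ) := by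
    rw [le_div_iff_of_neg (by linarith)]; linarith
  induction n with
  | zero =>
    have : d ≠ 0 := by omega
    simp only [zero_add, Function.iterate_one, zero_pow this]
    exact ⟨hi, le_rfl⟩
  | succ n ih =>
    rw [Function.iterate_succ_apply']
    set t := (fun z : ℚ => z ^ d + 1 / (c : ℚ))^[n+1] 0
    constructor
    · have h1 : t ^ d ≤ t ^ 2 := by
        rw [← hde.pow_abs, ← sq_abs]
        apply pow_le_pow_of_le_one (abs_nonneg _) _ hd
        rw [abs_of_neg ih.1]; linarith [ih.2]
      have h2 : t ^ 2 < -(1 / (c : ℚ)) := by nlinarith [ih.1, ih.2]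
      change t ^ d + 1 / (c : ℚ) < 0
      linarith
    · have := hde.pow_nonneg t
      linarith

lemma t_pos (d : ℕ) (hd : 2 ≤ d) (c : ℤ) (hc : 0 < c) (n : ℕ) :
    0 < ((fun z : ℚ => z ^ d + 1 / (c : ℚ))^[n+1] 0) := by
  have hcq : (0 : ℚ) < c := by exact_mod_cast hc
  induction n with
  | zero =>
    have : d ≠ 0 := by omega
    simp [this, hcq]
  | succ n ih =>
    rw [Function.iterate_succ_apply']
    positivity

lemma case_two (d : ℕ) (hmod : d % 12 = 4) (c : ℤ) (hc : c ≠ 0) (hsq : ∀ q : ℚ, q ^ 2 ≠ -(1 / (c : ℚ)))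
    (K : Type) [Field K] [NumberField K] (g : K) (hg : g ^ 2 = - algebraMap ℚ K (1 / (c : ℚ)))
    (hK : Module.finrank ℚ K = 2) (n : ℕ) (b : K) :
    b ^ 2 ≠ algebraMap ℚ K (((fun z : ℚ => z ^ d + 1 / (c : ℚ))^[n+1] 0) ^ (d / 2)) - g := by
  intro hb
  have hcq : (c : ℚ) ≠ 0 := by exact_mod_cast hc
  have hgq : ∀ q : ℚ, algebraMap ℚ K q ≠ g := by
    intro q hq
    apply hsq q
    apply (algebraMap ℚ K).injective
    rw [map_pow, hq, hg, map_neg]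
  obtain ⟨u, w, huw⟩ := quad_rep K g hK hgq b
  obtain ⟨e, he⟩ : ∃ e, d = 4 * e := ⟨d / 4, by omega⟩
  have he0 : 0 < e := by omega
  have hd2 : d / 2 = 2 * e := by omega
  set t := ((fun z : ℚ => z ^ d + 1 / (c : ℚ))^[n+1] 0) with ht
  -- compare coordinates
  have hlin : algebraMap ℚ K (u ^ 2 - w ^ 2 / c - t ^ (d / 2)) = algebraMap ℚ K (- (2 * u * w + 1)) * g := by
    rw [huw] at hb
    have e1 : algebraMap ℚ K (w ^ 2 / c) = - (algebraMap ℚ K w) ^ 2 * g ^ 2 := by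
      rw [hg, ← map_pow, ← map_neg, ← map_neg, ← map_mul]; congr 1; ring
    rw [map_sub, map_sub, e1, map_neg, map_add, map_mul, map_mul, map_pow, map_one, map_ofNat]
    linear_combination hb
  have hw1 : 2 * u * w + 1 = 0 := by
    by_contra hne
    apply hgq ((u ^ 2 - w ^ 2 / c - t ^ (d / 2)) / (- (2 * u * w + 1)))
    have : algebraMap ℚ K (- (2 * u * w + 1)) ≠ 0 := by
      rw [Ne, map_eq_zero]; exact neg_ne_zero.mpr hne
    rw [map_div₀, div_eq_iff this, hlin, mul_comm]
  have hw2 : u ^ 2 - w ^ 2 / c - t ^ (d / 2) = 0 := by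
    rw [hw1, neg_zero, map_zero, zero_mul, map_eq_zero] at hlin
    exact hlin
  have hu0 : u ≠ 0 := by rintro rfl; norm_num at hw1
  set T := t ^ e with hT
  have hT2 : t ^ (d / 2) = T ^ 2 := by rw [hd2, hT, ← pow_mul, mul_comm]
  have hT4 : t ^ d = T ^ 4 := by rw [hT, ← pow_mul, mul_comm, he]
  rw [hT2] at hw2
  have main : 1 / (c : ℚ) = 4 * u ^ 2 * (u ^ 2 - T ^ 2) := by
    have hw : w = -1 / (2 * u) := by field_simp; linarith
    rw [hw] at hw2
    field_simp at hw2
    field_simp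
    linarith
  rcases lt_or_gt_of_ne hc with hneg | hpos
  · have hc2 : c ≤ -2 := by
      by_contra h
      have : c = -1 := by omega
      apply hsq 1
      rw [this]; norm_num
    have h1 := (t_neg d (by omega) ⟨2 * e, by omega⟩ c hc2 (n + 1)).1
    rw [Function.iterate_succ_apply', ← ht] at h1
    change t ^ d + 1 / (c : ℚ) < 0 at h1
    rw [hT4, main] at h1
    have : T ^ 4 + 4 * u ^ 2 * (u ^ 2 - T ^ 2) = (2 * u ^ 2 - T ^ 2) ^ 2 := by ring
    rw [this] at h1
    exact absurd h1 (not_lt.mpr (sq_nonneg _))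
  · obtain ⟨a, ha, hac⟩ := t_int d (by omega) c hc n
    rw [← ht] at ha
    have htpos := t_pos d (by omega) c hpos n
    rw [← ht] at htpos
    have hcqp : (0 : ℚ) < c := by exact_mod_cast hpos
    have hapos : 0 < a := by
      have : (0 : ℚ) < a := by rw [← ha]; positivity
      exact_mod_cast this
    set s : ℚ := (c : ℚ) ^ (d ^ n * e) with hs
    have hs0 : s ≠ 0 := pow_ne_zero _ hcq
    have hTs : T * s = ((a ^ e : ℤ) : ℚ) := by
      rw [hT, hs, pow_mul, ← mul_pow, ha]; push_cast; rfl
    set B := a ^ e with hB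
    have hs4 : s ^ 4 = c ^ (d ^ (n + 1)) := by
      rw [hs, ← pow_mul]; congr 1; rw [pow_succ]; nth_rw 3 [he]; ring
    obtain ⟨M, hM⟩ : ∃ M, d ^ (n + 1) = M + 1 :=
      ⟨d ^ (n+1) - 1, by have : 0 < d ^ (n+1) := Nat.pow_pos (by omega)
                         omega⟩
    have hM0 : M ≠ 0 := by
      have : d ≤ d ^ (n+1) := Nat.le_self_pow (by omega) d
      omega
    have hM3 : 3 ∣ M := by
      have h1 : d ≡ 1 [MOD 3] := by unfold Nat.ModEq; omega
      have h2 := h1.pow (n + 1)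
      rw [one_pow, hM] at h2
      unfold Nat.ModEq at h2; omega
    have eqn : (c : ℚ) ^ M = 4 * (u * s) ^ 2 * ((u * s) ^ 2 - (B : ℚ) ^ 2) := by
      have h1 : (c : ℚ) ^ M = 1 / c * s ^ 4 := by
        rw [hs4, hM, pow_succ]; field_simp
      rw [h1, main, ← hTs]; ring
    obtain ⟨Y, hY⟩ := rat_int_of_sq (2 * (u * s) ^ 2 - (B : ℚ) ^ 2) (c ^ M + B ^ 4) (by
      push_cast; rw [eqn]; ring)
    obtain ⟨k, hk⟩ := rat_int_of_sq (2 * (u * s)) (2 * (Y + B ^ 2)) (by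
      push_cast; linear_combination 2 * hY)
    have hk2 : k ^ 2 = 2 * (Y + B ^ 2) := by
      have : (k : ℚ) ^ 2 = 2 * (Y + B ^ 2) := by rw [← hk]; linear_combination 2 * hY
      exact_mod_cast this
    obtain ⟨l, hl⟩ : 2 ∣ k := by
      have : Even (k ^ 2) := ⟨Y + B ^ 2, by rw [hk2]; ring⟩
      exact ((Int.even_pow' (by norm_num)).mp this).two_dvd
    have hU : u * s = l := by
      have : (2 : ℚ) * (u * s) = 2 * l := by rw [hk, hl]; push_cast; rfl
      linarith
    have hl0 : l ≠ 0 := by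
      rintro rfl
      have := mul_ne_zero hu0 hs0
      rw [hU] at this; simp at this
    rw [hU] at eqn
    have eqn' : c ^ M = 4 * l ^ 2 * (l ^ 2 - B ^ 2) := by exact_mod_cast eqn
    apply two_case |l| B c M (by positivity) (abs_pos.mpr hl0) hpos (hac.pow_left) hM3 hM0
    rw [sq_abs]; exact eqn'

lemma gen_coprime {R : Type*} [CommRing R] (p M : ℕ) (hp : p.Prime) (hp5 : 5 ≤ p) (b B η : R)
    (hcop : IsCoprime B η) (heq : b ^ p - B ^ p = η ^ M) (hdiv : (p : R) ∣ (b - B) ^ 2) :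
    ∃ Ψ : R, (p * (b - B)) * Ψ = η ^ M ∧ IsCoprime (p * (b - B)) Ψ := by
  set h := b - B with hh
  have hb : b = B + h := by rw [hh]; ring
  obtain ⟨z, hz⟩ := hdiv
  obtain ⟨q, rfl⟩ : ∃ q, p = q + 5 := ⟨p - 5, by omega⟩
  have h1 := add_pow_prime_eq hp B h
  set S := ∑ k ∈ Finset.Ioo 0 (q + 5), B ^ (k - 1) * h ^ (q + 5 - k - 1) * ((q + 5).choose k / (q + 5) : ℕ) with hS
  obtain ⟨Q, hQ⟩ : ∃ Q, S = B ^ (q + 3) + h * Q := by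
    have hmem : q + 4 ∈ Finset.Ioo 0 (q + 5) := by simp
    rw [hS, ← Finset.add_sum_erase _ _ hmem]
    have : h ∣ ∑ x ∈ (Finset.Ioo 0 (q + 5)).erase (q + 4),
        B ^ (x - 1) * h ^ (q + 5 - x - 1) * ((q + 5).choose x / (q + 5) : ℕ) := by
      apply Finset.dvd_sum
      intro x hx
      simp only [Finset.mem_erase, Finset.mem_Ioo] at hx
      obtain ⟨j, hj⟩ : ∃ j, q + 5 - x - 1 = j + 1 := ⟨q + 5 - x - 2, by omega⟩
      rw [hj, pow_succ]
      exact ⟨B ^ (x - 1) * h ^ j * ((q + 5).choose x / (q + 5) : ℕ), by ring⟩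
    obtain ⟨Q, hQ⟩ := this
    refine ⟨Q, ?_⟩
    rw [hQ]
    have e1 : q + 4 - 1 = q + 3 := by omega
    have e2 : q + 5 - (q + 4) - 1 = 0 := by omega
    have e3 : (q + 5).choose (q + 4) / (q + 5) = 1 := by
      rw [show q + 5 = (q + 4) + 1 by ring, Nat.choose_succ_self_right]
      exact Nat.div_self (by omega)
    rw [e1, e2, e3]; simp
  set Ψ := B ^ (q + 4) + h * (B * Q + z * h ^ (q + 1)) with hΨ
  have hprod : (((q + 5 : ℕ) : R) * h) * Ψ = η ^ M := by
    rw [← heq, hb, h1, hQ, hΨ]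
    have : h ^ (q + 5) = h ^ 2 * h ^ (q + 3) := by ring
    rw [this, hz]
    push_cast
    ring
  have chB : IsCoprime h B := by
    have : h ∣ η ^ M := ⟨((q + 5 : ℕ) : R) * Ψ, by rw [← hprod]; ring⟩
    exact (IsCoprime.of_isCoprime_of_dvd_left (hcop.symm.pow_left) this)
  have chΨ : IsCoprime h Ψ := (chB.pow_right (n := q + 4)).add_mul_left_right _
  have cpΨ : IsCoprime ((q + 5 : ℕ) : R) Ψ :=
    IsCoprime.of_isCoprime_of_dvd_left (chΨ.pow_left (m := 2)) ⟨z, hz⟩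
  exact ⟨Ψ, hprod, cpΨ.mul_left chΨ⟩

lemma quad_norm_trace (K : Type) [Field K] [NumberField K] (g : K) (c : ℚ) (hK : Module.finrank ℚ K = 2)
    (hg : ∀ q : ℚ, algebraMap ℚ K q ≠ g) (hg2 : g ^ 2 = - algebraMap ℚ K c) (u w : ℚ) :
    Algebra.norm ℚ (algebraMap ℚ K u + algebraMap ℚ K w * g) = u ^ 2 + c * w ^ 2 ∧
    Algebra.trace ℚ K (algebraMap ℚ K u + algebraMap ℚ K w * g) = 2 * u := by
  have hli : LinearIndependent ℚ ![(1 : K), g] := by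
    rw [LinearIndependent.pair_iff]
    intro s t h
    have ht : t = 0 := by
      by_contra ht
      apply hg (-s / t)
      rw [Algebra.smul_def, Algebra.smul_def, mul_one] at h
      have ht' : algebraMap ℚ K t ≠ 0 := by simpa using ht
      rw [map_div₀, map_neg, div_eq_iff ht']
      linear_combination -h
    refine ⟨?_, ht⟩
    rw [ht, zero_smul, add_zero, Algebra.smul_def, mul_one] at h
    simpa using h
  let bas := basisOfLinearIndependentOfCardEqFinrank hli (by simp [hK])
  have b0 : bas 0 = 1 := by simp [bas]
  have b1 : bas 1 = g := by simp [bas]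
  set x := algebraMap ℚ K u + algebraMap ℚ K w * g with hx
  have e0 : x * bas 0 = u • bas 0 + w • bas 1 := by
    rw [b0, b1, Algebra.smul_def, Algebra.smul_def, hx]; ring
  have e1 : x * bas 1 = (-c * w) • bas 0 + u • bas 1 := by
    rw [b0, b1, Algebra.smul_def, Algebra.smul_def, hx, map_mul, map_neg]
    linear_combination algebraMap ℚ K w * hg2
  have m0 : ∀ i, Algebra.leftMulMatrix bas x i 0 = (![u, w] : Fin 2 → ℚ) i := by
    intro i
    rw [Algebra.leftMulMatrix_eq_repr_mul, e0]
    fin_cases i <;> simp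
  have m1 : ∀ i, Algebra.leftMulMatrix bas x i 1 = (![-c * w, u] : Fin 2 → ℚ) i := by
    intro i
    rw [Algebra.leftMulMatrix_eq_repr_mul, e1]
    fin_cases i <;> simp
  constructor
  · rw [Algebra.norm_eq_matrix_det bas, Matrix.det_fin_two, m0, m0, m1, m1]
    simp; ring
  · rw [Algebra.trace_eq_matrix_trace bas, Matrix.trace_fin_two, m0, m1]
    simp; ring

lemma quad_int (K : Type) [Field K] [NumberField K] (g : K) (c : ℚ) (hK : Module.finrank ℚ K = 2)
    (hg : ∀ q : ℚ, algebraMap ℚ K q ≠ g) (hg2 : g ^ 2 = - algebraMap ℚ K c)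
    (hrep : ∀ b : K, ∃ u w : ℚ, b = algebraMap ℚ K u + algebraMap ℚ K w * g)
    (h : NumberField.RingOfIntegers K) :
    ∃ T : ℤ, h ^ 2 = (T : NumberField.RingOfIntegers K) * h - (Algebra.norm ℤ h : ℤ) := by
  obtain ⟨u, w, huw⟩ := hrep (h : K)
  obtain ⟨h1, h2⟩ := quad_norm_trace K g c hK hg hg2 u w
  rw [← huw] at h1 h2
  have hinteg : IsIntegral ℤ (Algebra.trace ℚ K (h : K)) :=
    Algebra.isIntegral_trace (NumberField.RingOfIntegers.isIntegral_coe h)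
  obtain ⟨T, hT⟩ := IsIntegrallyClosed.isIntegral_iff.mp hinteg
  refine ⟨T, ?_⟩
  apply NumberField.RingOfIntegers.coe_injective
  have hN : (((Algebra.norm ℤ h : ℤ) : ℚ)) = u ^ 2 + c * w ^ 2 := by rw [Algebra.coe_norm_int, h1]
  have hN' : ((Algebra.norm ℤ h : ℤ) : K) = algebraMap ℚ K (u ^ 2 + c * w ^ 2) := by
    rw [← hN]; simp
  have hT' : (T : K) = algebraMap ℚ K (2 * u) := by
    rw [← h2, ← hT]; simp
  have huw' : algebraMap (NumberField.RingOfIntegers K) K h = algebraMap ℚ K u + algebraMap ℚ K w * g := huw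
  rw [map_sub, map_mul, map_pow, map_intCast, map_intCast, hN', hT', huw']
  simp only [map_add, map_mul, map_pow, map_ofNat]
  linear_combination (algebraMap ℚ K w) ^ 2 * hg2

lemma cpx_bound (p : ℕ) (hp : p ≠ 0) (z : ℂ) (B κ : ℝ) (hB : 0 ≤ B) (hκ : 0 ≤ κ)
    (h : ‖z ^ p - (B : ℂ) ^ p‖ = κ ^ p) : κ - 2 * B ≤ ‖z - B‖ ∧ ‖z - B‖ ≤ κ + 2 * B := by
  have hBn : ‖(B : ℂ)‖ = B := by rw [Complex.norm_real, Real.norm_of_nonneg hB]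
  have h1 : κ ≤ ‖z‖ + B := by
    apply le_of_pow_le_pow_left₀ hp (by positivity)
    rw [← h]
    calc ‖z ^ p - (B : ℂ) ^ p‖ ≤ ‖z ^ p‖ + ‖(B : ℂ) ^ p‖ := norm_sub_le _ _
      _ = ‖z‖ ^ p + B ^ p := by rw [norm_pow, norm_pow, hBn]
      _ ≤ (‖z‖ + B) ^ p := pow_add_pow_le (norm_nonneg _) hB hp
  have h2 : ‖z‖ ≤ κ + B := by
    apply le_of_pow_le_pow_left₀ hp (by positivity)
    calc ‖z‖ ^ p = ‖(z ^ p - (B : ℂ) ^ p) + (B : ℂ) ^ p‖ := by rw [sub_add_cancel, norm_pow]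
      _ ≤ ‖z ^ p - (B : ℂ) ^ p‖ + ‖(B : ℂ) ^ p‖ := norm_add_le _ _
      _ = κ ^ p + B ^ p := by rw [h, norm_pow, hBn]
      _ ≤ (κ + B) ^ p := pow_add_pow_le hκ hB hp
  have h3 : ‖z - B‖ ≤ ‖z‖ + B := by
    calc _ ≤ ‖z‖ + ‖(B : ℂ)‖ := norm_sub_le _ _
      _ = _ := by rw [hBn]
  have h4 : ‖z‖ - B ≤ ‖z - B‖ := by
    have := norm_sub_norm_le z (B : ℂ)
    rwa [hBn] at this
  constructor <;> linarith

open NumberField in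
lemma nf_facts (K : Type) [Field K] [NumberField K] (η : 𝓞 K) (c : ℤ) (hK : Module.finrank ℚ K = 2)
    (hη : ∀ q : ℚ, algebraMap ℚ K q ≠ η) (hη2 : η ^ 2 = - (c : 𝓞 K))
    (p M : ℕ) (hp : p.Prime) (hp5 : 5 ≤ p) (hMo : Odd M) (hM2 : 2 ≤ M) (B : ℤ) (hB : 0 ≤ B)
    (hcop : IsCoprime B c) (b : 𝓞 K) (hb : b ^ p - (B : 𝓞 K) ^ p = η ^ M)
    (κ : ℝ) (hκ : 0 ≤ κ) (hκ2 : κ ^ (2 * p) = |(c : ℝ)| ^ M)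
    (hrep : ∀ b : K, ∃ u w : ℚ, b = algebraMap ℚ K u + algebraMap ℚ K w * η) :
    (∃ y : ℤ, y ^ p - (B ^ 2) ^ p = c ^ M) ∧
    ∃ n1 : ℤ, (∃ r1 r2 : ℝ, |(n1 : ℝ)| = r1 * r2 ∧ κ - 2 * B ≤ r1 ∧ r1 ≤ κ + 2 * B ∧
      κ - 2 * B ≤ r2 ∧ r2 ≤ κ + 2 * B) ∧
      ((p : ℤ) ∣ c → ∃ N0 : ℕ, p ^ 2 * n1.natAbs = N0 ^ M ∧ N0 ^ M ∣ c.natAbs ^ M) := by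
  have hη2K : ((η : K)) ^ 2 = - algebraMap ℚ K c := by
    have := congrArg (algebraMap (𝓞 K) K) hη2
    rw [map_pow, map_neg, map_intCast] at this
    rw [this]; simp
  have hnt := quad_norm_trace K η c hK hη hη2K
  have hnη : Algebra.norm ℤ η = c := by
    have h1 := (hnt 0 1).1
    rw [map_zero, zero_add, map_one, one_mul] at h1
    have : ((Algebra.norm ℤ η : ℤ) : ℚ) = c := by rw [Algebra.coe_norm_int, h1]; ring
    exact_mod_cast this
  have hZ : ∀ a : ℤ, Algebra.norm ℤ (a : 𝓞 K) = a ^ 2 := by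
    intro a
    have h1 := (hnt a 0).1
    rw [map_zero, zero_mul, add_zero] at h1
    have : ((Algebra.norm ℤ (a : 𝓞 K) : ℤ) : ℚ) = a ^ 2 := by
      rw [Algebra.coe_norm_int]
      have h2 : (((a : 𝓞 K)) : K) = algebraMap ℚ K (a : ℚ) := by rw [map_intCast]; exact map_intCast (algebraMap (𝓞 K) K) a
      rw [h2, h1]; ring
    exact_mod_cast this
  obtain ⟨k, hk⟩ := hMo
  have hηM : η ^ M = ((-c) ^ k : ℤ) * η := by
    rw [hk, pow_succ, pow_mul, hη2]; push_cast; ring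
  refine ⟨⟨Algebra.norm ℤ b, ?_⟩, Algebra.norm ℤ (b - B), ?_, ?_⟩
  · have h1 : Algebra.norm ℤ (b ^ p) = (B ^ 2) ^ p + c ^ M := by
      have e1 : b ^ p = (B : 𝓞 K) ^ p + ((-c) ^ k : ℤ) * η := by rw [← hηM, ← hb]; ring
      have h2 := (hnt ((B ^ p : ℤ) : ℚ) (((-c) ^ k : ℤ) : ℚ)).1
      have e2 : ((b ^ p : 𝓞 K) : K) = algebraMap ℚ K ((B ^ p : ℤ) : ℚ) + algebraMap ℚ K (((-c) ^ k : ℤ) : ℚ) * η := by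
        rw [e1, map_intCast, map_intCast]
        have : (algebraMap (𝓞 K) K) ((B : 𝓞 K) ^ p + (((-c) ^ k : ℤ) : 𝓞 K) * η) =
          ((B ^ p : ℤ) : K) + (((-c) ^ k : ℤ) : K) * η := by
          rw [map_add, map_mul, map_pow, map_intCast, map_intCast]; push_cast; rfl
        exact this
      rw [← e2, ← Algebra.coe_norm_int] at h2
      have h3 : (Algebra.norm ℤ (b ^ p) : ℤ) = (B ^ p) ^ 2 + c * ((-c) ^ k) ^ 2 := by exact_mod_cast h2
      rw [h3, hk]
      have h4 : ((-c) ^ k) ^ 2 = (c ^ k) ^ 2 := by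
        rw [← pow_mul, ← pow_mul, mul_comm k 2, pow_mul, pow_mul, neg_sq]
      rw [h4]; ring
    rw [← map_pow, h1]; ring
  · classical
    have hcard : Fintype.card (K →ₐ[ℚ] ℂ) = 2 := by
      rw [AlgHom.card, hK]
    have hbound : ∀ σ : K →ₐ[ℚ] ℂ, κ - 2 * B ≤ ‖σ (b - B : 𝓞 K)‖ ∧ ‖σ (b - B : 𝓞 K)‖ ≤ κ + 2 * B := by
      intro σ
      have e1 : σ (b - B : 𝓞 K) = σ b - ((B : ℝ) : ℂ) := by
        have : ((b - B : 𝓞 K) : K) = (b : K) - (B : K) := by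
          have := map_sub (algebraMap (𝓞 K) K) b B
          rw [map_intCast] at this; exact this
        rw [this, map_sub, map_intCast]; simp
      rw [e1]
      apply cpx_bound p hp.ne_zero _ _ _ (by exact_mod_cast hB) hκ
      have e2 : (σ b) ^ p - ((B : ℝ) : ℂ) ^ p = (σ η) ^ M := by
        have := congrArg (algebraMap (𝓞 K) K) hb
        rw [map_sub, map_pow, map_pow, map_pow, map_intCast] at this
        have := congrArg σ this
        rw [map_sub, map_pow, map_pow, map_pow, map_intCast] at this
        simpa using this
      have e3 : ‖σ η‖ ^ 2 = |(c : ℝ)| := by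
        have := congrArg σ hη2K
        rw [map_pow, map_neg, map_intCast, map_intCast] at this
        rw [← norm_pow, this, norm_neg, Complex.norm_intCast]
      rw [e2, norm_pow]
      have h2 : (‖σ η‖ ^ M) ^ 2 = (κ ^ p) ^ 2 := by
        rw [← pow_mul, mul_comm M 2, pow_mul, e3, ← hκ2, ← pow_mul, mul_comm]
      exact (pow_left_inj₀ (by positivity) (by positivity) (by norm_num)).mp h2
    have hprod := Algebra.norm_eq_prod_embeddings ℚ ℂ ((b - B : 𝓞 K) : K)
    obtain ⟨σ, τ, hστ, huniv⟩ := Finset.card_eq_two.mp (show (Finset.univ : Finset (K →ₐ[ℚ] ℂ)).card = 2 by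
      rw [Finset.card_univ]; exact hcard)
    rw [huniv, Finset.prod_pair hστ, ← Algebra.coe_norm_int] at hprod
    refine ⟨‖σ (b - B : 𝓞 K)‖, ‖τ (b - B : 𝓞 K)‖, ?_, (hbound σ).1, (hbound σ).2, (hbound τ).1, (hbound τ).2⟩
    rw [← norm_mul, ← hprod]
    simp
  · intro hpc
    set h := b - (B : 𝓞 K) with hh
    have hpη : ((p : ℕ) : 𝓞 K) ∣ η ^ M := by
      obtain ⟨c', hc'⟩ := hpc
      have : η ^ M = η ^ 2 * η ^ (M - 2) := by rw [← pow_add]; congr 1; omega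
      rw [this, hη2, hc']
      exact ⟨-(c' : 𝓞 K) * η ^ (M - 2), by push_cast; ring⟩
    have hph : ((p : ℕ) : 𝓞 K) ∣ h ^ p := by
      obtain ⟨r, hr⟩ := exists_add_pow_prime_eq hp (B : 𝓞 K) h
      have : (B : 𝓞 K) + h = b := by rw [hh]; ring
      rw [this] at hr
      have : h ^ p = η ^ M - p * (B * h * r) := by rw [← hb, hr]; ring
      rw [this]; exact dvd_sub hpη (Dvd.intro _ rfl)
    obtain ⟨T, hT⟩ := quad_int K η c hK hη hη2K hrep h
    have hpn : (p : ℤ) ∣ Algebra.norm ℤ h := by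
      obtain ⟨z, hz⟩ := hph
      have h1 := congrArg (Algebra.norm ℤ) hz
      have h2 := hZ (p : ℤ)
      rw [Int.cast_natCast] at h2
      rw [map_pow, map_mul, h2] at h1
      exact (Nat.prime_iff_prime_int.mp hp).dvd_of_dvd_pow (n := p) ⟨p * Algebra.norm ℤ z, by rw [h1]; ring⟩
    obtain ⟨m, hm⟩ := hpn
    have hind : ∀ j : ℕ, ((p : ℕ) : 𝓞 K) ∣ h ^ (j + 1) - (T : 𝓞 K) ^ j * h := by
      intro j
      induction j with
      | zero => simp
      | succ j ih =>
        have : h ^ (j + 1 + 1) - (T : 𝓞 K) ^ (j + 1) * h =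
          h * (h ^ (j + 1) - (T : 𝓞 K) ^ j * h) + (T : 𝓞 K) ^ j * (h ^ 2 - T * h) := by ring
        rw [this]
        apply dvd_add (ih.mul_left _)
        apply Dvd.dvd.mul_left
        rw [hT, hm]
        exact ⟨-(m : 𝓞 K), by push_cast; ring⟩
    have hp2 : ((p : ℕ) : 𝓞 K) ∣ h ^ 2 := by
      by_cases hTp : (p : ℤ) ∣ T
      · obtain ⟨T', hT'⟩ := hTp
        rw [hT, hm, hT']
        exact ⟨T' * h - m, by push_cast; ring⟩
      · have hcT : IsCoprime (p : ℤ) T := (Nat.prime_iff_prime_int.mp hp).coprime_iff_not_dvd.mpr hTp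
        have hcT2 : IsCoprime ((p : ℕ) : 𝓞 K) ((T : 𝓞 K) ^ (p - 1)) := by
          have := hcT.map (Int.castRingHom (𝓞 K))
          simp only [eq_intCast, Int.cast_natCast] at this
          exact this.pow_right
        have h3 := hind (p - 1)
        rw [Nat.sub_add_cancel hp.one_le] at h3
        have h4 : ((p : ℕ) : 𝓞 K) ∣ (T : 𝓞 K) ^ (p - 1) * h := by
          have := dvd_sub hph h3
          simpa using this
        exact (hcT2.dvd_of_dvd_mul_left h4).trans (Dvd.intro_left (h ^ 1) (by ring))
    have hcopη : IsCoprime (B : 𝓞 K) η := by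
      have := hcop.map (Int.castRingHom (𝓞 K))
      simp only [eq_intCast] at this
      have h1 : (c : 𝓞 K) = η * (-η) := by
        have : (c : 𝓞 K) = - η ^ 2 := by rw [hη2]; ring
        rw [this]; ring
      rw [h1] at this
      exact this.of_mul_right_left
    obtain ⟨Ψ, hΨ1, hΨ2⟩ := gen_coprime p M hp hp5 b (B : 𝓞 K) η hcopη hb hp2
    rw [← hh] at hΨ1 hΨ2
    have hideal : Ideal.span {((p : ℕ) : 𝓞 K) * h} * Ideal.span {Ψ} = (Ideal.span {η}) ^ M := by
      rw [Ideal.span_singleton_mul_span_singleton, Ideal.span_singleton_pow, hΨ1]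
    obtain ⟨L, hL⟩ := exists_eq_pow_of_mul_eq_pow_of_coprime
      ((Ideal.isCoprime_span_singleton_iff _ _).mpr hΨ2) hideal
    have hnorm : Algebra.norm ℤ (((p : ℕ) : 𝓞 K) * h) = p ^ 2 * Algebra.norm ℤ h := by
      have h2 := hZ (p : ℤ)
      rw [Int.cast_natCast] at h2
      rw [map_mul, h2]
    have hN0 : p ^ 2 * (Algebra.norm ℤ h).natAbs = (Ideal.absNorm L) ^ M := by
      have := congrArg Ideal.absNorm hL
      rw [map_pow, Ideal.absNorm_span_singleton, hnorm, Int.natAbs_mul, Int.natAbs_pow, Int.natAbs_natCast] at this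
      exact this
    refine ⟨Ideal.absNorm L, hN0, ?_⟩
    rw [← hN0]
    have h5 := congrArg (Algebra.norm ℤ) hΨ1
    rw [map_mul, map_pow, hnorm, hnη] at h5
    have h6 := congrArg Int.natAbs h5
    rw [Int.natAbs_mul, Int.natAbs_mul, Int.natAbs_pow, Int.natAbs_pow, Int.natAbs_natCast] at h6
    rw [← h6]; exact Dvd.intro _ rfl

lemma gap_lem (M p j : ℕ) (hp : p ≠ 0) (hj : j * p ≤ M) (small big lam mx mn τ : ℝ)
    (h1 : 0 < small) (h3 : 0 < lam) (h4 : 0 ≤ mx) (hτ : 1 ≤ τ)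
    (hbig : big ^ M * lam = mx ^ p) (hsmall : small ^ M * lam = mn ^ p) (hle : τ * small ≤ big) :
    τ ^ j * mn ≤ mx := by
  apply le_of_pow_le_pow_left₀ hp h4
  have hτ0 : 0 ≤ τ := by linarith
  calc (τ ^ j * mn) ^ p = τ ^ (j * p) * (small ^ M * lam) := by rw [mul_pow, ← pow_mul, hsmall]
    _ ≤ τ ^ M * (small ^ M * lam) := by
        apply mul_le_mul_of_nonneg_right (pow_le_pow_right₀ hτ hj) (by positivity)
    _ = (τ * small) ^ M * lam := by ring
    _ ≤ big ^ M * lam := by gcongr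
    _ = mx ^ p := hbig

lemma int_bound (p : ℕ) (hp : p ≠ 0) (y A : ℤ) (hA : 0 ≤ A) (k : ℝ) (hk : 0 ≤ k)
    (h : |((y ^ p - A ^ p : ℤ) : ℝ)| = k ^ p) :
    k - 2 * A ≤ |((y - A : ℤ) : ℝ)| ∧ |((y - A : ℤ) : ℝ)| ≤ k + 2 * A := by
  have hc := cpx_bound p hp (y : ℂ) (A : ℝ) k (by exact_mod_cast hA) hk (by
    rw [← h, ← Complex.norm_intCast]; push_cast; rfl)
  have : |((y - A : ℤ) : ℝ)| = ‖(y : ℂ) - ((A : ℝ) : ℂ)‖ := by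
    rw [← Complex.norm_intCast]; push_cast; rfl
  rw [this]; exact hc

lemma case_ndvd (p M : ℕ) (hp : p.Prime) (hp5 : 5 ≤ p) (hMo : Odd M) (hM : 3 * p ≤ M) (c : ℤ)
    (hC : 2 ≤ |c|) (hpc : ¬ (p : ℤ) ∣ c) (A : ℤ) (hA : 0 < A) (hcop : IsCoprime A c) (y : ℤ)
    (hy : y ^ p - A ^ p = c ^ M) (k : ℝ) (hk : 0 < k) (hkC : k ^ p = |(c : ℝ)| ^ M)
    (hbd : (A : ℝ) ^ p * |(c : ℝ)| ^ (4 * p) ≤ (1.1 : ℝ) ^ (4 * p) * |(c : ℝ)| ^ (M + 1)) : False := by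
  have hM0 : M ≠ 0 := by omega
  obtain ⟨Ψ, hΨ, hcΨ⟩ : ∃ Ψ : ℤ, (y - A) * Ψ = c ^ M ∧ IsCoprime (y - A) Ψ := by
    obtain ⟨e, he⟩ := Polynomial.powAddExpansion A (y - A) p
    have e1 : A + (y - A) = y := by ring
    rw [e1] at he
    have hprod : (y - A) * ((p : ℤ) * A ^ (p - 1) + (y - A) * e) = c ^ M := by
      rw [← hy, he]; ring
    refine ⟨p * A ^ (p - 1) + (y - A) * e, hprod, ?_⟩
    have hdvd : (y - A) ∣ c ^ M := Dvd.intro _ hprod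
    have c1 : IsCoprime (y - A) A :=
      IsCoprime.of_isCoprime_of_dvd_left (hcop.symm.pow_left) hdvd
    have c2 : IsCoprime (y - A) (p : ℤ) := by
      apply IsCoprime.of_isCoprime_of_dvd_left _ hdvd
      apply IsCoprime.pow_left
      exact ((Nat.prime_iff_prime_int.mp hp).coprime_iff_not_dvd.mpr hpc).symm
    exact ((c2.mul_right c1.pow_right).add_mul_left_right e)
  obtain ⟨⟨R, hR⟩, _⟩ := Int.eq_pow_of_mul_eq_pow_odd hcΨ hMo hΨ
  have hc0 : c ≠ 0 := by rintro rfl; norm_num at hC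
  have hyA : y - A ≠ 0 := by
    intro h; rw [h, zero_mul] at hΨ; exact pow_ne_zero M hc0 hΨ.symm
  have hR0 : R ≠ 0 := by rintro rfl; rw [zero_pow hM0] at hR; exact hyA hR
  have hne : |R| ^ p ≠ |c| := by
    intro h
    have h1 : |y - A| ^ p = |y - A| * |Ψ| := by
      rw [← abs_mul, hΨ, hR, abs_pow, abs_pow, ← h]; ring
    have h2 : |Ψ| = |y - A| ^ (p - 1) := by
      have : |y - A| ^ p = |y - A| * |y - A| ^ (p - 1) := by
        rw [← pow_succ']; congr 1; omega
      rw [this] at h1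
      exact (mul_left_cancel₀ (abs_ne_zero.mpr hyA) h1).symm
    have h3 : (y - A) ∣ Ψ := by
      rw [← abs_dvd, ← dvd_abs, h2]; exact dvd_pow_self _ (by omega)
    have h4 : IsUnit (y - A) := hcΨ.isUnit_of_dvd' dvd_rfl h3
    have h5 : |y - A| = 1 := Int.isUnit_iff_abs_eq.mp h4
    rw [hR, abs_pow] at h5
    have h6 : |R| = 1 := (pow_eq_one_iff_of_nonneg (abs_nonneg _) hM0).mp h5
    rw [h6, one_pow] at h; omega
  set C : ℝ := |(c : ℝ)| with hCdef
  have hC2 : (2 : ℝ) ≤ C := by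
    have : ((2 : ℤ) : ℝ) ≤ ((|c| : ℤ) : ℝ) := by exact_mod_cast hC
    rw [hCdef, ← Int.cast_abs]; exact_mod_cast this
  have hC0 : 0 < C := by linarith
  have hib := int_bound p (by omega) y A hA.le k hk.le (by
    rw [hy, hkC]; push_cast; rw [abs_pow])
  set v : ℝ := |((y - A : ℤ) : ℝ)| with hv
  have hv0 : 0 < v := by rw [hv]; apply abs_pos.mpr; exact_mod_cast hyA
  set X : ℝ := ((|R| ^ p : ℤ) : ℝ) with hX
  have hXpos : 0 < X := by
    have : 0 < |R| ^ p := pow_pos (abs_pos.mpr hR0) p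
    rw [hX]; exact_mod_cast this
  have hXM : X ^ M * 1 = v ^ p := by
    rw [hX, hv, hR]; push_cast; rw [abs_pow]; ring
  have hCM : C ^ M * 1 = k ^ p := by rw [hkC]; ring
  have hCi : ((|c| : ℤ) : ℝ) = C := by rw [hCdef, Int.cast_abs]
  have hτ : (1 : ℝ) ≤ 1 + 1 / C := by have : 0 < 1 / C := by positivity
                                      linarith
  have hτ3 : 1 + 3 / C ≤ (1 + 1 / C) ^ 3 := by
    have h := one_add_mul_le_pow (show (-2 : ℝ) ≤ 1 / C by have : 0 < 1 / C := by positivity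
                                                           linarith) 3
    have e : 1 + 3 / C = 1 + ((3 : ℕ) : ℝ) * (1 / C) := by push_cast; ring
    rw [e]; exact h
  have hA' : (0 : ℝ) < A := by exact_mod_cast hA
  have key : 3 * k ≤ 5 * A * C := by
    rcases lt_or_gt_of_ne hne with h | h
    · have hXC : X + 1 ≤ C := by
        rw [hX, ← hCi]; exact_mod_cast h
      have hle : (1 + 1 / C) * X ≤ C := by
        have : X / C ≤ 1 := by rw [div_le_one hC0]; linarith
        calc (1 + 1 / C) * X = X + X / C := by ring
          _ ≤ C := by linarith
      have hg := gap_lem M p 3 (by omega) hM X C 1 k v (1 + 1 / C) hXpos one_pos hk.le hτ hCM hXM hle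
      have h2 : (1 + 3 / C) * v ≤ k := le_trans (mul_le_mul_of_nonneg_right hτ3 hv0.le) hg
      have h3 : (1 + 3 / C) * (k - 2 * A) ≤ k :=
        le_trans (mul_le_mul_of_nonneg_left hib.1 (by positivity)) h2
      have h4 : (C + 3) * (k - 2 * A) ≤ C * k := by
        have := mul_le_mul_of_nonneg_left h3 hC0.le
        have e : C * ((1 + 3 / C) * (k - 2 * A)) = (C + 3) * (k - 2 * A) := by field_simp
        rw [e] at this; exact this
      nlinarith
    · have hXC : C + 1 ≤ X := by
        rw [hX, ← hCi]; exact_mod_cast h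
      have hle : (1 + 1 / C) * C ≤ X := by
        have : (1 + 1 / C) * C = C + 1 := by field_simp
        rw [this]; exact hXC
      have hg := gap_lem M p 3 (by omega) hM C X 1 v k (1 + 1 / C) hC0 one_pos hv0.le hτ hXM hCM hle
      have h2 : (1 + 3 / C) * k ≤ k + 2 * A :=
        le_trans (le_trans (mul_le_mul_of_nonneg_right hτ3 hk.le) hg) hib.2
      have h4 : (C + 3) * k ≤ C * (k + 2 * A) := by
        have := mul_le_mul_of_nonneg_left h2 hC0.le
        have e : C * ((1 + 3 / C) * k) = (C + 3) * k := by field_simp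
        rw [e] at this; exact this
      nlinarith
  have k2 : (3 : ℝ) ^ p * C ^ M ≤ 5 ^ p * (A : ℝ) ^ p * C ^ p := by
    rw [← hkC, ← mul_pow, ← mul_pow, ← mul_pow]; gcongr
  have k3 : ((3 : ℝ) ^ p * C ^ (4 * p)) * C ^ M ≤ (5 ^ p * (1.1 : ℝ) ^ (4 * p) * C ^ (p + 1)) * C ^ M := by
    calc ((3 : ℝ) ^ p * C ^ (4 * p)) * C ^ M = ((3 : ℝ) ^ p * C ^ M) * C ^ (4 * p) := by ring
      _ ≤ (5 ^ p * (A : ℝ) ^ p * C ^ p) * C ^ (4 * p) := by gcongr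
      _ = 5 ^ p * C ^ p * ((A : ℝ) ^ p * C ^ (4 * p)) := by ring
      _ ≤ 5 ^ p * C ^ p * ((1.1 : ℝ) ^ (4 * p) * C ^ (M + 1)) := by gcongr
      _ = _ := by ring
  have k4 := le_of_mul_le_mul_right k3 (by positivity)
  have k5 : (3 : ℝ) ^ p * C ^ (2 * p) ≤ 5 ^ p * (1.1 : ℝ) ^ (4 * p) := by
    apply le_of_mul_le_mul_right _ (show 0 < C ^ (p + 1) by positivity)
    refine le_trans ?_ k4
    rw [mul_assoc, ← pow_add]
    gcongr
    · linarith
    · omega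
  have k6 : (12 : ℝ) ^ p ≤ (7.3205 : ℝ) ^ p := by
    calc (12 : ℝ) ^ p = 3 ^ p * 2 ^ (2 * p) := by rw [pow_mul, ← mul_pow]; norm_num
      _ ≤ 3 ^ p * C ^ (2 * p) := by gcongr
      _ ≤ 5 ^ p * (1.1 : ℝ) ^ (4 * p) := k5
      _ = (7.3205 : ℝ) ^ p := by rw [pow_mul, ← mul_pow]; norm_num
  have := le_of_pow_le_pow_left₀ (by omega) (by norm_num) k6
  norm_num at this

lemma val_ne (p N0 R s : ℕ) (hp : p.Prime) (hR0 : R ≠ 0) (hs0 : s ≠ 0) (hN : N0 ∣ R * s)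
    (hpR : p ∣ R) (hps : ¬ p ∣ s) : N0 ^ p * s ≠ R ^ (2 * p - 1) := by
  have := Fact.mk hp
  intro h
  have hN0 : N0 ≠ 0 := by rintro rfl; simp at hN; tauto
  have h1 := congrArg (padicValNat p) h
  have vs : padicValNat p s = 0 := padicValNat.eq_zero_of_not_dvd hps
  rw [padicValNat.mul (pow_ne_zero _ hN0) hs0, padicValNat.pow, padicValNat.pow, vs] at h1
  have h2 : padicValNat p N0 ≤ padicValNat p R := by
    have := (padicValNat_dvd_iff_le (p := p) (mul_ne_zero hR0 hs0) (n := padicValNat p N0)).mp (pow_padicValNat_dvd.trans hN)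
    rwa [padicValNat.mul hR0 hs0, vs, add_zero] at this
  have h3 : 1 ≤ padicValNat p R := one_le_padicValNat_of_dvd hR0 hpR
  have h4 := hp.two_le
  have : p * padicValNat p N0 < (2 * p - 1) * padicValNat p R := by
    calc p * padicValNat p N0 ≤ p * padicValNat p R := by gcongr
      _ < (2 * p - 1) * padicValNat p R := by
        apply Nat.mul_lt_mul_of_pos_right (by omega) (by omega)
  omega

set_option maxHeartbeats 2000000 in
lemma case_dvd (p M : ℕ) (hp : p.Prime) (hp5 : 5 ≤ p) (hMo : Odd M) (hM : 3 * p ≤ M) (c : ℤ)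
    (hc0 : c ≠ 0) (hpc : (p : ℤ) ∣ c) (B : ℤ) (hB : 0 < B) (hcop : IsCoprime B c) (y : ℤ)
    (hy : y ^ p - (B ^ 2) ^ p = c ^ M) (κ : ℝ) (hκ : 0 < κ) (hκC : κ ^ (2 * p) = |(c : ℝ)| ^ M)
    (hbd : (((B ^ 2 : ℤ)) : ℝ) ^ p * |(c : ℝ)| ^ (4 * p) ≤ (1.1 : ℝ) ^ (4 * p) * |(c : ℝ)| ^ (M + 1))
    (n1 : ℤ) (r1 r2 : ℝ) (hr : |(n1 : ℝ)| = r1 * r2) (h1l : κ - 2 * B ≤ r1) (h1u : r1 ≤ κ + 2 * B)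
    (h2l : κ - 2 * B ≤ r2) (h2u : r2 ≤ κ + 2 * B) (N0 : ℕ) (hN0 : p ^ 2 * n1.natAbs = N0 ^ M)
    (hN0c : N0 ^ M ∣ c.natAbs ^ M) : False := by
  have hM0 : M ≠ 0 := by omega
  have hpZ : Prime (p : ℤ) := Nat.prime_iff_prime_int.mp hp
  set A : ℤ := B ^ 2 with hAdef
  have hA : 0 < A := by positivity
  have hcopA : IsCoprime A c := hcop.pow_left
  have hdiv : (p : ℤ) ∣ (y - A) := by
    have := Fact.mk hp
    have h1 : ((y ^ p - A ^ p : ℤ) : ZMod p) = 0 := by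
      rw [hy, ZMod.intCast_zmod_eq_zero_iff_dvd]; exact dvd_pow hpc hM0
    push_cast at h1
    rw [ZMod.pow_card, ZMod.pow_card] at h1
    rw [← ZMod.intCast_zmod_eq_zero_iff_dvd]; push_cast; exact h1
  obtain ⟨Ψ, hΨ, hcΨ⟩ := gen_coprime p M hp hp5 y A c hcopA hy (dvd_pow hdiv (by norm_num))
  obtain ⟨⟨R', hR'⟩, ⟨S', hS'⟩⟩ := Int.eq_pow_of_mul_eq_pow_odd hcΨ hMo hΨ
  have hRS : R' * S' = c := by
    apply hMo.pow_injective
    show (R' * S') ^ M = c ^ M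
    rw [mul_pow, ← hR', ← hS', hΨ]
  have hyA : y - A ≠ 0 := by
    intro h; rw [h, mul_zero, zero_mul] at hΨ; exact pow_ne_zero M hc0 hΨ.symm
  set R := R'.natAbs with hRdef
  set s := S'.natAbs with hsdef
  have hRs : R * s = c.natAbs := by rw [hRdef, hsdef, ← Int.natAbs_mul, hRS]
  have hR0 : R ≠ 0 := by
    intro h; rw [h, zero_mul] at hRs; exact hc0 (Int.natAbs_eq_zero.mp hRs.symm)
  have hs0 : s ≠ 0 := by
    intro h; rw [h, mul_zero] at hRs; exact hc0 (Int.natAbs_eq_zero.mp hRs.symm)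
  have hpR : p ∣ R := by
    have : (p : ℤ) ∣ R' := hpZ.dvd_of_dvd_pow (n := M) (by rw [← hR']; exact Dvd.intro _ rfl)
    rw [hRdef]; exact Int.natCast_dvd.mp this
  have hps : ¬ p ∣ s := by
    intro h
    have h1 : (p : ℤ) ∣ S' := Int.natCast_dvd.mpr h
    have h2 : (p : ℤ) ∣ Ψ := by rw [hS']; exact dvd_pow h1 hM0
    exact hpZ.not_isUnit (hcΨ.isUnit_of_dvd' (Dvd.intro _ rfl) h2)
  have hNc : N0 ∣ R * s := by rw [hRs]; exact (Nat.pow_dvd_pow_iff hM0).mp hN0c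
  have hpN : p ∣ N0 := hp.dvd_of_dvd_pow (n := M) (by rw [← hN0]; exact ⟨p * n1.natAbs, by ring⟩)
  have hN00 : N0 ≠ 0 := by rintro rfl; simp at hNc; tauto
  have hne := val_ne p N0 R s hp hR0 hs0 hNc hpR hps
  set C : ℝ := |(c : ℝ)| with hCdef
  have hCn : C = ((c.natAbs : ℕ) : ℝ) := by rw [hCdef, ← Int.cast_abs, Nat.cast_natAbs]
  have hC5 : (5 : ℝ) ≤ C := by
    rw [hCn]
    have : 5 ≤ c.natAbs := hp5.trans (Nat.le_of_dvd (Int.natAbs_pos.mpr hc0) (Int.natCast_dvd.mp hpc))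
    exact_mod_cast this
  have hC0 : 0 < C := by linarith
  have hCRs : C = (R : ℝ) * s := by rw [hCn, ← hRs]; push_cast; rfl
  have hB' : (0 : ℝ) < B := by exact_mod_cast hB
  have hAB : (A : ℝ) = (B : ℝ) ^ 2 := by rw [hAdef]; push_cast; rfl
  have hA' : (0 : ℝ) < A := by exact_mod_cast hA
  have hpR' : (5 : ℝ) ≤ p := by exact_mod_cast hp5
  have hp0 : (0 : ℝ) < p := by linarith
  -- lower bound for kappa
  have hκ4 : 4 * (B : ℝ) ≤ κ := by
    apply le_of_pow_le_pow_left₀ (n := 2 * p) (by omega) hκ.le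
    rw [hκC]
    apply le_of_mul_le_mul_right _ (show 0 < C ^ (4 * p) by positivity)
    calc (4 * (B : ℝ)) ^ (2 * p) * C ^ (4 * p) = 16 ^ p * ((A : ℝ) ^ p * C ^ (4 * p)) := by
          rw [hAB, pow_mul, mul_pow, mul_pow]; norm_num; ring
      _ ≤ 16 ^ p * ((1.1 : ℝ) ^ (4 * p) * C ^ (M + 1)) := by gcongr
      _ = (23.4256 : ℝ) ^ p * C ^ (M + 1) := by
          rw [← mul_assoc, pow_mul, ← mul_pow]; norm_num
      _ ≤ 125 ^ p * C ^ (M + 1) := by gcongr; norm_num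
      _ = 5 ^ (3 * p) * C ^ (M + 1) := by rw [pow_mul]; norm_num
      _ ≤ C ^ (3 * p) * C ^ (M + 1) := by gcongr
      _ ≤ C ^ M * C ^ (4 * p) := by
          rw [← pow_add, ← pow_add]
          exact pow_le_pow_right₀ (by linarith) (by omega)
  have hib := int_bound p (by omega) y A hA.le (κ ^ 2) (by positivity) (by
    rw [hy, ← pow_mul, hκC]; push_cast; rw [abs_pow])
  set v : ℝ := |((y - A : ℤ) : ℝ)| with hv
  have hpv : (p : ℝ) * v = (R : ℝ) ^ M := by
    have h1 := congrArg (fun z : ℤ => |(z : ℝ)|) hR'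
    rw [Int.cast_mul, abs_mul, Int.cast_natCast, Int.cast_pow, abs_pow, abs_of_pos hp0] at h1
    rw [hv, h1, hRdef, Nat.cast_natAbs, Int.cast_abs]
  have hn1 : (p : ℝ) ^ 2 * |(n1 : ℝ)| = (N0 : ℝ) ^ M := by
    have : ((p ^ 2 * n1.natAbs : ℕ) : ℝ) = ((N0 ^ M : ℕ) : ℝ) := by rw [hN0]
    push_cast at this
    rw [← this, Nat.cast_natAbs, Int.cast_abs]
  have hRpos : (0 : ℝ) < R := by exact_mod_cast Nat.pos_of_ne_zero hR0
  have hspos : (0 : ℝ) < s := by exact_mod_cast Nat.pos_of_ne_zero hs0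
  have hNpos : (0 : ℝ) < N0 := by exact_mod_cast Nat.pos_of_ne_zero hN00
  set X : ℝ := (N0 : ℝ) ^ p * s with hX
  set Y : ℝ := (R : ℝ) ^ (2 * p - 1) with hY
  have hXpos : 0 < X := by positivity
  have hYpos : 0 < Y := by positivity
  set lam : ℝ := (R : ℝ) ^ M / (p : ℝ) ^ (2 * p) with hlam
  have hlpos : 0 < lam := by positivity
  have hXM : X ^ M * lam = (|(n1 : ℝ)| * κ ^ 2) ^ p := by
    have e1 : X ^ M = ((p : ℝ) ^ 2 * |(n1 : ℝ)|) ^ p * (s : ℝ) ^ M := by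
      rw [hn1, hX]; ring
    rw [e1, mul_pow _ (κ ^ 2), ← pow_mul κ, hκC, hCRs, hlam]
    field_simp
    rw [mul_pow, mul_pow, ← pow_mul]; ring
  have hYM : Y ^ M * lam = (v ^ 2) ^ p := by
    have e1 : Y ^ M * (R : ℝ) ^ M = ((p : ℝ) * v) ^ (2 * p) := by
      rw [hpv, hY, ← mul_pow, ← pow_succ, ← pow_mul, ← pow_mul]
      congr 1
      rw [show 2 * p - 1 + 1 = 2 * p by omega]; ring
    rw [hlam, mul_div_assoc', e1, mul_pow, ← pow_mul]
    field_simp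
  have hkb : 4 * (B : ℝ) * B ≤ κ * B := mul_le_mul_of_nonneg_right hκ4 hB'.le
  have hkk : 4 * (B : ℝ) * κ ≤ κ * κ := mul_le_mul_of_nonneg_right hκ4 hκ.le
  have hBB : 0 < (B : ℝ) * B := mul_pos hB' hB'
  have hlow : κ * (κ - 2 * B) ≤ v := by
    refine le_trans ?_ hib.1; rw [hAB]; linarith only [hkb, hBB]
  have hupp : v ≤ κ * (κ + 2 * B) := by
    refine le_trans hib.2 ?_; rw [hAB]; linarith only [hkb, hBB]
  have hκB : 0 < κ - 2 * B := by linarith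
  have hkl0 : 0 < κ * (κ - 2 * B) := by positivity
  have hv0 : 0 < v := by linarith
  have hVl : (κ * (κ - 2 * B)) ^ 2 ≤ |(n1 : ℝ)| * κ ^ 2 := by
    rw [hr, mul_pow, mul_comm]
    apply mul_le_mul_of_nonneg_right _ (by positivity)
    rw [sq]; exact mul_le_mul h1l h2l hκB.le (by linarith)
  have hVu : |(n1 : ℝ)| * κ ^ 2 ≤ (κ * (κ + 2 * B)) ^ 2 := by
    rw [hr, mul_pow, mul_comm (κ ^ 2)]
    apply mul_le_mul_of_nonneg_right _ (by positivity)
    rw [sq]; exact mul_le_mul h1u h2u (by linarith) (by linarith)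
  have hkl : (κ * (κ - 2 * B)) ^ 2 ≤ v ^ 2 := by gcongr
  have hku : v ^ 2 ≤ (κ * (κ + 2 * B)) ^ 2 := by gcongr
  set P : ℝ := (p : ℝ) ^ p with hP
  have hPpos : 0 < P := by positivity
  have hτ : (1 : ℝ) ≤ 1 + P / Y := by
    have : 0 < P / Y := by positivity
    linarith
  have hdX : p ^ p ∣ N0 ^ p * s := (pow_dvd_pow_of_dvd hpN p).mul_right s
  have hdY : p ^ p ∣ R ^ (2 * p - 1) :=
    (pow_dvd_pow_of_dvd hpR p).trans (pow_dvd_pow R (by omega))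
  have key0 : (1 + P / Y) ^ 2 * (κ * (κ - 2 * B)) ^ 2 ≤ (κ * (κ + 2 * B)) ^ 2 := by
    rcases lt_or_gt_of_ne hne with h | h
    · have h5 : N0 ^ p * s + p ^ p ≤ R ^ (2 * p - 1) := by
        have := Nat.le_of_dvd (by omega) (Nat.dvd_sub hdY hdX)
        omega
      have h6 : X + P ≤ Y := by rw [hX, hY, hP]; exact_mod_cast h5
      have hle : (1 + P / Y) * X ≤ Y := by
        have h7 : X / Y ≤ 1 := by rw [div_le_one hYpos]; linarith
        calc (1 + P / Y) * X = X + P * (X / Y) := by ring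
          _ ≤ X + P * 1 := by gcongr
          _ ≤ Y := by linarith
      have hg := gap_lem M p 2 (by omega) (by omega) X Y lam (v ^ 2) (|(n1 : ℝ)| * κ ^ 2) (1 + P / Y)
        hXpos hlpos (by positivity) hτ hYM hXM hle
      exact le_trans (mul_le_mul_of_nonneg_left hVl (by positivity)) (hg.trans hku)
    · have h5 : R ^ (2 * p - 1) + p ^ p ≤ N0 ^ p * s := by
        have := Nat.le_of_dvd (by omega) (Nat.dvd_sub hdX hdY)
        omega
      have h6 : Y + P ≤ X := by rw [hX, hY, hP]; exact_mod_cast h5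
      have hle : (1 + P / Y) * Y ≤ X := by
        calc (1 + P / Y) * Y = Y + P := by rw [add_mul, one_mul, div_mul_cancel₀ _ hYpos.ne']
          _ ≤ X := h6
      have hg := gap_lem M p 2 (by omega) (by omega) Y X lam (|(n1 : ℝ)| * κ ^ 2) (v ^ 2) (1 + P / Y)
        hYpos hlpos (by positivity) hτ hXM hYM hle
      exact le_trans (mul_le_mul_of_nonneg_left hkl (by positivity)) (hg.trans hVu)
  have key1 : (1 + P / Y) * (κ * (κ - 2 * B)) ≤ κ * (κ + 2 * B) := by
    rw [← mul_pow] at key0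
    exact le_of_pow_le_pow_left₀ (by norm_num) (by positivity) key0
  have key2 : (1 + P / Y) * (κ - 2 * B) ≤ κ + 2 * B := by
    apply le_of_mul_le_mul_left _ hκ
    calc κ * ((1 + P / Y) * (κ - 2 * B)) = (1 + P / Y) * (κ * (κ - 2 * B)) := by ring
      _ ≤ _ := key1
  have key3 : (Y + P) * (κ - 2 * B) ≤ Y * (κ + 2 * B) := by
    have := mul_le_mul_of_nonneg_left key2 hYpos.le
    have e : Y * ((1 + P / Y) * (κ - 2 * B)) = (Y + P) * (κ - 2 * B) := by
      rw [← mul_assoc, mul_add, mul_one, mul_div_cancel₀ _ hYpos.ne']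
    rw [e] at this; exact this
  have key4 : P * κ ≤ 8 * B * Y := by
    have h1 : P * (4 * B) ≤ P * κ := mul_le_mul_of_nonneg_left hκ4 hPpos.le
    linarith only [h1, key3]
  -- bound on R
  have hRp : (R : ℝ) ^ p ≤ 2 * p * C := by
    apply le_of_pow_le_pow_left₀ hM0 (by positivity)
    calc ((R : ℝ) ^ p) ^ M = ((p : ℝ) * v) ^ p := by rw [hpv]; ring
      _ ≤ ((p : ℝ) * (2 * κ ^ 2)) ^ p := by
          gcongr
          refine hib.2.trans ?_
          rw [hAB]; linarith only [hkb, hkk, hBB]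
      _ = (2 * (p : ℝ)) ^ p * C ^ M := by
          rw [← hκC]; ring
      _ ≤ (2 * (p : ℝ)) ^ M * C ^ M := by
          gcongr
          · linarith
          · omega
      _ = (2 * p * C) ^ M := by ring
  have hY2 : Y ^ (2 * p) ≤ (2 * p * C) ^ (4 * p - 2) := by
    calc Y ^ (2 * p) = ((R : ℝ) ^ p) ^ (4 * p - 2) := by
          rw [hY, ← pow_mul, ← pow_mul]; congr 1
          rw [show 4 * p - 2 = 2 * (2 * p - 1) by omega]; ring
      _ ≤ _ := by gcongr
  have f1 : (P ^ (2 * p) * C ^ (4 * p)) * C ^ M ≤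
      ((93.7024 : ℝ) ^ p * (2 * p * C) ^ (4 * p - 2) * C) * C ^ M := by
    calc (P ^ (2 * p) * C ^ (4 * p)) * C ^ M = (P * κ) ^ (2 * p) * C ^ (4 * p) := by
          rw [← hκC]; ring
      _ ≤ (8 * B * Y) ^ (2 * p) * C ^ (4 * p) := by gcongr
      _ = 64 ^ p * ((A : ℝ) ^ p * C ^ (4 * p)) * Y ^ (2 * p) := by
          rw [hAB, mul_pow, mul_pow, pow_mul 8, pow_mul (B : ℝ)]; norm_num; ring
      _ ≤ 64 ^ p * ((1.1 : ℝ) ^ (4 * p) * C ^ (M + 1)) * (2 * p * C) ^ (4 * p - 2) := by gcongr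
      _ = (64 ^ p * (1.1 : ℝ) ^ (4 * p)) * (2 * p * C) ^ (4 * p - 2) * C * C ^ M := by ring
      _ = _ := by
          rw [pow_mul, ← mul_pow]; norm_num
  have f2 := le_of_mul_le_mul_right f1 (by positivity)
  have f3 : P ^ (2 * p) * C ^ (4 * p) ≤ ((93.7024 : ℝ) ^ p * (2 * p) ^ (4 * p)) * C ^ (4 * p) := by
    refine f2.trans ?_
    have e : (93.7024 : ℝ) ^ p * (2 * p * C) ^ (4 * p - 2) * C =
      (93.7024 : ℝ) ^ p * (2 * p) ^ (4 * p - 2) * C ^ (4 * p - 1) := by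
      rw [mul_pow, show 4 * p - 1 = (4 * p - 2) + 1 by omega, pow_succ C]; ring
    rw [e]
    gcongr
    · linarith
    · omega
    · linarith
    · omega
  have f4 := le_of_mul_le_mul_right f3 (by positivity)
  have f5 : (P ^ 2) ^ p ≤ (93.7024 * (2 * (p : ℝ)) ^ 4) ^ p := by
    calc (P ^ 2) ^ p = P ^ (2 * p) := by rw [pow_mul]
      _ ≤ _ := f4
      _ = _ := by rw [pow_mul (2 * (p : ℝ)) 4 p, ← mul_pow]
  have f6 := le_of_pow_le_pow_left₀ (by omega) (by positivity) f5
  have f7 : (p : ℝ) ^ 5 ≤ P := by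
    rw [hP]; exact pow_le_pow_right₀ (by linarith) hp5
  have f8 : (p : ℝ) ^ 4 * p ^ 6 ≤ P ^ 2 := by
    calc (p : ℝ) ^ 4 * p ^ 6 = ((p : ℝ) ^ 5) ^ 2 := by ring
      _ ≤ P ^ 2 := by gcongr
  have f9 : (5 : ℝ) ^ 6 ≤ (p : ℝ) ^ 6 := by gcongr
  have f10 : (0 : ℝ) < (p : ℝ) ^ 4 := by positivity
  have f11 := mul_le_mul_of_nonneg_left f9 f10.le
  linarith only [f6, f8, f10, f11]

lemma t_abs (d : ℕ) (hd : 20 ≤ d) (c : ℤ) (hc : 2 ≤ |c|) (n : ℕ) :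
    |((fun z : ℚ => z ^ d + 1 / (c : ℚ))^[n+1] 0)| ≤ 1.1 / |(c : ℚ)| := by
  have hC : (2 : ℚ) ≤ |(c : ℚ)| := by
    rw [← Int.cast_abs]; exact_mod_cast hc
  induction n with
  | zero =>
    have : d ≠ 0 := by omega
    simp only [zero_add, Function.iterate_one, ne_eq, this, not_false_eq_true, zero_pow]
    rw [abs_div, abs_one]
    gcongr; norm_num
  | succ n ih =>
    rw [Function.iterate_succ_apply']
    set t := ((fun z : ℚ => z ^ d + 1 / (c : ℚ))^[n+1] 0) with ht
    set C := |(c : ℚ)| with hCd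
    have hx : 1.1 / C ≤ 0.55 := by rw [div_le_iff₀ (by linarith)]; linarith
    have hx0 : 0 ≤ 1.1 / C := by positivity
    have h1 : |t| ^ d ≤ 0.1 / C := by
      calc |t| ^ d ≤ (1.1 / C) ^ d := by gcongr
        _ ≤ (1.1 / C) ^ 6 := pow_le_pow_of_le_one hx0 (by linarith) (by omega)
        _ = (1.1 / C) * (1.1 / C) ^ 5 := by ring
        _ ≤ (1.1 / C) * 0.55 ^ 5 := by gcongr
        _ ≤ (1.1 / C) * (0.1 / 1.1) := by gcongr; norm_num
        _ = 0.1 / C := by ring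
    calc |t ^ d + 1 / (c : ℚ)| ≤ |t ^ d| + |1 / (c : ℚ)| := abs_add_le _ _
      _ = |t| ^ d + 1 / C := by rw [abs_pow, abs_div, abs_one]
      _ ≤ 0.1 / C + 1 / C := by gcongr
      _ = 1.1 / C := by ring

lemma case_odd (d : ℕ) (hmod : d % 12 = 4) (c : ℤ) (hc : c ≠ 0) (hsq : ∀ q : ℚ, q ^ 2 ≠ -(1 / (c : ℚ)))
    (p : ℕ) (hp : p.Prime) (hpd : p ∣ d) (hp2 : p ≠ 2) (hpp : ∀ q : ℚ, q ^ p ≠ -(1 / (c : ℚ)))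
    (K : Type) [Field K] [NumberField K] (g : K) (hg : g ^ 2 = - algebraMap ℚ K (1 / (c : ℚ)))
    (hK : Module.finrank ℚ K = 2) (n : ℕ) (b : K) :
    b ^ p ≠ algebraMap ℚ K (((fun z : ℚ => z ^ d + 1 / (c : ℚ))^[n+1] 0) ^ (d / 2)) - g := by
  intro hb
  have hcq : (c : ℚ) ≠ 0 := by exact_mod_cast hc
  have hcK : (c : K) ≠ 0 := by exact_mod_cast hc
  have hpodd : Odd p := hp.odd_of_ne_two hp2
  have hp3 : p ≠ 3 := by rintro rfl; omega
  have hp5 : 5 ≤ p := by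
    have := hp.two_le
    by_contra h
    have : p = 4 := by omega
    subst this; revert hp; norm_num
  obtain ⟨f, hf⟩ : 4 * p ∣ d := by
    apply Nat.Coprime.mul_dvd_of_dvd_of_dvd _ (by omega) hpd
    exact (Nat.Coprime.pow_left 2 (Nat.coprime_two_left.mpr hpodd) : Nat.Coprime (2 ^ 2) p)
  have hf0 : 0 < f := by
    rcases Nat.eq_zero_or_pos f with h | h
    · subst h; omega
    · exact h
  have hd4p : 4 * p ≤ d := by rw [hf]; exact Nat.le_mul_of_pos_right _ hf0
  have hd2 : d / 2 = 2 * p * f := by rw [hf, show 4 * p * f = 2 * (2 * p * f) by ring]; omega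
  have hC2 : 2 ≤ |c| := by
    by_contra h
    have h1 : 0 < |c| := abs_pos.mpr hc
    have h2 : |c| = 1 := by omega
    rcases abs_eq (by norm_num : (0 : ℤ) ≤ 1) |>.mp h2 with h3 | h3
    · apply hpp (-1); rw [hpodd.neg_one_pow, h3]; norm_num
    · apply hpp 1; rw [h3]; norm_num
  have hgq : ∀ q : ℚ, algebraMap ℚ K q ≠ g := by
    intro q hq
    apply hsq q
    apply (algebraMap ℚ K).injective
    rw [map_pow, hq, hg, map_neg]
  obtain ⟨a, ha, hac⟩ := t_int d (by omega) c hc n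
  have htb := t_abs d (by omega) c hC2 n
  set t := ((fun z : ℚ => z ^ d + 1 / (c : ℚ))^[n+1] 0) with ht
  have ha0 : a ≠ 0 := by
    rintro rfl
    have h1 := isCoprime_zero_left.mp hac
    rw [Int.isUnit_iff_abs_eq] at h1; omega
  -- the exponent
  obtain ⟨k, hk⟩ : ∃ k, k + 1 = d ^ n * (2 * p * f) :=
    ⟨d ^ n * (2 * p * f) - 1, Nat.sub_add_cancel (by
      have : 0 < d ^ n * (2 * p * f) := by
        have : 0 < d := by omega
        positivity
      omega)⟩
  have hkodd : Odd k := by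
    have : Even (k + 1) := by rw [hk]; exact ⟨d ^ n * (p * f), by ring⟩
    rcases Nat.even_or_odd k with h | h
    · exact absurd this (by rw [Nat.not_even_iff_odd]; exact h.add_one)
    · exact h
  set M := 2 * k + 1 with hM
  have hM1 : M + 1 = d ^ (n + 1) := by
    rw [hM, show 2 * k + 1 + 1 = 2 * (k + 1) by ring, hk, pow_succ, hf]; ring
  have hM3 : 3 * p ≤ M := by
    have : d ≤ d ^ (n + 1) := Nat.le_self_pow (by omega) d
    omega
  have hMo : Odd M := ⟨k, rfl⟩
  have hgK : g ^ 2 * (c : K) = -1 := by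
    rw [hg, map_div₀, map_one, map_intCast]; field_simp
  -- the integral element eta
  have hη0 : ((c : K) * g) ^ 2 = - (c : K) := by
    linear_combination (c : K) * hgK
  have hηint : IsIntegral ℤ ((c : K) * g) := by
    apply IsIntegral.of_pow (n := 2) (by norm_num)
    rw [hη0]
    exact (isIntegral_algebraMap (R := ℤ) (A := K) (x := c)).neg
  set B : ℤ := a ^ (2 * f) with hBdef
  have hB : 0 < B := by rw [hBdef, pow_mul]; positivity
  have hcopB : IsCoprime B c := hac.pow_left
  have haK : algebraMap ℚ K t * (c : K) ^ (d ^ n) = (a : K) := by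
    have := congrArg (algebraMap ℚ K) ha
    rwa [map_mul, map_pow, map_intCast, map_intCast] at this
  have hb1 : (b * (c : K) ^ (d ^ n * (2 * f))) ^ p = (B : K) ^ p + ((c : K) * g) ^ M := by
    have e1 : ((c : K) * g) ^ M = - (c : K) ^ (k + 1) * g := by
      rw [hM, pow_succ, pow_mul, hη0, hkodd.neg_pow]; ring
    rw [e1, mul_pow, hb, hd2, hBdef, map_pow]
    push_cast
    rw [← haK, hk]
    ring
  have hbint : IsIntegral ℤ (b * (c : K) ^ (d ^ n * (2 * f))) := by
    apply IsIntegral.of_pow hp.pos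
    rw [hb1]
    exact ((isIntegral_algebraMap (R := ℤ) (A := K) (x := B)).pow p).add (hηint.pow M)
  let η : NumberField.RingOfIntegers K := ⟨(c : K) * g, hηint⟩
  let b1 : NumberField.RingOfIntegers K := ⟨b * (c : K) ^ (d ^ n * (2 * f)), hbint⟩
  have hηK : algebraMap (NumberField.RingOfIntegers K) K η = (c : K) * g := rfl
  have hb1K : algebraMap (NumberField.RingOfIntegers K) K b1 = b * (c : K) ^ (d ^ n * (2 * f)) := rfl
  have hη2 : η ^ 2 = - (c : NumberField.RingOfIntegers K) := by
    apply NumberField.RingOfIntegers.coe_injective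
    rw [map_pow, map_neg, map_intCast, hηK, hη0]
  have hbB : b1 ^ p - (B : NumberField.RingOfIntegers K) ^ p = η ^ M := by
    apply NumberField.RingOfIntegers.coe_injective
    rw [map_sub, map_pow, map_pow, map_pow, map_intCast, hηK, hb1K, hb1]; ring
  have hηq : ∀ q : ℚ, algebraMap ℚ K q ≠ η := by
    intro q hq
    apply hgq (q / c)
    rw [map_div₀, hq, map_intCast]
    change (c : K) * g / c = g
    field_simp
  set C : ℝ := |(c : ℝ)| with hCdef
  have hC2' : (2 : ℝ) ≤ C := by
    rw [hCdef, ← Int.cast_abs]; exact_mod_cast hC2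
  have hC0 : 0 < C := by linarith
  obtain ⟨κ, hκ, hκ2⟩ : ∃ κ : ℝ, 0 < κ ∧ κ ^ (2 * p) = C ^ M :=
    ⟨(C ^ M) ^ (((2 * p : ℕ) : ℝ)⁻¹), by positivity,
      Real.rpow_inv_natCast_pow (by positivity) (by omega)⟩
  have hbd : (((B ^ 2 : ℤ)) : ℝ) ^ p * C ^ (4 * p) ≤ (1.1 : ℝ) ^ (4 * p) * C ^ (M + 1) := by
    have htb' : |(t : ℝ)| ≤ 1.1 / C := by
      have : ((|t| : ℚ) : ℝ) ≤ ((1.1 / |(c : ℚ)| : ℚ) : ℝ) := by exact_mod_cast htb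
      push_cast at this
      rw [hCdef]; exact this
    have haR : (t : ℝ) * (c : ℝ) ^ (d ^ n) = a := by exact_mod_cast congrArg (fun q : ℚ => (q : ℝ)) ha
    have haabs : |(a : ℝ)| = |(t : ℝ)| * C ^ (d ^ n) := by
      rw [← haR, abs_mul, abs_pow]
    have e1 : (((B ^ 2 : ℤ)) : ℝ) ^ p = |(a : ℝ)| ^ d := by
      have : Even d := ⟨2 * p * f, by rw [hf]; ring⟩
      rw [this.pow_abs, hBdef, hf]; push_cast; ring
    have hx1 : 1.1 / C ≤ 1 := by rw [div_le_one hC0]; linarith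
    calc (((B ^ 2 : ℤ)) : ℝ) ^ p * C ^ (4 * p) = |(t : ℝ)| ^ d * C ^ (4 * p) * C ^ (M + 1) := by
          rw [e1, haabs, hM1]; ring
      _ ≤ (1.1 / C) ^ d * C ^ (4 * p) * C ^ (M + 1) := by gcongr
      _ ≤ (1.1 / C) ^ (4 * p) * C ^ (4 * p) * C ^ (M + 1) := by
          have := pow_le_pow_of_le_one (by positivity) hx1 hd4p
          gcongr
      _ = _ := by
          rw [← mul_pow, div_mul_cancel₀ _ hC0.ne']
  obtain ⟨⟨y, hy⟩, n1, ⟨r1, r2, hr, h1l, h1u, h2l, h2u⟩, hN⟩ :=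
    nf_facts K η c hK hηq hη2 p M hp hp5 hMo (by omega) B hB.le hcopB b1 hbB κ hκ.le hκ2
      (quad_rep K η hK hηq)
  by_cases hpc : (p : ℤ) ∣ c
  · obtain ⟨N0, hN0, hN0c⟩ := hN hpc
    exact case_dvd p M hp hp5 hMo hM3 c hc hpc B hB hcopB y hy κ hκ hκ2 hbd n1 r1 r2 hr
      h1l h1u h2l h2u N0 hN0 hN0c
  · exact case_ndvd p M hp hp5 hMo hM3 c hC2 hpc (B ^ 2) (by positivity) hcopB.pow_left y hy (κ ^ 2)
      (by positivity) (by rw [← pow_mul, hκ2]) hbd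

theorem stmt5 (d : ℕ) (hmod : d % 12 = 4) (c : ℤ) (hc : c ≠ 0)
    (f : ℚ[X]) (hf : f = X ^ d + C (1 / (c : ℚ))) (hirr : Irreducible f) :
    ∀ n : ℕ, 1 ≤ n → Irreducible ((f.comp ·)^[n] X) := by
  subst hf
  have hpow : ∀ m : ℕ, m ∣ d → m ≠ 1 → ∀ q : ℚ, q ^ m ≠ -(1 / (c : ℚ)) := by
    intro m hm hm1 q
    have h2 : Irreducible (X ^ d - C (-(1 / (c : ℚ))) : ℚ[X]) := by
      rw [map_neg, sub_neg_eq_add]; exact hirr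
    exact pow_ne_of_irreducible_X_pow_sub_C h2 hm hm1 q
  intro n hn
  refine tower_rat d (by omega) (by omega) (1 / (c : ℚ)) hirr ?_ n hn
  intro K _ _ g hg hK n hn p hp hpd b
  obtain ⟨m, rfl⟩ : ∃ m, n = m + 1 := ⟨n - 1, by omega⟩
  have hsq := hpow 2 (by omega) (by norm_num)
  by_cases hp2 : p = 2
  · subst hp2
    exact case_two d hmod c hc hsq K g hg hK m b
  · exact case_odd d hmod c hc hsq p hp hpd hp2 (hpow p hpd hp.ne_one) K g hg hK m b
end

section
/- Let c be a nonzero integer with |c| ≤ 10¹² and let f(z) = z³ + 1/c ∈ ℚ[z]. If f is reducible over ℚ, then for every n ≥ 1 the n-th iterate fⁿ(z) is the product of exactly two monic irreducible polynomials in ℚ[z]: there exist monic irreducible p, q ∈ ℚ[z] with fⁿ = p · q. -/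
open Polynomial

/-! ### The computational certificate -/

/-- Plain modular power. -/
def pmA (b e p : ℕ) : ℕ := b ^ e % p

/-- Modular power by repeated squaring, with fuel. -/
def pmGo (p : ℕ) : ℕ → ℕ → ℕ → ℕ
  | 0, b, e => b ^ e % p
  | k + 1, b, e =>
    cond (Nat.beq e 0) (1 % p)
      (cond (Nat.beq (e % 2) 0) (pmGo p k (b * b % p) (e / 2))
        (b * pmGo p k (b * b % p) (e / 2) % p))

def pmB (b e p : ℕ) : ℕ := pmGo p 22 b e

/-- Follow the orbit `x ↦ x ^ 3 + k` modulo `p` until it closes up, checking that `x + d` is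
never zero nor a cube modulo `p`. -/
def orbGo (pm : ℕ → ℕ → ℕ → ℕ) (p k d : ℕ) : ℕ → ℕ → List ℕ → Bool
  | 0, _, _ => false
  | f + 1, x, seen =>
    cond (List.any seen (Nat.beq x)) true
      (cond (Nat.ble (pm (x + d) (p / 3) p) 1) false
        (orbGo pm p k d f ((x * x * x + k) % p) (x :: seen)))

def chkAux (pm : ℕ → ℕ → ℕ → ℕ) (p w m i : ℕ) : Bool :=
  cond (Nat.beq (i * m % p) 1) (orbGo pm p (i * i * i % p) (w * i % p) 20 (i * i * i % p) []) false

def chk (pm : ℕ → ℕ → ℕ → ℕ) (p w m : ℕ) : Bool := chkAux pm p w m (pm (m % p) (p - 2) p)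

def maskA : List (ℕ × ℕ × ℕ) :=
  [(7, 1, 90), (13, 1, 4290), (19, 1, 163860), (31, 1, 180884304), (43, 1, 283467842592), (61,
   1, 7055588263601664), (67, 1, 720576254448764160), (73, 1, 3800221536485376), (79, 1,
   155842850298855826784388), (97, 1, 2476187327544591040660373568), (103, 1,
   633864136865509577735369130000), (109, 1, 44565841414273689896368619520), (127, 1,
   10633844248688930634900880429502431248), (139, 1, 207691874341393105141219853189775360),
   (151, 1, 1303154742316927315212967448936448), (157, 1,
   24263212137131275014490484692506426032248586376), (163, 1,
   2854495385411919762116571938898990272765497344), (181, 1,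
   23384026197294530092527247548610938039478918447104), (193, 1,
   1496577698928950916249022606832919927732998844186624), (199, 1,
   1580386026517947885182045371748756345606824719769141248), (211, 1,
   196159430692469227922127730571561027404380234165855977472), (223, 1,
   25108406941546723055343843745335509182161511793631424413696), (229, 1,
   1688300933050422535920860805471897555196333620594399158318200521216), (241, 1,
   55213970774324513364469128629993920336302926077981460831699942764445760), (271, 1,
   22835963083461511596405689995304898064658989056), (277, 1,
   1897166764242922166501837202000371728221825845979306187893033970808017693746135168), (283,
   1, 3138553860848693635607076385052180905983572029177790988288)]

def maskB : List (ℕ × ℕ × ℕ) :=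
  [(7, 2, 102), (7, 4, 60), (13, 3, 1320), (13, 9, 2580), (19, 7, 17952), (19, 11, 73800), (31,
   5, 1616005638), (31, 25, 94520736), (43, 6, 1140989952), (43, 36, 34494021888), (61, 13,
   82402079150229792), (61, 47, 1334764235168946258), (67, 29, 144150581831795712), (67, 37,
   73787012067893444610), (73, 8, 6935552532555503616), (73, 64, 150173655474586554432), (79,
   23, 113337084030366756372504), (79, 55, 1844692703246622402048), (97, 35,
   39626189404798785351107821572), (97, 61, 4951818301278841432786862112), (103, 46,
   5705049088907609797598860296210), (103, 56, 5071262625526298830901740847106), (109, 63,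
   635063240153400081023251252224), (139, 42, 20283647543690956367206463569920), (139, 96,
   5192296859743754024605877941567488), (157, 12,
   178406645071049661525138058011361458400527360), (157, 144,
   356942593266923875492166650072640625055891968), (241, 225,
   220855883097298041197912187637466304875496812620686320574835091717488656), (277, 116,
   30106169358126713067905979926602923967386951935461779020658279139789626902323200)]

def tabA0 : List (ℕ × ℕ × ℕ) :=
  [(1967, 331, 1), (1960, 421, 1), (1937, 1669, 1), (1927, 337, 1), (1906, 313, 1), (1890, 499,
   1), (1855, 2971, 1), (1846, 331, 1), (1764, 307, 1), (1738, 1009, 1), (1703, 499, 1), (1673,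
   349, 1), (1659, 613, 1), (1633, 307, 1), (1545, 349, 1), (1517, 1609, 1), (1458, 619, 1),
   (1456, 499, 1), (1433, 421, 1), (1428, 26947, 1), (1419, 1579, 1), (1388, 673, 1), (1304,
   673, 1), (1297, 601, 1), (1251, 727, 1), (1225, 1213, 1), (1204, 379, 1), (1162, 823, 1),
   (1160, 1777, 1), (1083, 337, 1), (1036, 733, 1), (940, 2203, 1), (919, 373, 1), (884, 7411,
   1), (882, 307, 1), (873, 1423, 1), (817, 409, 1), (791, 3709, 1), (754, 3373, 1), (744,
   157837, 1), (730, 57301, 1), (712, 307, 1), (672, 421, 1), (646, 5839, 1), (590, 1171, 1),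
   (548, 1038043, 1), (525, 1050031, 1), (499, 757, 1), (455, 337, 1), (429, 463, 1), (362,
   379, 1), (348, 1429, 1), (282, 1461637, 1), (152, 103903, 1), (140, 331, 1), (138, 3463, 1),
   (100, 409, 1), (28, 313, 1), (16, 307, 1)]

def tabA1 : List (ℕ × ℕ × ℕ) :=
  [(3939, 571, 1), (3934, 421, 1), (3890, 1069, 1), (3813, 18211, 1), (3780, 1621, 1), (3768,
   2137, 1), (3752, 337, 1), (3740, 367, 1), (3710, 919, 1), (3642, 337, 1), (3596, 613, 1),
   (3591, 331, 1), (3458, 883, 1), (3428, 307, 1), (3423, 631, 1), (3421, 877, 1), (3351, 577,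
   1), (3341, 349, 1), (3337, 2287, 1), (3299, 307, 1), (3297, 331, 1), (3276, 571, 1), (3271,
   337, 1), (3227, 12781, 1), (3148, 307, 1), (3115, 7237, 1), (3068, 313, 1), (2994, 709, 1),
   (2975, 577, 1), (2973, 6067, 1), (2912, 409, 1), (2868, 337, 1), (2863, 547, 1), (2847,
   1699, 1), (2826, 751, 1), (2760, 457, 1), (2746, 421, 1), (2707, 8209, 1), (2695, 577, 1),
   (2686, 1873, 1), (2604, 541, 1), (2576, 751, 1), (2543, 331, 1), (2513, 373, 1), (2494,
   5101, 1), (2473, 751, 1), (2452, 421, 1), (2448, 409, 1), (2429, 307, 1), (2401, 409, 1),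
   (2394, 997, 1), (2338, 3469, 1), (2324, 853, 1), (2296, 499, 1), (2277, 397, 1), (2273, 367,
   1), (2252, 3313, 1), (2233, 7789, 1), (2119, 1723, 1), (2098, 307, 1), (2077, 619, 1),
   (2072, 1531, 1), (2049, 823, 1), (2046, 409, 1), (2025, 3373, 1)]

def tabA2 : List (ℕ × ℕ × ℕ) :=
  [(5976, 2713, 1), (5952, 877, 1), (5950, 613, 1), (5941, 337, 1), (5852, 1951, 1), (5833,
   547, 1), (5798, 757, 1), (5777, 367, 1), (5749, 421, 1), (5735, 307, 1), (5670, 547, 1),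
   (5640, 331, 1), (5637, 2851, 1), (5614, 331, 1), (5612, 1051, 1), (5577, 307, 1), (5556,
   2203, 1), (5521, 3697, 1), (5490, 573901, 1), (5418, 2179, 1), (5348, 487, 1), (5346, 331,
   1), (5332, 23599, 1), (5287, 367, 1), (5269, 457, 1), (5252, 463, 1), (5250, 853, 1), (5222,
   421, 1), (5187, 613, 1), (5182, 823, 1), (5159, 1621, 1), (5143, 1093, 1), (5117, 4519, 1),
   (5101, 1933, 1), (5098, 6007, 1), (5091, 523, 1), (5070, 313, 1), (5068, 367, 1), (5066,
   547, 1), (5005, 5851, 1), (4977, 1531, 1), (4884, 499, 1), (4872, 1783, 1), (4839, 3079, 1),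
   (4807, 769, 1), (4781, 619, 1), (4769, 5209, 1), (4758, 2677, 1), (4753, 673, 1), (4711,
   1226293, 1), (4709, 373, 1), (4671, 337, 1), (4667, 313, 1), (4664, 463, 1), (4643, 739, 1),
   (4636, 10159, 1), (4587, 74923, 1), (4559, 1873, 1), (4555, 1399, 1), (4515, 751, 1), (4513,
   1423, 1), (4494, 331, 1), (4464, 571, 1), (4459, 307, 1), (4438, 487, 1), (4370, 409, 1),
   (4324, 1447, 1), (4319, 1093, 1), (4307, 1051, 1), (4275, 331, 1), (4240, 751, 1), (4221,
   373, 1), (4202, 439, 1), (4151, 2557, 1), (4149, 463, 1), (4137, 307, 1), (4072, 463, 1),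
   (4048, 421, 1), (4025, 877, 1)]

def tabA3 : List (ℕ × ℕ × ℕ) :=
  [(7985, 164821, 1), (7966, 307, 1), (7926, 733, 1), (7915, 16141, 1), (7894, 331, 1), (7796,
   337, 1), (7784, 1699, 1), (7719, 4507, 1), (7714, 307, 1), (7709, 349, 1), (7698, 3433, 1),
   (7681, 853, 1), (7499, 571, 1), (7485, 709, 1), (7460, 1009, 1), (7453, 24571, 1), (7439,
   5557, 1), (7392, 907, 1), (7373, 1789, 1), (7301, 331, 1), (7296, 337, 1), (7282, 5779, 1),
   (7264, 19273, 1), (7259, 523, 1), (7233, 409, 1), (7212, 439, 1), (7210, 577, 1), (7194,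
   919, 1), (7168, 3739, 1), (7098, 757, 1), (7082, 409, 1), (7054, 1549, 1), (7037, 613, 1),
   (7035, 577, 1), (7023, 19687, 1), (6991, 65371, 1), (6867, 1051, 1), (6848, 15241, 1),
   (6820, 349, 1), (6769, 787, 1), (6755, 367, 1), (6734, 577, 1), (6645, 337, 1), (6613, 457,
   1), (6582, 499, 1), (6573, 1321, 1), (6484, 733, 1), (6482, 349, 1), (6419, 1021, 1), (6393,
   643, 1), (6379, 463, 1), (6321, 463, 1), (6314, 313, 1), (6295, 457, 1), (6244, 409, 1),
   (6242, 1423, 1), (6216, 1489, 1), (6186, 751, 1), (6102, 751, 1), (6069, 853, 1), (6004,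
   5407, 1)]

def tabA4 : List (ℕ × ℕ × ℕ) :=
  [(9989, 547, 1), (9980, 331, 1), (9889, 18481, 1), (9828, 421, 1), (9765, 313, 1), (9763,
   409, 1), (9758, 787, 1), (9721, 1237, 1), (9630, 33091, 1), (9620, 463, 1), (9518, 577, 1),
   (9501, 307, 1), (9462, 1039, 1), (9410, 1321, 1), (9396, 1039, 1), (9378, 162847, 1), (9338,
   17419, 1), (9280, 601, 1), (9165, 463, 1), (9128, 307, 1), (9070, 373, 1), (9051, 409, 1),
   (9032, 571, 1), (8960, 3541, 1), (8948, 769, 1), (8902, 661, 1), (8892, 463, 1), (8864, 307,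
   1), (8822, 613, 1), (8778, 1033, 1), (8766, 577, 1), (8741, 2371, 1), (8731, 1489, 1),
   (8727, 463, 1), (8680, 313, 1), (8654, 10597, 1), (8650, 379, 1), (8629, 397, 1), (8601,
   373, 1), (8598, 1063, 1), (8577, 571, 1), (8559, 601, 1), (8512, 367, 1), (8479, 313, 1),
   (8465, 523, 1), (8463, 12763, 1), (8437, 463, 1), (8388, 499, 1), (8349, 13723, 1), (8342,
   613, 1), (8311, 1021, 1), (8260, 337, 1), (8181, 409, 1), (8146, 673, 1), (8143, 307, 1),
   (8127, 409, 1), (8101, 463, 1)]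

def tabA : List (ℕ × ℕ × ℕ) := tabA0 ++ (tabA1 ++ (tabA2 ++ (tabA3 ++ tabA4)))

def tabB0 : List (ℕ × ℕ × ℕ) :=
  [(1351, 337, 208), (539, 1009, 374)]

def tabB1 : List (ℕ × ℕ × ℕ) :=
  [(3906, 601, 576)]

def tabB2 : List (ℕ × ℕ × ℕ) :=
  []

def tabB3 : List (ℕ × ℕ × ℕ) :=
  []

def tabB4 : List (ℕ × ℕ × ℕ) :=
  [(8932, 919, 866)]

def tabB : List (ℕ × ℕ × ℕ) := tabB0 ++ (tabB1 ++ (tabB2 ++ (tabB3 ++ tabB4)))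

/-- The bit number `r` of `M`. -/
def mbit (M r : ℕ) : Bool := Nat.beq (M / 2 ^ r % 2) 1

/-- Every residue `r < k` in the mask passes the check. -/
def maskOk (p w M : ℕ) : ℕ → Bool
  | 0 => true
  | r + 1 => cond (mbit M r) (cond (chk pmA p w r) (maskOk p w M r) false) (maskOk p w M r)

def inMask (L : List (ℕ × ℕ × ℕ)) (m : ℕ) : Bool := List.any L fun t => mbit t.2.2 (m % t.1)

/-- Each of `s + 1, …, s + k` is covered by the masks `L` or by the (decreasing) table. -/
def walk (L : List (ℕ × ℕ × ℕ)) (s : ℕ) : ℕ → List (ℕ × ℕ × ℕ) → Bool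
  | 0, _ => true
  | k + 1, T => cond (inMask L (s + (k + 1))) (walk L s k T)
      (match T with
        | [] => false
        | t :: T' => cond (Nat.beq t.1 (s + (k + 1))) (walk L s k T') false)

theorem maskOk_spec {p w M : ℕ} : ∀ {k : ℕ}, maskOk p w M k = true → ∀ r, r < k →
    mbit M r = true → chk pmA p w r = true
  | 0, _, r, h1, _ => by omega
  | k + 1, h, r, h1, h2 => by
    rw [maskOk] at h
    rcases Nat.lt_or_ge r k with h3 | h3
    · refine maskOk_spec (k := k) ?_ r h3 h2
      cases hb : mbit M k <;> cases hc : chk pmA p w k <;> simp_all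
    · obtain rfl : r = k := by omega
      rw [h2] at h
      cases hc : chk pmA p w r <;> simp_all

theorem walk_spec {L : List (ℕ × ℕ × ℕ)} {s : ℕ} : ∀ {k : ℕ} {T : List (ℕ × ℕ × ℕ)},
    walk L s k T = true → ∀ m, s < m → m ≤ s + k → inMask L m = true ∨ ∃ t ∈ T, t.1 = m
  | 0, _, _, m, h1, h2 => by omega
  | k + 1, T, h, m, h1, h2 => by
    unfold walk at h
    cases hk : inMask L (s + (k + 1)) with
    | true =>
      rw [hk] at h
      rcases Nat.lt_or_ge (s + k) m with h3 | h3
      · left; rwa [show m = s + (k + 1) by omega]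
      · exact walk_spec (k := k) h m h1 h3
    | false =>
      rw [hk] at h
      cases T with
      | nil => simp at h
      | cons t T' =>
        cases ht : Nat.beq t.1 (s + (k + 1)) with
        | false => simp [ht] at h
        | true =>
          simp only [ht, cond_false, cond_true] at h
          rcases Nat.lt_or_ge (s + k) m with h3 | h3
          · right
            refine ⟨t, by simp, ?_⟩
            rw [Nat.eq_of_beq_eq_true ht]; omega
          · rcases walk_spec (k := k) h m h1 h3 with h4 | ⟨t', h4, h5⟩
            · exact Or.inl h4
            · exact Or.inr ⟨t', by simp [h4], h5⟩

theorem maskA_ok : List.all maskA (fun t => maskOk t.1 t.2.1 t.2.2 t.1) = true := by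
  decide +kernel

theorem tabA_ok : List.all tabA (fun t => chk pmB t.2.1 t.2.2 t.1) = true := by
  decide +kernel

theorem walkA0 : walk maskA 0 2000 tabA0 = true := by decide +kernel

theorem walkA1 : walk maskA 2000 2000 tabA1 = true := by decide +kernel

theorem walkA2 : walk maskA 4000 2000 tabA2 = true := by decide +kernel

theorem walkA3 : walk maskA 6000 2000 tabA3 = true := by decide +kernel

theorem walkA4 : walk maskA 8000 2000 tabA4 = true := by decide +kernel

theorem coverA (m : ℕ) (h1 : 0 < m) (h2 : m ≤ 10000) :
    inMask maskA m = true ∨ ∃ t ∈ tabA, t.1 = m := by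
  rcases Nat.lt_or_ge 8000 m with h | h
  · exact (walk_spec walkA4 m h (by omega)).imp_right fun ⟨t, h, hh⟩ => ⟨t, by simp [tabA, h], hh⟩
  rcases Nat.lt_or_ge 6000 m with h | h
  · exact (walk_spec walkA3 m h (by omega)).imp_right fun ⟨t, h, hh⟩ => ⟨t, by simp [tabA, h], hh⟩
  rcases Nat.lt_or_ge 4000 m with h | h
  · exact (walk_spec walkA2 m h (by omega)).imp_right fun ⟨t, h, hh⟩ => ⟨t, by simp [tabA, h], hh⟩
  rcases Nat.lt_or_ge 2000 m with h | h
  · exact (walk_spec walkA1 m h (by omega)).imp_right fun ⟨t, h, hh⟩ => ⟨t, by simp [tabA, h], hh⟩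
  · exact (walk_spec walkA0 m h1 (by omega)).imp_right fun ⟨t, h, hh⟩ => ⟨t, by simp [tabA, h], hh⟩

theorem maskB_ok : List.all maskB (fun t => maskOk t.1 t.2.1 t.2.2 t.1) = true := by
  decide +kernel

theorem tabB_ok : List.all tabB (fun t => chk pmB t.2.1 t.2.2 t.1) = true := by
  decide +kernel

theorem walkB0 : walk maskB 0 2000 tabB0 = true := by decide +kernel

theorem walkB1 : walk maskB 2000 2000 tabB1 = true := by decide +kernel

theorem walkB2 : walk maskB 4000 2000 tabB2 = true := by decide +kernel

theorem walkB3 : walk maskB 6000 2000 tabB3 = true := by decide +kernel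

theorem walkB4 : walk maskB 8000 2000 tabB4 = true := by decide +kernel

theorem coverB (m : ℕ) (h1 : 0 < m) (h2 : m ≤ 10000) :
    inMask maskB m = true ∨ ∃ t ∈ tabB, t.1 = m := by
  rcases Nat.lt_or_ge 8000 m with h | h
  · exact (walk_spec walkB4 m h (by omega)).imp_right fun ⟨t, h, hh⟩ => ⟨t, by simp [tabB, h], hh⟩
  rcases Nat.lt_or_ge 6000 m with h | h
  · exact (walk_spec walkB3 m h (by omega)).imp_right fun ⟨t, h, hh⟩ => ⟨t, by simp [tabB, h], hh⟩
  rcases Nat.lt_or_ge 4000 m with h | h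
  · exact (walk_spec walkB2 m h (by omega)).imp_right fun ⟨t, h, hh⟩ => ⟨t, by simp [tabB, h], hh⟩
  rcases Nat.lt_or_ge 2000 m with h | h
  · exact (walk_spec walkB1 m h (by omega)).imp_right fun ⟨t, h, hh⟩ => ⟨t, by simp [tabB, h], hh⟩
  · exact (walk_spec walkB0 m h1 (by omega)).imp_right fun ⟨t, h, hh⟩ => ⟨t, by simp [tabB, h], hh⟩

theorem cover_chk {L T : List (ℕ × ℕ × ℕ)} {m : ℕ}
    (hL : List.all L (fun t => maskOk t.1 t.2.1 t.2.2 t.1) = true)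
    (hT : List.all T (fun t => chk pmB t.2.1 t.2.2 t.1) = true)
    (hL0 : ∀ t ∈ L, 0 < t.1)
    (h : inMask L m = true ∨ ∃ t ∈ T, t.1 = m) :
    (∃ t ∈ L, chk pmA t.1 t.2.1 (m % t.1) = true) ∨ ∃ t ∈ T, chk pmB t.2.1 t.2.2 m = true := by
  rw [List.all_eq_true] at hL hT
  rcases h with h | ⟨t, ht, rfl⟩
  · left
    rw [inMask, List.any_eq_true] at h
    obtain ⟨t, ht, h⟩ := h
    exact ⟨t, ht, maskOk_spec (hL t ht) _ (Nat.mod_lt _ (hL0 t ht)) h⟩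
  · exact Or.inr ⟨t, ht, hT t ht⟩

theorem maskA_prime : ∀ t ∈ maskA, t.1.Prime ∧ t.1 % 3 = 1 ∧ t.2.1 = 1 := by
  simp only [maskA, List.forall_mem_cons]
  norm_num

set_option maxRecDepth 100000 in
theorem tabA_prime0 : ∀ t ∈ tabA0, t.2.1.Prime ∧ t.2.1 % 3 = 1 ∧ t.2.2 = 1 := by
  simp only [tabA0, List.forall_mem_cons]
  norm_num

set_option maxRecDepth 100000 in
theorem tabA_prime1 : ∀ t ∈ tabA1, t.2.1.Prime ∧ t.2.1 % 3 = 1 ∧ t.2.2 = 1 := by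
  simp only [tabA1, List.forall_mem_cons]
  norm_num

set_option maxRecDepth 100000 in
theorem tabA_prime2 : ∀ t ∈ tabA2, t.2.1.Prime ∧ t.2.1 % 3 = 1 ∧ t.2.2 = 1 := by
  simp only [tabA2, List.forall_mem_cons]
  norm_num

set_option maxRecDepth 100000 in
theorem tabA_prime3 : ∀ t ∈ tabA3, t.2.1.Prime ∧ t.2.1 % 3 = 1 ∧ t.2.2 = 1 := by
  simp only [tabA3, List.forall_mem_cons]
  norm_num

set_option maxRecDepth 100000 in
theorem tabA_prime4 : ∀ t ∈ tabA4, t.2.1.Prime ∧ t.2.1 % 3 = 1 ∧ t.2.2 = 1 := by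
  simp only [tabA4, List.forall_mem_cons]
  norm_num

theorem tabA_prime : ∀ t ∈ tabA, t.2.1.Prime ∧ t.2.1 % 3 = 1 ∧ t.2.2 = 1 := by
  intro t ht
  simp only [tabA, List.mem_append] at ht
  rcases ht with h | h | h | h | h
  · exact tabA_prime0 t h
  · exact tabA_prime1 t h
  · exact tabA_prime2 t h
  · exact tabA_prime3 t h
  · exact tabA_prime4 t h

theorem maskB_prime : ∀ t ∈ maskB,
    t.1.Prime ∧ t.1 % 3 = 1 ∧ (t.2.1 * t.2.1 + t.2.1 + 1) % t.1 = 0 := by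
  simp only [maskB, List.forall_mem_cons]
  norm_num

theorem tabB_prime : ∀ t ∈ tabB,
    t.2.1.Prime ∧ t.2.1 % 3 = 1 ∧ (t.2.2 * t.2.2 + t.2.2 + 1) % t.2.1 = 0 := by
  simp only [tabB, tabB0, tabB1, tabB2, tabB3, tabB4, List.cons_append, List.nil_append,
    List.forall_mem_cons]
  norm_num

/-! ### From the certificate to congruences -/

theorem pmA_eq (b e p : ℕ) : pmA b e p = b ^ e % p := rfl

theorem pmGo_eq (p : ℕ) : ∀ k b e : ℕ, pmGo p k b e = b ^ e % p
  | 0, b, e => rfl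
  | k + 1, b, e => by
    rw [pmGo, pmGo_eq p k]
    have key : (b * b % p) ^ (e / 2) % p = (b ^ (2 * (e / 2))) % p := by
      rw [pow_mul, pow_two, ← Nat.pow_mod]
    cases h0 : Nat.beq e 0 with
    | true => rw [Nat.eq_of_beq_eq_true h0]; simp
    | false =>
      cases h1 : Nat.beq (e % 2) 0 with
      | true =>
        have := Nat.eq_of_beq_eq_true h1
        simp only [cond_true, cond_false]
        rw [key, show 2 * (e / 2) = e by omega]
      | false =>
        have := Nat.ne_of_beq_eq_false h1
        simp only [cond_false]
        rw [key, Nat.mul_mod_mod, ← pow_succ', show 2 * (e / 2) + 1 = e by omega]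

theorem pmB_eq (b e p : ℕ) : pmB b e p = b ^ e % p := pmGo_eq p 22 b e

/-- The critical orbit of `z ^ 3 + j ^ 3`. -/
def u {R : Type*} [CommRing R] (j : R) : ℕ → R
  | 0 => 0
  | n + 1 => (u j n) ^ 3 + j ^ 3

theorem map_u {R S : Type*} [CommRing R] [CommRing S] (φ : R →+* S) (j : R) (n : ℕ) :
    φ (u j n) = u (φ j) n := by
  induction n with
  | zero => simp [u]
  | succ n ih => simp [u, ih]

theorem u_neg {R : Type*} [CommRing R] (j : R) (n : ℕ) : u (-j) n = -u j n := by
  induction n with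
  | zero => simp [u]
  | succ n ih => simp only [u, ih]; ring

theorem orbGo_spec {pm : ℕ → ℕ → ℕ → ℕ} {p k d : ℕ} : ∀ {f x : ℕ} {seen : List ℕ},
    orbGo pm p k d f x seen = true →
    (∀ y ∈ seen, 1 < pm (y + d) (p / 3) p ∧
      ((y * y * y + k) % p = x ∨ (y * y * y + k) % p ∈ seen)) →
    ∃ S : Set ℕ, x ∈ S ∧ ∀ y ∈ S, 1 < pm (y + d) (p / 3) p ∧ (y * y * y + k) % p ∈ S
  | 0, _, _, h, _ => by simp [orbGo] at h
  | f + 1, x, seen, h, hs => by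
    rw [orbGo] at h
    cases h1 : List.any seen (Nat.beq x) with
    | true =>
      rw [List.any_eq_true] at h1
      obtain ⟨y, hy, hxy⟩ := h1
      have hx : x ∈ seen := by rw [Nat.eq_of_beq_eq_true hxy]; exact hy
      refine ⟨{y | y ∈ seen}, hx, fun y hy => ⟨(hs y hy).1, ?_⟩⟩
      rcases (hs y hy).2 with h2 | h2
      · rw [h2]; exact hx
      · exact h2
    | false =>
      rw [h1] at h
      cases h2 : Nat.ble (pm (x + d) (p / 3) p) 1 with
      | true => rw [h2] at h; simp at h
      | false =>
        rw [h2] at h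
        have h3 : 1 < pm (x + d) (p / 3) p := by
          by_contra hcon
          have := Nat.ble_eq_true_of_le (not_lt.mp hcon)
          rw [h2] at this; simp at this
        obtain ⟨S, hS, hS'⟩ := orbGo_spec (seen := x :: seen) h (by
          intro y hy
          rcases List.mem_cons.mp hy with rfl | hy
          · exact ⟨h3, Or.inl rfl⟩
          · refine ⟨(hs y hy).1, Or.inr ?_⟩
            rcases (hs y hy).2 with h4 | h4
            · rw [h4]; simp
            · simp [h4])
        refine ⟨insert x S, by simp, ?_⟩
        rintro y (rfl | hy)
        · exact ⟨h3, Or.inr hS⟩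
        · exact ⟨(hS' y hy).1, Or.inr (hS' y hy).2⟩

theorem chk_spec {pm : ℕ → ℕ → ℕ → ℕ} (hpm : ∀ b e p, pm b e p = b ^ e % p) {p w m : ℕ}
    [Fact p.Prime] (h : chk pm p w m = true) :
    ∃ i : ZMod p, i * m = 1 ∧ ∀ n, 1 ≤ n →
      (u i n + w * i) ^ (p / 3) ≠ 0 ∧ (u i n + w * i) ^ (p / 3) ≠ 1 := by
  have hp1 : 1 < p := (Fact.out : p.Prime).one_lt
  rw [chk] at h
  generalize pm (m % p) (p - 2) p = i at h
  rw [chkAux] at h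
  cases h1 : Nat.beq (i * m % p) 1 with
  | false => rw [h1] at h; simp at h
  | true =>
    rw [h1] at h
    have him := Nat.eq_of_beq_eq_true h1
    obtain ⟨S, hS, hS'⟩ := orbGo_spec (seen := []) h (by simp)
    refine ⟨(i : ZMod p), ?_, ?_⟩
    · have : ((i * m % p : ℕ) : ZMod p) = ((1 : ℕ) : ZMod p) := by rw [him]
      simpa [ZMod.natCast_mod] using this
    · have key : ∀ n, ∃ y ∈ S, (y : ZMod p) = u (i : ZMod p) (n + 1) := by
        intro n
        induction n with
        | zero => exact ⟨_, hS, by simp [u, ZMod.natCast_mod]; ring⟩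
        | succ n ih =>
          obtain ⟨y, hy, hyu⟩ := ih
          refine ⟨_, (hS' y hy).2, ?_⟩
          rw [u, ← hyu]
          simp [ZMod.natCast_mod]; ring
      intro n hn
      obtain ⟨k, rfl⟩ : ∃ k, n = k + 1 := ⟨n - 1, by omega⟩
      obtain ⟨y, hy, hyu⟩ := key k
      have h2 := (hS' y hy).1
      rw [hpm] at h2
      have h3 : (u (i : ZMod p) (k + 1) + w * i) ^ (p / 3)
          = (((y + w * i % p) ^ (p / 3) % p : ℕ) : ZMod p) := by
        rw [← hyu]; simp [ZMod.natCast_mod]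
      rw [h3]
      have h4 : (y + w * i % p) ^ (p / 3) % p < p := Nat.mod_lt _ (by omega)
      generalize (y + w * i % p) ^ (p / 3) % p = v at h2 h4 ⊢
      constructor
      · intro h5
        rw [ZMod.natCast_eq_zero_iff] at h5
        have := Nat.le_of_dvd (by omega) h5
        omega
      · intro h5
        have h6 : (v : ZMod p) = ((1 : ℕ) : ZMod p) := by rw [h5]; simp
        rw [ZMod.natCast_eq_natCast_iff'] at h6
        rw [Nat.mod_eq_of_lt h4, Nat.mod_eq_of_lt hp1] at h6
        omega

/-! ### The p-adic reduction -/

theorem noncube_padic {p : ℕ} [Fact p.Prime] (hp : p % 3 = 1) {K : Type*} [Field K]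
    (σ : K →+* ℚ_[p]) {j x : K} {jz wz : ℤ_[p]} (hj : σ j = jz) (hx : σ x = -(wz * jz : ℤ_[p]))
    {n : ℕ} (h0 : (u (PadicInt.toZMod jz) n + PadicInt.toZMod wz * PadicInt.toZMod jz) ^ (p / 3) ≠ 0)
    (h1 : (u (PadicInt.toZMod jz) n + PadicInt.toZMod wz * PadicInt.toZMod jz) ^ (p / 3) ≠ 1)
    (y : K) : y ^ 3 ≠ u j n - x := by
  intro hy
  have e1 : (σ y) ^ 3 = ((u jz n + wz * jz : ℤ_[p]) : ℚ_[p]) := by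
    rw [← map_pow, hy, map_sub, map_u, hj, hx]
    have : ((u jz n : ℤ_[p]) : ℚ_[p]) = u (jz : ℚ_[p]) n :=
      map_u (PadicInt.Coe.ringHom (p := p)) jz n
    push_cast
    rw [this]; ring
  have e2 : ‖σ y‖ ≤ 1 := by
    have : ‖σ y‖ ^ 3 ≤ 1 := by
      rw [← norm_pow, e1]; exact PadicInt.norm_le_one _
    exact (pow_le_one_iff_of_nonneg (norm_nonneg _) (by norm_num)).mp this
  obtain ⟨z, hz⟩ : ∃ z : ℤ_[p], (z : ℚ_[p]) = σ y := ⟨⟨σ y, e2⟩, rfl⟩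
  have e3 : z ^ 3 = u jz n + wz * jz := by
    apply PadicInt.ext
    rw [← e1, ← hz]; simp
  have e4 := congrArg (PadicInt.toZMod (p := p)) e3
  rw [map_pow, map_add, map_mul, map_u] at e4
  rw [← e4, ← pow_mul] at h0 h1
  have hpp : 3 * (p / 3) = p - 1 := by omega
  rw [hpp] at h0 h1
  have hp1 : 1 < p := (Fact.out : p.Prime).one_lt
  by_cases hz0 : PadicInt.toZMod z = 0
  · rw [hz0] at h0
    exact h0 (zero_pow (by omega))
  · exact h1 (ZMod.pow_card_sub_one_eq_one hz0)

theorem exists_inv {p m : ℕ} [Fact p.Prime] {i : ZMod p} (h : i * m = 1) :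
    ∃ jz : ℤ_[p], jz * m = 1 ∧ PadicInt.toZMod jz = i := by
  have hu : IsUnit (m : ℤ_[p]) := by
    by_contra hcon
    have : (m : ℤ_[p]) ∈ IsLocalRing.maximalIdeal ℤ_[p] := hcon
    rw [← PadicInt.ker_toZMod, RingHom.mem_ker, map_natCast] at this
    rw [this] at h; simp at h
  obtain ⟨v, hv⟩ := hu.exists_left_inv
  refine ⟨v, hv, ?_⟩
  have h2 := congrArg (PadicInt.toZMod (p := p)) hv
  rw [map_mul, map_natCast, map_one] at h2
  calc PadicInt.toZMod v = PadicInt.toZMod v * (i * m) := by rw [h, mul_one]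
    _ = i * (PadicInt.toZMod v * m) := by ring
    _ = i := by rw [h2, mul_one]

theorem exists_root {p w : ℕ} [Fact p.Prime] (hp : p % 3 = 1) (hw : (w * w + w + 1) % p = 0) :
    ∃ wz : ℤ_[p], wz ^ 2 + wz + 1 = 0 ∧ PadicInt.toZMod wz = w := by
  have hlt : ∀ x : ℤ_[p], ‖x‖ < 1 ↔ PadicInt.toZMod x = 0 := by
    intro x
    rw [← RingHom.mem_ker, PadicInt.ker_toZMod, IsLocalRing.mem_maximalIdeal,
      PadicInt.mem_nonunits]
  have hw' : (w : ZMod p) ^ 2 + w + 1 = 0 := by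
    have := (ZMod.natCast_eq_zero_iff (w * w + w + 1) p).mpr (Nat.dvd_of_mod_eq_zero hw)
    push_cast at this
    rw [← this]; ring
  have hd : ‖(2 * w + 1 : ℤ_[p])‖ = 1 := by
    refine le_antisymm (PadicInt.norm_le_one _) (not_lt.mp ?_)
    rw [hlt]
    intro h
    simp only [map_add, map_mul, map_natCast, map_one, map_ofNat] at h
    have h3 : ((3 : ℕ) : ZMod p) = 0 := by
      push_cast
      linear_combination 4 * hw' - (2 * (w : ZMod p) + 1) * h
    rw [ZMod.natCast_eq_zero_iff] at h3
    have := (Nat.prime_dvd_prime_iff_eq Fact.out Nat.prime_three).mp h3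
    omega
  have hF : ‖(X ^ 2 + X + 1 : ℤ_[p][X]).aeval (w : ℤ_[p])‖ <
      ‖(X ^ 2 + X + 1 : ℤ_[p][X]).derivative.aeval (w : ℤ_[p])‖ ^ 2 := by
    have e : (X ^ 2 + X + 1 : ℤ_[p][X]).derivative.aeval (w : ℤ_[p]) = 2 * w + 1 := by
      simp [one_add_one_eq_two]
    rw [e, hd, one_pow, hlt]
    simpa using hw'
  obtain ⟨z, hz, hz2, -⟩ := hensels_lemma hF
  refine ⟨z, by simpa using hz, ?_⟩
  have : ‖z - w‖ < 1 := lt_of_lt_of_le hz2 (PadicInt.norm_le_one _)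
  rw [hlt, map_sub, map_natCast, sub_eq_zero] at this
  exact this

/-! ### Irreducibility -/

/-- The iterates. -/
noncomputable def P {K : Type*} [Field K] (j : K) (n : ℕ) : K[X] :=
  ((X ^ 3 + C (j ^ 3) : K[X]).comp ·)^[n] X

theorem P_zero {K : Type*} [Field K] (j : K) : P j 0 = X := rfl

theorem P_succ {K : Type*} [Field K] (j : K) (n : ℕ) : P j (n + 1) = P j n ^ 3 + C (j ^ 3) := by
  rw [P, Function.iterate_succ_apply', ← P]; simp

theorem P_succ' {K : Type*} [Field K] (j : K) (n : ℕ) :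
    P j (n + 1) = (P j n).comp (X ^ 3 + C (j ^ 3)) := by
  induction n with
  | zero => simp [P_succ, P_zero]
  | succ n ih => rw [P_succ j (n + 1)]; nth_rw 2 [P_succ j n]; rw [add_comp, pow_comp, ← ih, C_comp]

theorem P_eval_zero {K : Type*} [Field K] (j : K) (n : ℕ) : (P j n).eval 0 = u j n := by
  induction n with
  | zero => simp [P_zero, u]
  | succ n ih => simp [P_succ, u, ih]

theorem P_map {K L : Type*} [Field K] [Field L] (φ : K →+* L) (j : K) (n : ℕ) :
    (P j n).map φ = P (φ j) n := by
  induction n with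
  | zero => simp [P_zero]
  | succ n ih => simp [P_succ, ih]

theorem P_monic {K : Type*} [Field K] (j : K) (n : ℕ) :
    (P j n).Monic ∧ 0 < (P j n).natDegree := by
  induction n with
  | zero => simp [P_zero, monic_X]
  | succ n ih =>
    have h3 : (P j n ^ 3).Monic := ih.1.pow 3
    have hd : 0 < (P j n ^ 3).natDegree := by rw [ih.1.natDegree_pow]; omega
    rw [P_succ]
    refine ⟨h3.add_of_left ?_, by rwa [natDegree_add_C]⟩
    exact lt_of_le_of_lt degree_C_le (natDegree_pos_iff_degree_pos.mp hd)

theorem P_sub_monic {K : Type*} [Field K] (j x : K) (n : ℕ) : (P j n - C x).Monic :=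
  (P_monic j n).1.sub_of_left
    (lt_of_le_of_lt degree_C_le (natDegree_pos_iff_degree_pos.mp (P_monic j n).2))

theorem norm_sub_gen_s7 {K E : Type*} [Field K] [Field E] [Algebra K E] (pb : PowerBasis K E) (a : K) :
    Algebra.norm K (algebraMap K E a - pb.gen) = (minpoly K pb.gen).eval a := by
  rw [← charpoly_leftMulMatrix, Matrix.eval_charpoly, Algebra.norm_eq_matrix_det pb.basis, map_sub]
  congr 2
  ext i k
  simp [Matrix.scalar_apply, Matrix.algebraMap_eq_diagonal]
  rfl

theorem core {K : Type*} [Field K] (j x : K)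
    (h : ∀ n, 1 ≤ n → ∀ y : K, y ^ 3 ≠ u j n - x) (n : ℕ) : Irreducible (P j n - C x) := by
  induction n with
  | zero => rw [P_zero]; exact irreducible_X_sub_C x
  | succ n ih =>
    have e : P j (n + 1) - C x = (P j n - C x).comp (X ^ 3 + C (j ^ 3)) := by
      rw [sub_comp, C_comp, P_succ']
    rw [e]
    refine Polynomial.irreducible_comp (P_sub_monic j x n) (monic_X_pow_add_C _ (by norm_num)) ih ?_
    intro E _ _ β hβ
    have hint : IsIntegral K β := by
      by_contra hcon
      rw [minpoly.eq_zero hcon] at hβ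
      exact (P_sub_monic j x n).ne_zero hβ.symm
    set g := IntermediateField.AdjoinSimple.gen K β with hg
    have e2 : (X ^ 3 + C (j ^ 3) : K[X]).map (algebraMap K (IntermediateField.adjoin K {β})) - C g
        = X ^ 3 - C (g - algebraMap K _ (j ^ 3)) := by
      simp only [Polynomial.map_add, Polynomial.map_pow, map_X, map_C, C_sub]
      ring
    rw [e2]
    refine X_pow_sub_C_irreducible_of_prime Nat.prime_three ?_
    intro b hb
    have hb' : (-b) ^ 3 = algebraMap K _ (j ^ 3) - g := by
      rw [Odd.neg_pow (by decide), hb]; ring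
    have hn := norm_sub_gen_s7 (IntermediateField.adjoin.powerBasis hint) (j ^ 3)
    rw [IntermediateField.adjoin.powerBasis_gen, ← hg, ← hb', map_pow, hg,
      IntermediateField.minpoly_gen, hβ, eval_sub, eval_C] at hn
    apply h (n + 1) (by omega) _ (hn.trans _)
    rw [← P_eval_zero, P_succ', eval_comp]
    simp

/-! ### Assembling -/

/-- For `m` an integer, there is a prime `p` and a `p`-adic obstruction to
`fⁿ(0) - x` being a cube, where `x = -w / m`, `Q w`. -/
def Good (Q : ∀ (p : ℕ) [Fact p.Prime], ℤ_[p] → Prop) (m : ℤ) : Prop :=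
  ∃ (p : ℕ) (_ : Fact p.Prime) (jz wz : ℤ_[p]), jz * m = 1 ∧ Q p wz ∧
    ∀ (K : Type) [Field K] (σ : K →+* ℚ_[p]) (j x : K), σ j = jz → σ x = -(wz * jz : ℤ_[p]) →
      ∀ n, 1 ≤ n → ∀ y : K, y ^ 3 ≠ u j n - x

theorem good_neg {Q : ∀ (p : ℕ) [Fact p.Prime], ℤ_[p] → Prop} {m : ℤ} (h : Good Q m) :
    Good Q (-m) := by
  obtain ⟨p, hp, jz, wz, h1, h2, h3⟩ := h
  refine ⟨p, hp, -jz, wz, by push_cast; rw [neg_mul_neg, h1], h2, ?_⟩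
  intro K _ σ j x hj hx n hn y hy
  refine h3 K σ (-j) (-x) ?_ ?_ n hn (-y) ?_
  · rw [map_neg, hj]; push_cast; ring
  · rw [map_neg, hx]; push_cast; ring
  · rw [u_neg, Odd.neg_pow (by decide), hy]; ring

theorem good_of {Q : ∀ (p : ℕ) [Fact p.Prime], ℤ_[p] → Prop} {m p w : ℕ} [Fact p.Prime]
    (hp : p % 3 = 1)
    (hQ : ∃ wz : ℤ_[p], Q p wz ∧ PadicInt.toZMod wz = w)
    (h : ∃ i : ZMod p, i * m = 1 ∧ ∀ n, 1 ≤ n →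
      (u i n + w * i) ^ (p / 3) ≠ 0 ∧ (u i n + w * i) ^ (p / 3) ≠ 1) : Good Q m := by
  obtain ⟨i, hi, h⟩ := h
  obtain ⟨jz, hjz, rfl⟩ := exists_inv hi
  obtain ⟨wz, hQ, hwz⟩ := hQ
  refine ⟨p, inferInstance, jz, wz, by simpa using hjz, hQ, ?_⟩
  intro K _ σ j x hj hx n hn y
  rw [← hwz] at h
  exact noncube_padic hp σ hj hx (h n hn).1 (h n hn).2 y

theorem chk_spec' {p w m : ℕ} [Fact p.Prime] (h : chk pmA p w (m % p) = true) :
    ∃ i : ZMod p, i * m = 1 ∧ ∀ n, 1 ≤ n →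
      (u i n + w * i) ^ (p / 3) ≠ 0 ∧ (u i n + w * i) ^ (p / 3) ≠ 1 := by
  obtain ⟨i, hi, h⟩ := chk_spec pmA_eq h
  exact ⟨i, by simpa [ZMod.natCast_mod] using hi, h⟩

theorem goodA_nat (m : ℕ) (h1 : 0 < m) (h2 : m ≤ 10000) : Good (fun _ _ wz => wz = 1) m := by
  rcases cover_chk maskA_ok tabA_ok (fun t ht => (maskA_prime t ht).1.pos) (coverA m h1 h2) with
    ⟨t, ht, h⟩ | ⟨t, ht, h⟩
  · obtain ⟨hp, h3, hw⟩ := maskA_prime t ht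
    have : Fact t.1.Prime := ⟨hp⟩
    exact good_of h3 ⟨1, rfl, by rw [hw]; simp⟩ (chk_spec' h)
  · obtain ⟨hp, h3, hw⟩ := tabA_prime t ht
    have : Fact t.2.1.Prime := ⟨hp⟩
    exact good_of h3 ⟨1, rfl, by rw [hw]; simp⟩ (chk_spec pmB_eq h)

theorem goodB_nat (m : ℕ) (h1 : 0 < m) (h2 : m ≤ 10000) :
    Good (fun _ _ wz => wz ^ 2 + wz + 1 = 0) m := by
  rcases cover_chk maskB_ok tabB_ok (fun t ht => (maskB_prime t ht).1.pos) (coverB m h1 h2) with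
    ⟨t, ht, h⟩ | ⟨t, ht, h⟩
  · obtain ⟨hp, h3, hw⟩ := maskB_prime t ht
    have : Fact t.1.Prime := ⟨hp⟩
    exact good_of h3 (exists_root h3 hw) (chk_spec' h)
  · obtain ⟨hp, h3, hw⟩ := tabB_prime t ht
    have : Fact t.2.1.Prime := ⟨hp⟩
    exact good_of h3 (exists_root h3 hw) (chk_spec pmB_eq h)

theorem good_int {Q : ∀ (p : ℕ) [Fact p.Prime], ℤ_[p] → Prop}
    (h : ∀ m : ℕ, 0 < m → m ≤ 10000 → Good Q m) (m : ℤ) (h0 : m ≠ 0) (h1 : |m| ≤ 10000) :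
    Good Q m := by
  have h2 := h m.natAbs (by omega) (by rw [Int.abs_eq_natAbs] at h1; omega)
  rcases Int.natAbs_eq m with h3 | h3
  · rw [h3]; exact h2
  · rw [h3]; exact good_neg h2

theorem cast_inv {p : ℕ} [Fact p.Prime] {jz : ℤ_[p]} {m : ℤ} (h : jz * m = 1) (h0 : m ≠ 0) :
    (((1 / (m : ℚ)) : ℚ) : ℚ_[p]) = jz := by
  have h2 : (jz : ℚ_[p]) * m = 1 := by
    have := congrArg (fun z : ℤ_[p] => (z : ℚ_[p])) h
    simpa using this
  have h3 : (m : ℚ_[p]) ≠ 0 := by exact_mod_cast h0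
  push_cast
  rw [div_eq_iff h3, h2]

theorem irredA (m : ℤ) (h0 : m ≠ 0) (h1 : |m| ≤ 10000) (n : ℕ) :
    Irreducible (P (1 / (m : ℚ)) n + C (1 / (m : ℚ))) := by
  obtain ⟨p, hp, jz, wz, hjz, rfl, h⟩ := good_int goodA_nat m h0 h1
  have h2 := core (1 / (m : ℚ)) (-(1 / (m : ℚ)))
    (h ℚ (Rat.castHom ℚ_[p]) _ _ (cast_inv hjz h0) (by
      rw [map_neg, one_mul]; exact congrArg _ (cast_inv hjz h0))) n
  rwa [C_neg, sub_neg_eq_add] at h2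

theorem quad_monic (j : ℚ) : (X ^ 2 - C j * X + C (j ^ 2) : ℚ[X]).Monic := by
  monicity!

theorem quad_irred (j : ℚ) (hj : j ≠ 0) : Irreducible (X ^ 2 - C j * X + C (j ^ 2) : ℚ[X]) := by
  have hd : (X ^ 2 - C j * X + C (j ^ 2) : ℚ[X]).natDegree = 2 := by compute_degree!
  rw [(quad_monic j).irreducible_iff_roots_eq_zero_of_degree_le_three (by omega) (by omega)]
  rw [Multiset.eq_zero_iff_forall_notMem]
  intro a ha
  have := (mem_roots'.mp ha).2
  simp only [IsRoot.def, eval_add, eval_sub, eval_pow, eval_X, eval_mul, eval_C] at this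
  have hj2 : 0 < j ^ 2 := by positivity
  nlinarith [sq_nonneg (2 * a - j)]

theorem exists_embed {F E L : Type*} [Field F] [Field E] [Algebra F E] [Field L] [Algebra F L]
    {x : E} (hint : IsIntegral F x) (z : L) (hz : aeval z (minpoly F x) = 0) :
    ∃ σ : IntermediateField.adjoin F {x} →+* L, (∀ a : F, σ (algebraMap F _ a) = algebraMap F L a) ∧
      σ (IntermediateField.AdjoinSimple.gen F x) = z := by
  have hroot : aeval z (minpoly F (IntermediateField.adjoin.powerBasis hint).gen) = 0 := by
    rwa [IntermediateField.adjoin.powerBasis_gen, IntermediateField.minpoly_gen]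
  refine ⟨((IntermediateField.adjoin.powerBasis hint).lift z hroot : _ →+* L), fun a => ?_, ?_⟩
  · exact ((IntermediateField.adjoin.powerBasis hint).lift z hroot).commutes a
  · have := (IntermediateField.adjoin.powerBasis hint).lift_gen _ hroot
    rw [IntermediateField.adjoin.powerBasis_gen] at this
    exact this

theorem irredB (m : ℤ) (h0 : m ≠ 0) (h1 : |m| ≤ 10000) (n : ℕ) :
    Irreducible ((X ^ 2 - C (1 / (m : ℚ)) * X + C ((1 / (m : ℚ)) ^ 2) : ℚ[X]).comp
      (P (1 / (m : ℚ)) n)) := by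
  obtain ⟨p, hp, jz, wz, hjz, hwz, h⟩ := good_int goodB_nat m h0 h1
  have hj0 : (1 / (m : ℚ)) ≠ 0 := by
    have : (m : ℚ) ≠ 0 := by exact_mod_cast h0
    positivity
  have hcast := cast_inv hjz h0
  generalize (1 / (m : ℚ)) = j at *
  refine Polynomial.irreducible_comp (quad_monic j) (P_monic j n).1 (quad_irred j hj0) ?_
  intro E _ _ x hx
  have hint : IsIntegral ℚ x := by
    by_contra hcon
    rw [minpoly.eq_zero hcon] at hx
    exact (quad_monic j).ne_zero hx.symm
  rw [P_map]
  have hroot : aeval (-((wz * jz : ℤ_[p]) : ℚ_[p]))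
      (minpoly ℚ x) = 0 := by
    rw [hx]
    have h2 : (wz : ℚ_[p]) ^ 2 + wz + 1 = 0 := by
      have := congrArg (fun z : ℤ_[p] => (z : ℚ_[p])) hwz
      simpa using this
    simp only [map_add, map_sub, map_mul, map_pow, aeval_X, aeval_C, eq_ratCast, hcast]
    push_cast
    linear_combination (jz : ℚ_[p]) ^ 2 * h2
  obtain ⟨σ, hσ1, hσ2⟩ := exists_embed hint _ hroot
  refine core _ _ (h _ σ _ _ ?_ hσ2) n
  rw [hσ1, eq_ratCast, hcast]

theorem exists_cube_root {c : ℤ} {b : ℚ} (h : b ^ 3 = c) : ∃ m : ℤ, (m : ℚ) = b := by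
  have : IsIntegral ℤ b := ⟨X ^ 3 - C c, monic_X_pow_sub_C _ (by norm_num), by
    simp only [eval₂_sub, eval₂_pow, eval₂_X, eval₂_C, h]; simp⟩
  obtain ⟨m, hm⟩ := IsIntegrallyClosed.isIntegral_iff.mp this
  exact ⟨m, by simpa using hm⟩




/-- If `c` is a nonzero integer with `|c| ≤ 10¹²` and `f(z) = z³ + 1/c` is reducible
over `ℚ`, then every iterate `fⁿ` (`n ≥ 1`) is the product of exactly two monic
irreducible polynomials of `ℚ[z]`. -/
theorem stmt7 (c : ℤ) (hc : c ≠ 0) (hbound : |c| ≤ 10 ^ 12)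
    (f : ℚ[X]) (hf : f = X ^ 3 + C (1 / (c : ℚ))) (hred : ¬ Irreducible f) :
    ∀ n : ℕ, 1 ≤ n → ∃ p q : ℚ[X], p.Monic ∧ q.Monic ∧ Irreducible p ∧ Irreducible q ∧
      (f.comp ·)^[n] X = p * q := by
  intro n hn
  have hcQ : (c : ℚ) ≠ 0 := by exact_mod_cast hc
  obtain ⟨m, hm⟩ : ∃ m : ℤ, c = m ^ 3 := by
    have e : f = X ^ 3 - C (-(1 / (c : ℚ))) := by rw [hf, C_neg, sub_neg_eq_add]
    rw [e, X_pow_sub_C_irreducible_iff_of_prime Nat.prime_three] at hred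
    push Not at hred
    obtain ⟨b, hb⟩ := hred
    have hb0 : b ≠ 0 := by
      rintro rfl
      have : (1 / (c : ℚ)) ≠ 0 := by positivity
      apply this
      linear_combination hb
    have h3 : (-b⁻¹) ^ 3 = (c : ℚ) := by
      rw [Odd.neg_pow (by decide), inv_pow, hb]
      field_simp
    obtain ⟨m, hm⟩ := exists_cube_root h3
    refine ⟨m, ?_⟩
    rw [← hm] at h3
    exact_mod_cast h3.symm
  have hm0 : m ≠ 0 := by rintro rfl; simp at hm; exact hc hm
  have hm1 : |m| ≤ 10000 := by
    rw [hm, abs_pow] at hbound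
    by_contra hcon
    push Not at hcon
    have : (10000 : ℤ) ^ 3 < |m| ^ 3 := by gcongr
    norm_num at this hbound
    omega
  obtain ⟨k, rfl⟩ : ∃ k, n = k + 1 := ⟨n - 1, by omega⟩
  have hfP : (f.comp ·)^[k + 1] X = P (1 / (m : ℚ)) (k + 1) := by
    rw [P, hf, hm]; push_cast; simp
  rw [hfP, P_succ]
  have hA := irredA m hm0 hm1 k
  have hB := irredB m hm0 hm1 k
  generalize (1 / (m : ℚ)) = j at hA hB ⊢
  refine ⟨_, _, ?_, ?_, hA, hB, ?_⟩
  · simpa using P_sub_monic j (-j) k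
  · exact (quad_monic j).comp (P_monic j k).1 (P_monic j k).2.ne'
  · simp only [add_comp, sub_comp, pow_comp, mul_comp, X_comp, C_comp, C_pow]
    ring
end

section
/- For every integer m with |m| ≥ 2, the integer m⁴ − m² + 1 is not the cube of an integer. -/
theorem fin_check : ∀ e ∈ Finset.range 41, ∀ p ∈ Finset.range 201,
    0 < e → 0 < p → 3 * p ^ 2 * e ^ 2 + 3 * p * e = e ^ 3 + 8 * p ^ 3 + 1 → e < 2 * p ^ 2 →
    (3 * p ^ 2 = e + 1 ∧ e = 1) ∨ False := by
  decide +kernel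

theorem arith_pe (p e : ℤ) (hp : 1 ≤ p) (he0 : e ≠ 0) (he : e < 2 * p ^ 2)
    (h : p ^ 2 * (3 * e ^ 2 - 8 * p) = e ^ 3 - 3 * p * e + 1) : False := by
  rcases lt_trichotomy (3 * e ^ 2 - 8 * p) 0 with hf | hf | hf
  · have h1 : p ^ 2 ≤ 3 * p * e - e ^ 3 - 1 := by nlinarith [sq_nonneg p]
    rcases lt_or_gt_of_ne he0 with hneg | hpos
    · nlinarith [mul_pos (neg_pos.2 hneg) hp, mul_pos (neg_pos.2 hneg) (neg_pos.2 hf)]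
    · have h2 : p < 3 * e := by nlinarith [pow_pos hpos 3]
      have h3 : e < 8 := by nlinarith
      have h4 : p < 24 := by omega
      interval_cases e <;> interval_cases p <;> omega
  · rw [hf] at h
    have h1 : e * (3 * p - e ^ 2) = 1 := by linarith
    rcases Int.eq_one_or_neg_one_of_mul_eq_one h1 with rfl | rfl <;> omega
  · have h1 : p ^ 2 ≤ e ^ 3 - 3 * p * e + 1 := by nlinarith [sq_nonneg p]
    rcases lt_or_gt_of_ne he0 with hneg | hpos
    · obtain ⟨s, rfl⟩ : ∃ s, e = -s := ⟨-e, by ring⟩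
      have hs : 1 ≤ s := by omega
      have h2 : 3 * p ^ 2 ≤ p * s + 3 := by nlinarith
      have h3 : s ^ 2 ≤ 3 * p := by
        by_contra hc
        nlinarith [sq_nonneg p]
      have h4 : 3 * p ≤ s + 3 := by nlinarith
      have h5 : s < 3 := by nlinarith
      have h6 : p < 3 := by omega
      interval_cases s <;> interval_cases p <;> omega
    · have h2 : e ^ 2 ≤ 8 * p := by
        have : p ^ 2 * e ^ 2 ≤ p ^ 2 * (8 * p) := by
          nlinarith [mul_pos hpos (show 0 < p by omega), mul_nonneg (sq_nonneg e) (show 0 ≤ 2 * p ^ 2 - e by omega)]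
        exact le_of_mul_le_mul_left this (by positivity)
      have h3 : p ≤ 5 * e := by
        by_contra hc
        have : p ^ 2 ≤ 5 * p * e + 1 := by nlinarith
        nlinarith
      have h4 : e ≤ 40 := by nlinarith
      lift e to ℕ using hpos.le
      lift p to ℕ using (by omega)
      have := fin_check e (by simp; omega) p (by simp; omega) (by omega) (by omega)
        (by zify; linarith) (by exact_mod_cast he)
      rcases this with ⟨h5, h6⟩ | h5
      · subst h6; omega
      · exact h5

theorem arith_cd (m c d : ℤ) (hm : 4 ≤ m ^ 2) (h1 : m ^ 2 - 1 = c ^ 3 - 3 * c * d ^ 2)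
    (h2 : m = 3 * c ^ 2 * d - d ^ 3) : False := by
  have hd : d ≠ 0 := by rintro rfl; subst h2; norm_num at hm
  have hd2 : 1 ≤ d ^ 2 := by have := sq_pos_of_ne_zero hd; omega
  have hm2 : m ^ 2 = d ^ 2 * (3 * c ^ 2 - d ^ 2) ^ 2 := by rw [h2]; ring
  have hcd : c ^ 2 < d ^ 2 := by
    by_contra hc
    push Not at hc
    have ha : (2 * c ^ 2) ^ 2 ≤ (3 * c ^ 2 - d ^ 2) ^ 2 := pow_le_pow_left₀ (by positivity) (by linarith) 2
    have hb : 4 * c ^ 4 ≤ m ^ 2 := by nlinarith [sq_nonneg (3 * c ^ 2 - d ^ 2)]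
    have hc1 : |c ^ 2 - 3 * d ^ 2| ≤ 2 * c ^ 2 := by rw [abs_le]; constructor <;> linarith
    have h3 : m ^ 2 - 1 ≤ |c| * (2 * c ^ 2) := by
      calc m ^ 2 - 1 = c * (c ^ 2 - 3 * d ^ 2) := by rw [h1]; ring
        _ ≤ |c * (c ^ 2 - 3 * d ^ 2)| := le_abs_self _
        _ ≤ _ := by rw [abs_mul]; exact mul_le_mul_of_nonneg_left hc1 (abs_nonneg c)
    have hx : c ^ 2 = |c| ^ 2 := (sq_abs c).symm
    have hx4 : c ^ 4 = |c| ^ 4 := by rw [show c ^ 4 = (c ^ 2) ^ 2 by ring, hx]; ring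
    rw [hx4] at hb
    rw [hx] at h3 hc
    have hpos : 1 ≤ |c| := by
      by_contra h0
      have : |c| = 0 := by have := abs_nonneg c; omega
      rw [this] at hc; norm_num at hc; omega
    have : |c| ^ 3 ≤ |c| ^ 4 := pow_le_pow_right₀ hpos (by norm_num)
    have : 1 ≤ |c| ^ 4 := one_le_pow₀ hpos
    nlinarith
  have hcneg : c < 0 := by
    by_contra hc
    push Not at hc
    nlinarith [mul_nonneg hc (show 0 ≤ 3 * d ^ 2 - c ^ 2 by nlinarith)]
  refine arith_pe (-c) (3 * c ^ 2 - d ^ 2) (by omega) ?_ (by nlinarith) ?_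
  · intro h0; rw [h0] at hm2; norm_num at hm2; rw [hm2] at hm; norm_num at hm
  · rw [hm2] at h1; linear_combination h1

/-- For every integer `m` with `|m| ≥ 2`, the integer `m⁴ - m² + 1` is not the cube
of an integer. -/
theorem stmt14 (m : ℤ) (hm : 2 ≤ |m|) : ¬ ∃ k : ℤ, m ^ 4 - m ^ 2 + 1 = k ^ 3 := by
  rintro ⟨k, hk⟩
  have hm4 : 4 ≤ m ^ 2 := by rw [← sq_abs]; nlinarith
  obtain ⟨t, ht⟩ : ∃ t, m ^ 4 - m ^ 2 = 2 * t := by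
    have : Even (m ^ 4 - m ^ 2) := by simp [Int.even_sub, Int.even_pow]
    exact this.two_dvd
  let z : GaussianInt := ⟨m ^ 2 - 1, m⟩
  let z' : GaussianInt := ⟨m ^ 2 - 1, -m⟩
  have hz : z * z' = (⟨k, 0⟩ : GaussianInt) ^ 3 := by
    rw [pow_succ, pow_two]
    ext <;> simp [z, z']
    · linarith
    · ring
  have hco : IsCoprime z z' := by
    refine ⟨z' - ⟨t, 0⟩ * ⟨-1, -m⟩, - (⟨t, 0⟩ * ⟨-1, m⟩), ?_⟩
    ext <;> simp [z, z']
    · linear_combination ht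
    · ring
  obtain ⟨w, u, hu⟩ := exists_associated_pow_of_mul_eq_pow' hco hz
  obtain ⟨x, y⟩ := w
  have hn := (Zsqrtd.norm_eq_one_iff' (by norm_num) (u : GaussianInt)).2 u.isUnit
  generalize (u : GaussianInt) = v at hu hn
  obtain ⟨a, b⟩ := v
  rw [Zsqrtd.norm_def] at hn
  simp at hn
  rw [pow_succ, pow_two] at hu
  have hre := congrArg Zsqrtd.re hu
  have him := congrArg Zsqrtd.im hu
  simp [z] at hre him
  have ha1 : a ≤ 1 := by nlinarith [mul_self_nonneg b]
  have ha2 : -1 ≤ a := by nlinarith [mul_self_nonneg b]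
  have hb1 : b ≤ 1 := by nlinarith [mul_self_nonneg a]
  have hb2 : -1 ≤ b := by nlinarith [mul_self_nonneg a]
  interval_cases a <;> interval_cases b <;> norm_num at hn
  · exact arith_cd m (-x) (-y) hm4 (by linarith) (by linarith)
  · exact arith_cd m (-y) x hm4 (by linarith) (by linarith)
  · exact arith_cd m y (-x) hm4 (by linarith) (by linarith)
  · exact arith_cd m x y hm4 (by linarith) (by linarith)
end

section
/- Let m be an integer with |m| ≥ 2, f(z) = z³ + 1/m³ ∈ ℚ[z] and g₂(z) = z² − z/m + 1/m². For every n ≥ 1, the numerator in lowest terms of the rational number g₂(f^{2n−1}(0)) is not the cube of an integer. -/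
open Polynomial

lemma box_check_one : ∀ d ∈ Finset.Icc (-20 : ℤ) 20, ∀ N ∈ Finset.Icc (-34 : ℤ) 34,
    N * (N - 3 * d ^ 2) ^ 2 = 64 * (d ^ 3 + 1) + 24 * d * (N - 3 * d ^ 2) →
    (d = -1 ∧ N = 3) ∨ (d = 3 ∧ N = 19) ∨ (d = 2 ∧ N = 0) ∨ (d = 0 ∧ N = 4) := by
  decide +kernel

lemma box_check_two : ∀ d ∈ Finset.Icc (-12 : ℤ) 12, ∀ p ∈ Finset.Icc (-5 : ℤ) 5,
    8 * p ^ 3 + 3 * p ^ 2 * d ^ 2 - 3 * d * p - d ^ 3 - 1 = 0 →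
    (d = -1 ∧ p = 0) ∨ 3 * p ^ 2 - d = 0 := by
  decide +kernel

lemma box_bound (p d q : ℤ) (hq0 : q ≠ 0) (hd0 : d ≠ 0) (hq : q ^ 2 = 3 * p ^ 2 - d)
    (h2 : p * (p ^ 2 - 3 * q ^ 2) = q ^ 2 * d ^ 2 - 1)
    (h : 8 * p ^ 3 + 3 * p ^ 2 * d ^ 2 - 3 * d * p - d ^ 3 - 1 = 0) :
    (|d| ≤ 20 ∧ |8 * p + 3 * d ^ 2| ≤ 34) ∨ (|d| ≤ 12 ∧ |p| ≤ 5) := by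
  have hN : (8 * p + 3 * d ^ 2) * p ^ 2 = d ^ 3 + 3 * d * p + 1 := by linarith
  have hq1 : 1 ≤ q ^ 2 := by have := sq_nonneg q; have : q ^ 2 ≠ 0 := by positivity
                             omega
  have hd1 : 1 ≤ |d| := Int.one_le_abs hd0
  have hp0' : 0 ≤ |p| := abs_nonneg p
  have hup : |d ^ 3 + 3 * d * p + 1| ≤ |d| ^ 3 + 3 * |d| * |p| + 1 := by
    refine (abs_add_le _ _).trans ?_
    have := abs_add_le (d ^ 3) (3 * d * p)
    rw [abs_pow, abs_mul, abs_mul] at this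
    simp only [Nat.abs_ofNat, abs_one] at *
    linarith
  have hNabs : |8 * p + 3 * d ^ 2| * |p| ^ 2 ≤ |d| ^ 3 + 3 * |d| * |p| + 1 := by
    rw [← abs_pow, ← abs_mul, hN]; exact hup
  have hsz : q ^ 2 * |d| ^ 2 ≤ |p| ^ 3 + 3 * |p| * q ^ 2 + 1 := by
    have e : q ^ 2 * |d| ^ 2 = p * (p ^ 2 - 3 * q ^ 2) + 1 := by rw [sq_abs]; linarith
    rw [e]
    have h1 : p ^ 3 ≤ |p| ^ 3 := by rw [← abs_pow]; exact le_abs_self _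
    have h3 : -p ≤ |p| := neg_le_abs p
    nlinarith
  have hNlow : 3 * |d| ^ 2 - 8 * |p| ≤ |8 * p + 3 * d ^ 2| := by
    rw [sq_abs]
    have := neg_le_abs p
    have := le_abs_self (8 * p + 3 * d ^ 2)
    linarith
  have hNz : 8 * p + 3 * d ^ 2 ≠ 0 := by
    intro h0
    rw [h0, zero_mul] at hN
    have h8 : d ^ 3 = 8 := by nlinarith
    have : d = 2 := by
      have : d ^ 3 = 2 ^ 3 := by rw [h8]; norm_num
      exact (Odd.strictMono_pow (by decide : Odd 3)).injective this
    subst this; omega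
  have hN1 : 1 ≤ |8 * p + 3 * d ^ 2| := Int.one_le_abs hNz
  generalize |8 * p + 3 * d ^ 2| = N at *
  generalize |d| = δ at *
  generalize |p| = P at *
  clear hN hup h h2 hq
  have hpp : P ^ 2 ≤ δ ^ 3 + 3 * δ * P + 1 := by nlinarith [sq_nonneg P]
  by_cases hc : δ ^ 2 ≤ 8 * P
  · -- large regime
    have hP1 : 1 ≤ P := by nlinarith
    have h1 : P ^ 2 ≤ 11 * δ * P + 1 := by nlinarith
    have h3 : P ≤ 11 * δ + 1 := by
      by_contra hh; push Not at hh; nlinarith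
    have h4 : δ ≤ 89 := by by_contra hh; push Not at hh; nlinarith
    have h6 : δ ≤ 20 := by
      by_contra hh
      push Not at hh
      have hN5 : N ≤ 5 := by
        by_contra hn
        push Not at hn
        have : 6 * P ^ 2 ≤ N * P ^ 2 := by gcongr; linarith
        have h7 : 6 * P ^ 2 ≤ 11 * δ * P + 1 := by nlinarith
        have h8 : 6 * P ≤ 11 * δ + 1 := by nlinarith
        nlinarith
      have h9 : 3 * δ ^ 2 ≤ 8 * P + 5 := by linarith
      nlinarith
    refine Or.inl ⟨h6, ?_⟩
    have h7 : N * P ≤ 11 * δ + 1 := by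
      have : (N * P) * P ≤ (11 * δ + 1) * P := by nlinarith
      exact le_of_mul_le_mul_right this (by linarith)
    by_contra hh
    push Not at hh
    have h8 : 35 * P ≤ 11 * δ + 1 := by nlinarith
    have h9 : δ ≤ 2 := by nlinarith
    linarith
  · push Not at hc
    have h5 : 2 * δ ^ 2 * P ^ 2 ≤ δ ^ 3 + 3 * δ * P + 1 := by nlinarith [sq_nonneg P]
    have hle : δ ^ 2 ≤ P ^ 3 + 3 * P + 1 := by
      by_cases h6 : δ ^ 2 ≤ 3 * P
      · nlinarith [pow_nonneg hp0' 3]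
      · push Not at h6
        nlinarith
    have hP : P ≤ 5 := by
      by_contra hh
      push Not at hh
      have h7 : 2 * P ^ 2 ≤ δ + 3 * P + 1 := by
        by_contra h8
        push Not at h8
        have : δ ^ 2 * (δ + 3 * P + 2) ≤ δ ^ 2 * (2 * P ^ 2) := by
          apply mul_le_mul_of_nonneg_left _ (by positivity); linarith
        have : δ * P ≤ δ ^ 2 * P := by nlinarith
        nlinarith
      have h9 : P ^ 2 ≤ δ := by nlinarith
      have h10 : (P ^ 2) ^ 2 ≤ δ ^ 2 := by gcongr
      have h11 : 6 * P ^ 3 ≤ (P ^ 2) ^ 2 := by nlinarith [pow_nonneg hp0' 3]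
      nlinarith [pow_nonneg hp0' 3, pow_nonneg hp0' 2]
    refine Or.inr ⟨?_, hP⟩
    by_contra hh
    push Not at hh
    have : P ^ 3 ≤ 5 ^ 3 := by gcongr
    nlinarith

lemma phi12_not_cube (m : ℤ) (hm : 2 ≤ |m|) (y : ℤ) : m ^ 4 - m ^ 2 + 1 ≠ y ^ 3 := by
  intro h
  obtain ⟨j, hj⟩ : ∃ j, m * (m ^ 2 - 1) = 2 * j := by
    have : Even (m * (m ^ 2 - 1)) := by
      rcases Int.even_or_odd m with h | h
      · exact h.mul_right _
      · exact (h.pow.sub_odd odd_one).mul_left _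
    obtain ⟨j, hj⟩ := this
    exact ⟨j, by linarith⟩
  let α : GaussianInt := ⟨m ^ 2 - 1, m⟩
  let β : GaussianInt := ⟨m ^ 2 - 1, -m⟩
  have hco : IsCoprime α β := by
    refine ⟨⟨0, j⟩, α - ⟨0, j⟩, ?_⟩
    ext
    · simp [α, β]; linear_combination m * hj
    · simp [α, β]; ring
  have hprod : α * β = (⟨y, 0⟩ : GaussianInt) ^ 3 := by
    ext
    · simp [α, β, pow_succ]; nlinarith
    · simp [α, β, pow_succ]; ring
  obtain ⟨γ, hγ⟩ := exists_associated_pow_of_mul_eq_pow' hco hprod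
  obtain ⟨w, hw⟩ := hγ
  obtain ⟨κ, hκ⟩ : ∃ κ : GaussianInt, κ ^ 3 = α := by
    have hw4 : (w : GaussianInt) ^ 4 = 1 := by
      have h1 : Int.natAbs (Zsqrtd.norm (w : GaussianInt)) = 1 :=
        Zsqrtd.norm_eq_one_iff.mpr w.isUnit
      obtain ⟨⟨a, b⟩, w', _, _⟩ := w
      simp only at h1 ⊢
      have h2 : a * a + b * b = 1 := by
        have := Zsqrtd.norm_nonneg (by norm_num : (-1 : ℤ) ≤ 0) (⟨a, b⟩ : GaussianInt)
        rw [Zsqrtd.norm_def] at *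
        simp at *
        omega
      have ha : -1 ≤ a ∧ a ≤ 1 := ⟨by nlinarith, by nlinarith⟩
      have hb : -1 ≤ b ∧ b ≤ 1 := ⟨by nlinarith, by nlinarith⟩
      obtain ⟨ha1, ha2⟩ := ha
      obtain ⟨hb1, hb2⟩ := hb
      interval_cases a <;> interval_cases b <;> first | omega | rfl
    refine ⟨γ * w ^ 3, ?_⟩
    calc (γ * (w : GaussianInt) ^ 3) ^ 3 = γ ^ 3 * w * ((w : GaussianInt) ^ 4) ^ 2 := by ring
      _ = α := by rw [hw4, hw]; ring
  obtain ⟨p, q⟩ := κ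
  have hre := congrArg Zsqrtd.re hκ
  have him := congrArg Zsqrtd.im hκ
  simp [α, pow_succ] at hre him
  have hre' : m ^ 2 - 1 = p * (p ^ 2 - 3 * q ^ 2) := by nlinarith
  have him' : m = q * (3 * p ^ 2 - q ^ 2) := by nlinarith
  obtain ⟨d, hd⟩ : ∃ d, d = 3 * p ^ 2 - q ^ 2 := ⟨_, rfl⟩
  rw [← hd] at him'
  have hm0 : m ≠ 0 := by rintro rfl; simp at hm
  have hq0 : q ≠ 0 := by rintro rfl; simp at him'; exact hm0 him'
  have hd0 : d ≠ 0 := by rintro rfl; simp at him'; exact hm0 him'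
  have hq : q ^ 2 = 3 * p ^ 2 - d := by linarith
  have h2 : p * (p ^ 2 - 3 * q ^ 2) = q ^ 2 * d ^ 2 - 1 := by rw [← hre', him']; ring
  have hE : 8 * p ^ 3 + 3 * p ^ 2 * d ^ 2 - 3 * d * p - d ^ 3 - 1 = 0 := by
    rw [hq] at h2; linarith
  have hfin : (d = -1 ∧ p = 0) ∨ 3 * p ^ 2 - d = 0 := by
    rcases box_bound p d q hq0 hd0 hq h2 hE with ⟨hdb, hpb⟩ | ⟨hdb, hpb⟩
    · rcases box_check_one d (Finset.mem_Icc.mpr (abs_le.mp hdb)) (8 * p + 3 * d ^ 2)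
        (Finset.mem_Icc.mpr (abs_le.mp hpb)) (by linear_combination 64 * hE)
        with ⟨rfl, h0⟩ | ⟨rfl, h0⟩ | ⟨rfl, h0⟩ | ⟨rfl, h0⟩
      · exact Or.inl ⟨rfl, by omega⟩
      · obtain rfl : p = -1 := by omega
        norm_num
      · omega
      · omega
    · exact box_check_two d (Finset.mem_Icc.mpr (abs_le.mp hdb)) p
        (Finset.mem_Icc.mpr (abs_le.mp hpb)) hE
  rcases hfin with ⟨rfl, rfl⟩ | h0
  · have : m ^ 2 = 1 := by rw [him']; linarith
    rw [← sq_abs] at this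
    nlinarith
  · rw [← hq] at h0
    exact hq0 (by simpa using h0)

lemma orbit_even (m : ℤ) (hm0 : m ≠ 0) (f : ℚ[X]) (hf : f = X ^ 3 + C (1 / (m : ℚ) ^ 3)) (j : ℕ) :
    ∃ (c : ℕ) (u : ℤ), (((f.comp ·)^[2 * j] X).eval 0) = (u : ℚ) / (m : ℚ) ^ (8 * c + 1) ∧
      (m ^ 4 - m ^ 2 + 1) ∣ u ∧ IsCoprime (u ^ 3 + m ^ (24 * c)) m := by
  have hmq : (m : ℚ) ≠ 0 := by exact_mod_cast hm0
  induction j with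
  | zero => exact ⟨0, 0, by simp, dvd_zero _, by simpa using isCoprime_one_left⟩
  | succ j ih =>
    obtain ⟨c, u, h1, h2, h3⟩ := ih
    refine ⟨9 * c + 1, (u ^ 3 + m ^ (24 * c)) ^ 3 + m ^ (72 * c + 6), ?_, ?_, ?_⟩
    · rw [show 2 * (j + 1) = 2 * j + 1 + 1 by ring, Function.iterate_succ_apply',
        Function.iterate_succ_apply', eval_comp, eval_comp, h1, hf]
      simp only [eval_add, eval_pow, eval_X, eval_C]
      push_cast
      field_simp
      ring
    · have h6 : m ^ 6 ≡ -1 [ZMOD (m ^ 4 - m ^ 2 + 1)] := by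
        apply Int.ModEq.symm
        rw [Int.modEq_iff_dvd]
        exact ⟨m ^ 2 + 1, by ring⟩
      have hu : u ≡ 0 [ZMOD (m ^ 4 - m ^ 2 + 1)] := (Int.modEq_zero_iff_dvd).mpr h2
      apply (Int.modEq_zero_iff_dvd).mp
      have e : (u ^ 3 + m ^ (24 * c)) ^ 3 + m ^ (72 * c + 6)
          = (u ^ 3 + ((m ^ 6) ^ 4) ^ c) ^ 3 + ((m ^ 6) ^ 12) ^ c * m ^ 6 := by
        rw [← pow_mul, ← pow_mul, ← pow_mul, ← pow_mul]; ring
      rw [e]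
      have := (((hu.pow 3).add ((h6.pow 4).pow c)).pow 3).add (((h6.pow 12).pow c).mul h6)
      refine this.trans ?_
      norm_num
    · have h9 : IsCoprime ((u ^ 3 + m ^ (24 * c)) ^ 9) m := h3.pow_left
      have e : ((u ^ 3 + m ^ (24 * c)) ^ 3 + m ^ (72 * c + 6)) ^ 3 + m ^ (24 * (9 * c + 1))
        = (u ^ 3 + m ^ (24 * c)) ^ 9 + m * (m ^ (72 * c + 5) *
          (3 * (u ^ 3 + m ^ (24 * c)) ^ 6 + 3 * (u ^ 3 + m ^ (24 * c)) ^ 3 * m ^ (72 * c + 6)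
            + (m ^ (72 * c + 6)) ^ 2) + m ^ (216 * c + 23)) := by
        ring
      rw [e]
      exact h9.add_mul_left_left _

/-- Let `m` be an integer with `|m| ≥ 2`, `f(z) = z³ + 1/m³ ∈ ℚ[z]` and
`g₂(z) = z² - z/m + 1/m²`. For every `n ≥ 1`, the numerator (in lowest terms) of
`g₂(f^{2n-1}(0))` is not the cube of an integer. -/
theorem stmt16 (m : ℤ) (hm : 2 ≤ |m|)
    (f : ℚ[X]) (hf : f = X ^ 3 + C (1 / (m : ℚ) ^ 3))
    (g₂ : ℚ[X]) (hg₂ : g₂ = X ^ 2 - C (1 / (m : ℚ)) * X + C (1 / (m : ℚ) ^ 2)) :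
    ∀ n : ℕ, 1 ≤ n →
      ¬ ∃ k : ℤ, (g₂.eval (((f.comp ·)^[2 * n - 1] X).eval 0)).num = k ^ 3 := by
  intro n hn
  rintro ⟨k, hk⟩
  have hm0 : m ≠ 0 := by rintro rfl; simp at hm
  have hmq : (m : ℚ) ≠ 0 := by exact_mod_cast hm0
  obtain ⟨j, rfl⟩ : ∃ j, n = j + 1 := ⟨n - 1, by omega⟩
  obtain ⟨c, u, h1, ⟨u₁, hu₁⟩, h3⟩ := orbit_even m hm0 f hf j
  obtain ⟨A, hA⟩ : ∃ A : ℤ, A = (u ^ 3 + m ^ (24 * c)) ^ 2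
    - (u ^ 3 + m ^ (24 * c)) * m ^ (24 * c + 2) + m ^ (48 * c + 4) := ⟨_, rfl⟩
  have hval : g₂.eval (((f.comp ·)^[2 * (j + 1) - 1] X).eval 0)
      = (A : ℚ) / ((m ^ (48 * c + 6) : ℤ) : ℚ) := by
    rw [show 2 * (j + 1) - 1 = 2 * j + 1 by omega, Function.iterate_succ_apply', eval_comp, h1,
      hf, hg₂, hA]
    simp only [eval_add, eval_sub, eval_mul, eval_pow, eval_X, eval_C]
    push_cast
    field_simp
    ring
  have hcop : IsCoprime A m := by
    have h9 : IsCoprime ((u ^ 3 + m ^ (24 * c)) ^ 2) m := h3.pow_left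
    have e : A = (u ^ 3 + m ^ (24 * c)) ^ 2 + m * (-(u ^ 3 + m ^ (24 * c)) * m ^ (24 * c + 1)
        + m ^ (48 * c + 3)) := by rw [hA]; ring
    rw [e]
    exact h9.add_mul_left_left _
  have hnum : (g₂.eval (((f.comp ·)^[2 * (j + 1) - 1] X).eval 0)).num = A := by
    rw [hval]
    apply Rat.num_div_eq_of_coprime
    · exact Even.pow_pos ⟨24 * c + 3, by ring⟩ hm0
    · exact Int.isCoprime_iff_nat_coprime.mp hcop.pow_right
  rw [hnum] at hk
  obtain ⟨D, hD⟩ : ∃ D : ℤ, D = m ^ 4 - m ^ 2 + 1 := ⟨_, rfl⟩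
  rw [← hD] at hu₁
  have hDm : IsCoprime D m := ⟨1, -(m ^ 3 - m), by rw [hD]; ring⟩
  have hfac : D * ((m ^ (24 * c)) ^ 2 + D * (D * (u₁ ^ 3 * m ^ (24 * c) * (2 - m ^ 2)
      + D ^ 3 * u₁ ^ 6))) = k ^ 3 := by
    rw [← hk, hA, hu₁]
    have e1 : m ^ (24 * c + 2) = m ^ (24 * c) * m ^ 2 := by ring
    have e2 : m ^ (48 * c + 4) = (m ^ (24 * c)) ^ 2 * m ^ 4 := by ring
    rw [e1, e2]
    have : m ^ 4 = D + m ^ 2 - 1 := by rw [hD]; ring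
    rw [this]
    ring
  have hc2 : IsCoprime D ((m ^ (24 * c)) ^ 2 + D * (D * (u₁ ^ 3 * m ^ (24 * c) * (2 - m ^ 2)
      + D ^ 3 * u₁ ^ 6))) := by
    apply IsCoprime.add_mul_left_right
    exact hDm.pow_right.pow_right
  obtain ⟨y, hy⟩ := Int.eq_pow_of_mul_eq_pow_odd_left hc2 (by decide : Odd 3) hfac
  exact phi12_not_cube m hm y (by rw [← hD, hy])
end
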